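/- arXiv:2302.03407 — 2 statements merged into one kernel-verified Lean document; each statement's English description precedes it below -/
import Mathlib

section
/- Under the smoothness and convexity assumptions, choose μ_k = μ̄(k+1)^{−p} with μ̄ ∈ (0,1/2] and 0 < p < 1/4, step sizes β_k ∈ [β̄(k+1)^{−τ/2}, 1/(L_{Fy2}+L_{fy2})], η_k = (k+1)^{−τ/2} β_k, α_k = (k+1)^{−3τ/2} β_k μ_k³, with 0 < τ < 1/12, and let (x_k, y_k, v_k) be the sequence generated by sl-BAMM. If the sequence (‖v*_{μ_k}(x_k)‖) is bounded, then there is a constant C > 0 such that for all K ≥ 1, min_{0≤k≤K} Π(x_k, y_k, v_k) ≤ C · K^{−(1−3p−3τ)}. If in addition (v_k) is bounded, then there is a constant C' > 0 such that for all K ≥ 1, min_{0≤k≤K} KKT(x_k, y_k, v_k) ≤ C'(K^{−(1−3p−3τ)} + K^{−2p}); moreover every limit point of (x_k, y_k) is a KKT point of the equality-constrained reformulation, and ‖x_{k+1} − x_k‖ = O(k^{−3p/2−τ/4}). -/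
open Set Filter Asymptotics
open scoped NNReal

noncomputable section

/-- `ℝⁿ` as a Euclidean space. -/
abbrev Eu (n : ℕ) : Type := EuclideanSpace ℝ (Fin n)

variable {n m : ℕ}

/-- Partial gradient with respect to the first (upper-level) variable. -/
def gradx (F : Eu n → Eu m → ℝ) (x : Eu n) (y : Eu m) : Eu n :=
  gradient (fun x' => F x' y) x

/-- Partial gradient with respect to the second (lower-level) variable. -/
def grady (F : Eu n → Eu m → ℝ) (x : Eu n) (y : Eu m) : Eu m :=
  gradient (fun y' => F x y') y

/-- Second-order partial derivative `∇²_{yy}`. -/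
def hessyy (F : Eu n → Eu m → ℝ) (x : Eu n) (y : Eu m) : Eu m →L[ℝ] Eu m :=
  fderiv ℝ (fun y' => grady F x y') y

/-- Mixed second-order partial derivative `∇²_{xy}`, viewed as the linear map
sending a multiplier `v ∈ ℝᵐ` to an element of `ℝⁿ`. -/
def hessxy (F : Eu n → Eu m → ℝ) (x : Eu n) (y : Eu m) : Eu m →L[ℝ] Eu n :=
  ContinuousLinearMap.adjoint (fderiv ℝ (fun x' => grady F x' y) x)

/-- The aggregation function `ψ_μ = μ F + (1-μ) f`. -/
def aggreg (μ : ℝ) (F f : Eu n → Eu m → ℝ) : Eu n → Eu m → ℝ :=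
  fun x y => μ * F x y + (1 - μ) * f x y

/-- The squared KKT residual of the equality-constrained reformulation
`min F(x,y) s.t. ∇_y f(x,y) = 0`. -/
def KKTres (F f : Eu n → Eu m → ℝ) (x : Eu n) (y v : Eu m) : ℝ :=
  ‖gradx F x y - hessxy f x y v‖ ^ 2 + ‖grady F x y - hessyy f x y v‖ ^ 2 +
    ‖grady f x y‖ ^ 2

namespace BAMM

open scoped RealInnerProductSpace Topology

section Calculus

variable {G : Eu n → Eu m → ℝ}

lemma hasGradientAt_gradx (hG : ContDiff ℝ 2 (Function.uncurry G)) (x : Eu n) (y : Eu m) :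
    HasGradientAt (fun x' => G x' y) (gradx G x y) x := by
  have h : DifferentiableAt ℝ (fun x' => Function.uncurry G (x', y)) x :=
    DifferentiableAt.comp (f := fun x' => (x', y)) x
      ((hG.differentiable (by norm_num)) (x, y)) (by fun_prop)
  exact h.hasGradientAt

lemma hasGradientAt_grady (hG : ContDiff ℝ 2 (Function.uncurry G)) (x : Eu n) (y : Eu m) :
    HasGradientAt (fun y' => G x y') (grady G x y) y := by
  have h : DifferentiableAt ℝ (fun y' => Function.uncurry G (x, y')) y :=
    DifferentiableAt.comp (f := fun y' => (x, y')) y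
      ((hG.differentiable (by norm_num)) (x, y)) (by fun_prop)
  exact h.hasGradientAt

lemma inner_gradx (hG : ContDiff ℝ 2 (Function.uncurry G)) (x h : Eu n) (y : Eu m) :
    fderiv ℝ (Function.uncurry G) (x, y) (h, 0) = ⟪gradx G x y, h⟫ := by
  have h1 := HasFDerivAt.comp (f := fun x' => (x', y)) x
    ((hG.differentiable (by norm_num)) (x, y)).hasFDerivAt (hasFDerivAt_prodMk_left x y)
  have h2 := (hasGradientAt_gradx hG x y).hasFDerivAt
  have := congrArg (fun T => T h) (h1.unique h2)
  simpa using this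

lemma inner_grady (hG : ContDiff ℝ 2 (Function.uncurry G)) (x : Eu n) (y h : Eu m) :
    fderiv ℝ (Function.uncurry G) (x, y) (0, h) = ⟪grady G x y, h⟫ := by
  have h1 := HasFDerivAt.comp (f := fun y' => (x, y')) y
    ((hG.differentiable (by norm_num)) (x, y)).hasFDerivAt (hasFDerivAt_prodMk_right x y)
  have h2 := (hasGradientAt_grady hG x y).hasFDerivAt
  have := congrArg (fun T => T h) (h1.unique h2)
  simpa using this

lemma fderiv_uncurry_apply (hG : ContDiff ℝ 2 (Function.uncurry G)) (x h : Eu n) (y l : Eu m) :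
    fderiv ℝ (Function.uncurry G) (x, y) (h, l) = ⟪gradx G x y, h⟫ + ⟪grady G x y, l⟫ := by
  rw [← inner_gradx hG, ← inner_grady hG, ← map_add]
  simp

lemma contDiff_grady (hG : ContDiff ℝ 2 (Function.uncurry G)) :
    ContDiff ℝ 1 (Function.uncurry (grady G)) := by
  have h1 : ContDiff ℝ 1 (fderiv ℝ (Function.uncurry G)) :=
    hG.fderiv_right (by norm_num)
  have h2 : Function.uncurry (grady G) = fun z =>
      (InnerProductSpace.toDual ℝ (Eu m)).symm
        ((fderiv ℝ (Function.uncurry G) z).comp (ContinuousLinearMap.inr ℝ (Eu n) (Eu m))) := by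
    ext1 ⟨x, y⟩
    rw [LinearIsometryEquiv.eq_symm_apply]
    ext h
    simp [inner_grady hG]
  rw [h2]
  exact (LinearIsometryEquiv.contDiff _).comp (h1.clm_comp contDiff_const)

lemma hasFDerivAt_grady_left (hG : ContDiff ℝ 2 (Function.uncurry G)) (x : Eu n) (y : Eu m) :
    HasFDerivAt (fun x' => grady G x' y) (fderiv ℝ (fun x' => grady G x' y) x) x := by
  have h : DifferentiableAt ℝ (fun x' => Function.uncurry (grady G) (x', y)) x :=
    DifferentiableAt.comp (g := Function.uncurry (grady G)) (f := fun x' => (x', y)) x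
      (((contDiff_grady hG).differentiable (by norm_num)) (x, y)) (by fun_prop)
  exact h.hasFDerivAt

lemma hasFDerivAt_hessyy (hG : ContDiff ℝ 2 (Function.uncurry G)) (x : Eu n) (y : Eu m) :
    HasFDerivAt (fun y' => grady G x y') (hessyy G x y) y := by
  have h : DifferentiableAt ℝ (fun y' => Function.uncurry (grady G) (x, y')) y :=
    DifferentiableAt.comp (g := Function.uncurry (grady G)) (f := fun y' => (x, y')) y
      (((contDiff_grady hG).differentiable (by norm_num)) (x, y)) (by fun_prop)
  exact h.hasFDerivAt

lemma fderiv_uncurry_grady_apply (hG : ContDiff ℝ 2 (Function.uncurry G)) (x h : Eu n)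
    (y l : Eu m) :
    fderiv ℝ (Function.uncurry (grady G)) (x, y) (h, l) =
      ContinuousLinearMap.adjoint (hessxy G x y) h + hessyy G x y l := by
  have h0 := (((contDiff_grady hG).differentiable (by norm_num)) (x, y)).hasFDerivAt
  have h1 := HasFDerivAt.comp (f := fun x' => (x', y)) x h0 (hasFDerivAt_prodMk_left x y)
  have h2 := HasFDerivAt.comp (f := fun y' => (x, y')) y h0 (hasFDerivAt_prodMk_right x y)
  have e1 := congrArg (fun T => T h) (h1.unique (hasFDerivAt_grady_left hG x y))
  have e2 := congrArg (fun T => T l) (h2.unique (hasFDerivAt_hessyy hG x y))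
  simp only [ContinuousLinearMap.comp_apply, ContinuousLinearMap.inl_apply,
    ContinuousLinearMap.inr_apply] at e1 e2
  rw [hessxy, ContinuousLinearMap.adjoint_adjoint, ← e1, ← e2, ← map_add]
  simp

lemma hessyy_symm (hG : ContDiff ℝ 2 (Function.uncurry G)) (x : Eu n) (y u w : Eu m) :
    ⟪hessyy G x y u, w⟫ = ⟪u, hessyy G x y w⟫ := by
  have h1 : ∀ y', HasFDerivAt (fun y' => G x y')
      (InnerProductSpace.toDual ℝ (Eu m) (grady G x y')) y' :=
    fun y' => (hasGradientAt_grady hG x y').hasFDerivAt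
  have h2 := ((InnerProductSpace.toDual ℝ (Eu m)).toContinuousLinearEquiv
    |>.toContinuousLinearMap.hasFDerivAt).comp y (hasFDerivAt_hessyy hG x y)
  have := second_derivative_symmetric h1 h2 u w
  simp at this
  rw [this, real_inner_comm]

lemma norm_hessyy_le (L : ℝ≥0) (h : ∀ x, LipschitzWith L fun y => grady G x y)
    (x : Eu n) (y : Eu m) : ‖hessyy G x y‖ ≤ L :=
  norm_fderiv_le_of_lipschitz ℝ (h x)

lemma norm_hessxy_le (L : ℝ≥0) (h : ∀ y, LipschitzWith L fun x => grady G x y)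
    (x : Eu n) (y : Eu m) : ‖hessxy G x y‖ ≤ L := by
  rw [hessxy, LinearIsometryEquiv.norm_map]
  exact norm_fderiv_le_of_lipschitz ℝ (h y)

end Calculus

section Aggregate

variable {F f : Eu n → Eu m → ℝ}

lemma contDiff_aggreg (hF : ContDiff ℝ 2 (Function.uncurry F))
    (hf : ContDiff ℝ 2 (Function.uncurry f)) (μ : ℝ) :
    ContDiff ℝ 2 (Function.uncurry (aggreg μ F f)) := by
  have : Function.uncurry (aggreg μ F f) =
      fun z => μ * Function.uncurry F z + (1 - μ) * Function.uncurry f z := by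
    ext ⟨x, y⟩; rfl
  rw [this]
  fun_prop

lemma grady_aggreg (hF : ContDiff ℝ 2 (Function.uncurry F))
    (hf : ContDiff ℝ 2 (Function.uncurry f)) (μ : ℝ) (x : Eu n) (y : Eu m) :
    grady (aggreg μ F f) x y = μ • grady F x y + (1 - μ) • grady f x y := by
  refine HasGradientAt.gradient ?_
  have := ((hasGradientAt_grady hF x y).hasFDerivAt.const_mul μ).add
    ((hasGradientAt_grady hf x y).hasFDerivAt.const_mul (1 - μ))
  rw [hasGradientAt_iff_hasFDerivAt]
  refine this.congr_fderiv ?_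
  ext h
  simp

lemma hessyy_aggreg (hF : ContDiff ℝ 2 (Function.uncurry F))
    (hf : ContDiff ℝ 2 (Function.uncurry f)) (μ : ℝ) (x : Eu n) (y : Eu m) :
    hessyy (aggreg μ F f) x y = μ • hessyy F x y + (1 - μ) • hessyy f x y := by
  rw [hessyy]
  simp_rw [grady_aggreg hF hf]
  exact (((hasFDerivAt_hessyy hF x y).const_smul μ).add
    ((hasFDerivAt_hessyy hf x y).const_smul (1 - μ))).fderiv

lemma hessxy_aggreg (hF : ContDiff ℝ 2 (Function.uncurry F))
    (hf : ContDiff ℝ 2 (Function.uncurry f)) (μ : ℝ) (x : Eu n) (y : Eu m) :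
    hessxy (aggreg μ F f) x y = μ • hessxy F x y + (1 - μ) • hessxy f x y := by
  rw [hessxy]
  simp_rw [grady_aggreg hF hf]
  have := (((hasFDerivAt_grady_left hF x y).const_smul μ).add
    ((hasFDerivAt_grady_left hf x y).const_smul (1 - μ))).fderiv
  refine (congrArg _ this).trans ?_
  simp [hessxy]

end Aggregate

section Convexity

variable {h : Eu m → ℝ} {g : Eu m → Eu m} {σ : ℝ}

/-- First-order characterization of strong convexity. -/
lemma _root_.StrongConvexOn.add_inner_add_le (hh : StrongConvexOn univ σ h) {y g : Eu m}
    (hg : HasGradientAt h g y) (z : Eu m) :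
    h y + ⟪g, z - y⟫ + σ / 2 * ‖z - y‖ ^ 2 ≤ h z := by
  have hd : HasDerivAt (fun t : ℝ => h (y + t • (z - y))) ⟪g, z - y⟫ 0 := by
    have h1 : HasDerivAt (fun t : ℝ => y + t • (z - y)) (z - y) 0 := by
      simpa using ((hasDerivAt_id (0 : ℝ)).smul_const (z - y)).const_add y
    have h2 : HasFDerivAt h (InnerProductSpace.toDual ℝ (Eu m) g) (y + (0 : ℝ) • (z - y)) := by
      simpa using hg.hasFDerivAt
    simpa [Function.comp_def] using h2.comp_hasDerivAt (0 : ℝ) h1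
  have hl : Tendsto (fun t : ℝ => t⁻¹ * (h (y + t • (z - y)) - h y)) (𝓝[>] 0)
      (𝓝 ⟪g, z - y⟫) := by
    simpa using hd.tendsto_slope_zero_right
  have hr : Tendsto (fun t : ℝ => h z - h y - (1 - t) * (σ / 2 * ‖z - y‖ ^ 2)) (𝓝[>] 0)
      (𝓝 (h z - h y - (1 - 0) * (σ / 2 * ‖z - y‖ ^ 2))) := by
    refine Tendsto.mono_left (Continuous.tendsto ?_ 0) nhdsWithin_le_nhds
    fun_prop
  have := le_of_tendsto_of_tendsto hl hr (by
    filter_upwards [Ioo_mem_nhdsGT (zero_lt_one' ℝ)] with t ht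
    have h3 := hh.2 (mem_univ y) (mem_univ z) (sub_nonneg.2 ht.2.le) ht.1.le (by ring)
    have h4 : (1 - t) • y + t • z = y + t • (z - y) := by module
    rw [h4, norm_sub_rev y z] at h3
    simp only [smul_eq_mul] at h3
    rw [inv_mul_le_iff₀ ht.1]
    linarith)
  linarith

lemma _root_.StrongConvexOn.le_inner_sub (hh : StrongConvexOn univ σ h)
    (hg : ∀ y, HasGradientAt h (g y) y) (y z : Eu m) :
    σ * ‖z - y‖ ^ 2 ≤ ⟪g z - g y, z - y⟫ := by
  have h1 := hh.add_inner_add_le (hg y) z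
  have h2 := hh.add_inner_add_le (hg z) y
  rw [norm_sub_rev, ← neg_sub z y, inner_neg_right] at h2
  rw [inner_sub_left]
  linarith

lemma _root_.StrongConvexOn.le_inner_hess (hh : StrongConvexOn univ σ h)
    (hg : ∀ y, HasGradientAt h (g y) y) {y : Eu m} {H : Eu m →L[ℝ] Eu m}
    (hH : HasFDerivAt g H y) (u : Eu m) :
    σ * ‖u‖ ^ 2 ≤ ⟪H u, u⟫ := by
  have hd : HasDerivAt (fun t : ℝ => ⟪g (y + t • u), u⟫) ⟪H u, u⟫ 0 := by
    have h1 : HasDerivAt (fun t : ℝ => y + t • u) u 0 := by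
      simpa using ((hasDerivAt_id (0 : ℝ)).smul_const u).const_add y
    have h2 : HasFDerivAt g H (y + (0 : ℝ) • u) := by simpa using hH
    simpa using (h2.comp_hasDerivAt (0 : ℝ) h1).inner ℝ (hasDerivAt_const (0 : ℝ) u)
  have hl : Tendsto (fun t : ℝ => t⁻¹ * (⟪g (y + t • u), u⟫ - ⟪g y, u⟫)) (𝓝[>] 0)
      (𝓝 ⟪H u, u⟫) := by
    simpa using hd.tendsto_slope_zero_right
  refine ge_of_tendsto hl ?_
  filter_upwards [self_mem_nhdsWithin] with t (ht : 0 < t)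
  have h3 := hh.le_inner_sub hg y (y + t • u)
  rw [add_sub_cancel_left, norm_smul, inner_smul_right, Real.norm_of_nonneg ht.le,
    inner_sub_left] at h3
  rw [le_inv_mul_iff₀ ht]
  refine le_of_mul_le_mul_left ?_ ht
  linarith

end Convexity

section Operators

variable {T : Eu m →L[ℝ] Eu m}

/-- A step of size `η ≤ 1 / L` along a symmetric operator with spectrum in `[c, L]` contracts. -/
lemma norm_sub_smul_sq_le {c L η : ℝ} (hs : ∀ u w, ⟪T u, w⟫ = ⟪u, T w⟫)
    (hc : ∀ u, c * ‖u‖ ^ 2 ≤ ⟪T u, u⟫) (hc0 : 0 ≤ c) (hL : ‖T‖ ≤ L)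
    (hη : 0 ≤ η) (hηL : η * L ≤ 1) (u : Eu m) :
    ‖u - η • T u‖ ^ 2 ≤ (1 - η * c) * ‖u‖ ^ 2 := by
  have hpos : ∀ w, 0 ≤ ⟪T w, w⟫ := fun w => (by positivity : 0 ≤ c * ‖w‖ ^ 2).trans (hc w)
  have hcs : ‖T u‖ ^ 2 * ‖T u‖ ^ 2 ≤ ⟪T u, u⟫ * (L * ‖T u‖ ^ 2) := by
    have h1 : ⟪T (T u), T u⟫ ≤ L * ‖T u‖ ^ 2 := by
      refine (real_inner_le_norm _ _).trans ?_
      rw [sq, ← mul_assoc]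
      gcongr
      exact (T.le_opNorm _).trans (by gcongr)
    have h2 : ∀ s : ℝ, 0 ≤ ⟪T (T u), T u⟫ * (s * s) + (2 * ‖T u‖ ^ 2) * s + ⟪T u, u⟫ := by
      intro s
      have := hpos (u + s • T u)
      rw [map_add, map_smul, inner_add_left, inner_add_right, inner_add_right,
        inner_smul_left, inner_smul_left, inner_smul_right, inner_smul_right,
        hs (T u) u, real_inner_self_eq_norm_sq] at this
      simp only [conj_trivial] at this
      linarith
    have h3 := discrim_le_zero h2
    rw [discrim] at h3
    have := mul_le_mul_of_nonneg_left h1 (hpos u)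
    nlinarith
  have hTu : ‖T u‖ ^ 2 ≤ L * ⟪T u, u⟫ := by
    rcases (sq_nonneg ‖T u‖).eq_or_lt with h0 | h0
    · rw [← h0]
      exact mul_nonneg ((norm_nonneg _).trans hL) (hpos u)
    · refine le_of_mul_le_mul_right ?_ h0
      linarith
  rw [norm_sub_sq_real, inner_smul_right, norm_smul, mul_pow, Real.norm_eq_abs, sq_abs,
    real_inner_comm]
  have h4 : η ^ 2 * ‖T u‖ ^ 2 ≤ η * ⟪T u, u⟫ := by
    have := mul_le_mul_of_nonneg_left hTu (sq_nonneg η)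
    have h5 := mul_le_mul_of_nonneg_right hηL (mul_nonneg hη (hpos u))
    nlinarith
  have h6 := mul_le_mul_of_nonneg_left (hc u) hη
  nlinarith

lemma mul_norm_le_of_coercive {c : ℝ} (hc : ∀ u, c * ‖u‖ ^ 2 ≤ ⟪T u, u⟫) (u : Eu m) :
    c * ‖u‖ ≤ ‖T u‖ := by
  rcases (norm_nonneg u).eq_or_lt with h0 | h0
  · rw [← h0]; simp
  · refine le_of_mul_le_mul_right ?_ h0
    have := (hc u).trans (real_inner_le_norm _ _)
    nlinarith

lemma apply_inverse_of_coercive {c : ℝ} (hc0 : 0 < c) (hc : ∀ u, c * ‖u‖ ^ 2 ≤ ⟪T u, u⟫)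
    (b : Eu m) : T (T.inverse b) = b := by
  have hinj : Function.Injective (T : Eu m →ₗ[ℝ] Eu m) := by
    rw [← LinearMap.ker_eq_bot, LinearMap.ker_eq_bot']
    intro u hu
    have h1 := mul_norm_le_of_coercive hc u
    rw [show T u = 0 from hu, norm_zero] at h1
    have := nonpos_of_mul_nonpos_right h1 hc0
    exact norm_le_zero_iff.1 this
  let e := (LinearEquiv.ofInjectiveEndo (T : Eu m →ₗ[ℝ] Eu m) hinj).toContinuousLinearEquiv
  have he : T = (e : Eu m →L[ℝ] Eu m) := by ext1 u; rfl
  rw [he, ContinuousLinearMap.inverse_equiv]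
  simp

end Operators

section Problem

/-- Lipschitz continuity in both variables with respect to the sum of the two distances. -/
def JointLip {W : Type*} [NormedAddCommGroup W] (M : ℝ) (φ : Eu n → Eu m → W) : Prop :=
  ∀ x y x' y', ‖φ x' y' - φ x y‖ ≤ M * (‖x' - x‖ + ‖y' - y‖)

lemma JointLip.of_lipschitzWith {W : Type*} [NormedAddCommGroup W] {φ : Eu n → Eu m → W}
    {K₁ K₂ : ℝ≥0} {M : ℝ} (h₁ : ∀ y, LipschitzWith K₁ fun x => φ x y)
    (h₂ : ∀ x, LipschitzWith K₂ fun y => φ x y) (hK₁ : K₁ ≤ M) (hK₂ : K₂ ≤ M) :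
    JointLip M φ := by
  intro x y x' y'
  have e1 := (h₁ y').norm_sub_le x' x
  have e2 := (h₂ x).norm_sub_le y' y
  calc ‖φ x' y' - φ x y‖ = ‖(φ x' y' - φ x y') + (φ x y' - φ x y)‖ := by congr 1; abel
    _ ≤ K₁ * ‖x' - x‖ + K₂ * ‖y' - y‖ := (norm_add_le _ _).trans (add_le_add e1 e2)
    _ ≤ M * ‖x' - x‖ + M * ‖y' - y‖ := by gcongr
    _ = _ := by ring

lemma JointLip.convexComb {W : Type*} [NormedAddCommGroup W] [NormedSpace ℝ W] {M μ : ℝ}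
    {φ χ : Eu n → Eu m → W} (hφ : JointLip M φ) (hχ : JointLip M χ) (hμ : μ ∈ Ioc (0 : ℝ) (1 / 2)) :
    JointLip M fun x y => μ • φ x y + (1 - μ) • χ x y := by
  intro x y x' y'
  have h1 : 0 ≤ 1 - μ := by linarith [hμ.2]
  calc ‖μ • φ x' y' + (1 - μ) • χ x' y' - (μ • φ x y + (1 - μ) • χ x y)‖
      = ‖μ • (φ x' y' - φ x y) + (1 - μ) • (χ x' y' - χ x y)‖ := by congr 1; module
    _ ≤ μ * ‖φ x' y' - φ x y‖ + (1 - μ) * ‖χ x' y' - χ x y‖ := by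
        refine (norm_add_le _ _).trans_eq ?_
        rw [norm_smul, norm_smul, Real.norm_of_nonneg hμ.1.le, Real.norm_of_nonneg h1]
    _ ≤ μ * (M * (‖x' - x‖ + ‖y' - y‖)) + (1 - μ) * (M * (‖x' - x‖ + ‖y' - y‖)) := by
        have := hμ.1.le
        gcongr
        exacts [hφ _ _ _ _, hχ _ _ _ _]
    _ = _ := by ring

lemma JointLip.tendsto {W ι : Type*} [NormedAddCommGroup W] {M : ℝ} {φ : Eu n → Eu m → W}
    (hφ : JointLip M φ) {l : Filter ι} {x : ι → Eu n} {y : ι → Eu m} {a : Eu n} {b : Eu m}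
    (hx : Tendsto x l (𝓝 a)) (hy : Tendsto y l (𝓝 b)) :
    Tendsto (fun i => φ (x i) (y i)) l (𝓝 (φ a b)) := by
  rw [tendsto_iff_norm_sub_tendsto_zero] at hx hy ⊢
  refine squeeze_zero (fun _ => norm_nonneg _) (fun i => hφ a b (x i) (y i)) ?_
  simpa using (hx.add hy).const_mul M

/-- The smoothness and convexity assumptions, with uniform constants, together with the lower-level
solution map `ystar` and the multiplier map `vstar`. -/
structure Problem (F f : Eu n → Eu m → ℝ) (ystar : ℝ → Eu n → Eu m) (vstar : ℝ → Eu n → Eu m)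
    (σ M L : ℝ) : Prop where
  contDiff_F : ContDiff ℝ 2 (Function.uncurry F)
  contDiff_f : ContDiff ℝ 2 (Function.uncurry f)
  lip_gradx_F : JointLip M (gradx F)
  lip_grady_F : JointLip M (grady F)
  lip_grady_f : JointLip M (grady f)
  lip_hessxy_F : JointLip M (hessxy F)
  lip_hessxy_f : JointLip M (hessxy f)
  lip_hessyy_F : JointLip M (hessyy F)
  lip_hessyy_f : JointLip M (hessyy f)
  norm_hessxy_F : ∀ x y, ‖hessxy F x y‖ ≤ M
  norm_hessxy_f : ∀ x y, ‖hessxy f x y‖ ≤ M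
  norm_hessyy_F : ∀ x y, ‖hessyy F x y‖ ≤ M
  norm_hessyy_f : ∀ x y, ‖hessyy f x y‖ ≤ M
  norm_hessyy_add : ∀ x y, ‖hessyy F x y‖ + ‖hessyy f x y‖ ≤ L
  M_nonneg : 0 ≤ M
  σ_pos : 0 < σ
  strongConvex : ∀ x, StrongConvexOn univ σ (F x)
  convex : ∀ x, ConvexOn ℝ univ (f x)
  isMin : ∀ μ ∈ Ioc (0 : ℝ) 1, ∀ x y, aggreg μ F f x (ystar μ x) ≤ aggreg μ F f x y
  vstar_eq : ∀ μ x, vstar μ x =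
    (hessyy (aggreg μ F f) x (ystar μ x)).inverse (grady F x (ystar μ x))

variable {F f : Eu n → Eu m → ℝ} {ystar vstar : ℝ → Eu n → Eu m} {σ M L μ μ' D : ℝ}

namespace Problem

lemma strongConvex_zero_f (P : Problem F f ystar vstar σ M L) (x : Eu n) :
    StrongConvexOn univ 0 (f x) := strongConvexOn_zero.2 (P.convex x)

lemma contDiff_aggreg (P : Problem F f ystar vstar σ M L) (μ : ℝ) :
    ContDiff ℝ 2 (Function.uncurry (aggreg μ F f)) :=
  BAMM.contDiff_aggreg P.contDiff_F P.contDiff_f μ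

lemma grady_aggreg (P : Problem F f ystar vstar σ M L) (μ : ℝ) (x : Eu n) (y : Eu m) :
    grady (aggreg μ F f) x y = μ • grady F x y + (1 - μ) • grady f x y :=
  BAMM.grady_aggreg P.contDiff_F P.contDiff_f μ x y

lemma hessyy_aggreg (P : Problem F f ystar vstar σ M L) (μ : ℝ) (x : Eu n) (y : Eu m) :
    hessyy (aggreg μ F f) x y = μ • hessyy F x y + (1 - μ) • hessyy f x y :=
  BAMM.hessyy_aggreg P.contDiff_F P.contDiff_f μ x y

lemma hessxy_aggreg (P : Problem F f ystar vstar σ M L) (μ : ℝ) (x : Eu n) (y : Eu m) :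
    hessxy (aggreg μ F f) x y = μ • hessxy F x y + (1 - μ) • hessxy f x y :=
  BAMM.hessxy_aggreg P.contDiff_F P.contDiff_f μ x y

lemma lip_grady_aggreg (P : Problem F f ystar vstar σ M L) (hμ : μ ∈ Ioc (0 : ℝ) (1 / 2)) :
    JointLip M (grady (aggreg μ F f)) := by
  convert P.lip_grady_F.convexComb P.lip_grady_f hμ using 3
  exact P.grady_aggreg _ _ _

lemma lip_hessxy_aggreg (P : Problem F f ystar vstar σ M L) (hμ : μ ∈ Ioc (0 : ℝ) (1 / 2)) :
    JointLip M (hessxy (aggreg μ F f)) := by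
  convert P.lip_hessxy_F.convexComb P.lip_hessxy_f hμ using 3
  exact P.hessxy_aggreg _ _ _

lemma lip_hessyy_aggreg (P : Problem F f ystar vstar σ M L) (hμ : μ ∈ Ioc (0 : ℝ) (1 / 2)) :
    JointLip M (hessyy (aggreg μ F f)) := by
  convert P.lip_hessyy_F.convexComb P.lip_hessyy_f hμ using 3
  exact P.hessyy_aggreg _ _ _

lemma _root_.BAMM.norm_convexComb_le {W : Type*} [NormedAddCommGroup W] [NormedSpace ℝ W]
    {a b : W} {R : ℝ} (hμ : μ ∈ Ioc (0 : ℝ) (1 / 2)) (ha : ‖a‖ ≤ R) (hb : ‖b‖ ≤ R) :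
    ‖μ • a + (1 - μ) • b‖ ≤ R := by
  have h1 : 0 ≤ 1 - μ := by linarith [hμ.2]
  refine (norm_add_le _ _).trans ?_
  rw [norm_smul, norm_smul, Real.norm_of_nonneg hμ.1.le, Real.norm_of_nonneg h1]
  have := mul_le_mul_of_nonneg_left ha hμ.1.le
  have := mul_le_mul_of_nonneg_left hb h1
  linarith

lemma norm_hessxy_aggreg (P : Problem F f ystar vstar σ M L) (hμ : μ ∈ Ioc (0 : ℝ) (1 / 2))
    (x : Eu n) (y : Eu m) : ‖hessxy (aggreg μ F f) x y‖ ≤ M := by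
  rw [P.hessxy_aggreg]
  exact norm_convexComb_le hμ (P.norm_hessxy_F x y) (P.norm_hessxy_f x y)

lemma norm_hessyy_aggreg (P : Problem F f ystar vstar σ M L) (hμ : μ ∈ Ioc (0 : ℝ) (1 / 2))
    (x : Eu n) (y : Eu m) : ‖hessyy (aggreg μ F f) x y‖ ≤ M := by
  rw [P.hessyy_aggreg]
  exact norm_convexComb_le hμ (P.norm_hessyy_F x y) (P.norm_hessyy_f x y)

lemma norm_hessyy_aggreg' (P : Problem F f ystar vstar σ M L) (hμ : μ ∈ Ioc (0 : ℝ) (1 / 2))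
    (x : Eu n) (y : Eu m) : ‖hessyy (aggreg μ F f) x y‖ ≤ L := by
  rw [P.hessyy_aggreg]
  have := P.norm_hessyy_add x y
  exact norm_convexComb_le hμ (by linarith [norm_nonneg (hessyy f x y)])
    (by linarith [norm_nonneg (hessyy F x y)])

lemma hessyy_coercive (P : Problem F f ystar vstar σ M L) (hμ : μ ∈ Ioc (0 : ℝ) (1 / 2))
    (x : Eu n) (y u : Eu m) : μ * σ * ‖u‖ ^ 2 ≤ ⟪hessyy (aggreg μ F f) x y u, u⟫ := by
  have h1 := (P.strongConvex x).le_inner_hess (hasGradientAt_grady P.contDiff_F x)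
    (hasFDerivAt_hessyy P.contDiff_F x y) u
  have h2 := (P.strongConvex_zero_f x).le_inner_hess (hasGradientAt_grady P.contDiff_f x)
    (hasFDerivAt_hessyy P.contDiff_f x y) u
  have h3 : 0 ≤ 1 - μ := by linarith [hμ.2]
  rw [P.hessyy_aggreg]
  simp only [_root_.add_apply, _root_.smul_apply, inner_add_left, inner_smul_left, conj_trivial]
  have := mul_le_mul_of_nonneg_left h1 hμ.1.le
  have := mul_le_mul_of_nonneg_left h2 h3
  linarith

lemma grady_mono (P : Problem F f ystar vstar σ M L) (hμ : μ ∈ Ioc (0 : ℝ) (1 / 2))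
    (x : Eu n) (y z : Eu m) :
    μ * σ * ‖z - y‖ ^ 2 ≤
      ⟪grady (aggreg μ F f) x z - grady (aggreg μ F f) x y, z - y⟫ := by
  have h1 := (P.strongConvex x).le_inner_sub (hasGradientAt_grady P.contDiff_F x) y z
  have h2 := (P.strongConvex_zero_f x).le_inner_sub (hasGradientAt_grady P.contDiff_f x) y z
  have h3 : 0 ≤ 1 - μ := by linarith [hμ.2]
  have h4 : grady (aggreg μ F f) x z - grady (aggreg μ F f) x y =
      μ • (grady F x z - grady F x y) + (1 - μ) • (grady f x z - grady f x y) := by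
    rw [P.grady_aggreg, P.grady_aggreg]; module
  rw [h4, inner_add_left, inner_smul_left, inner_smul_left]
  simp only [conj_trivial]
  have := mul_le_mul_of_nonneg_left h1 hμ.1.le
  have := mul_le_mul_of_nonneg_left h2 h3
  linarith

lemma grady_ystar (P : Problem F f ystar vstar σ M L) (hμ : μ ∈ Ioc (0 : ℝ) (1 / 2)) (x : Eu n) :
    grady (aggreg μ F f) x (ystar μ x) = 0 := by
  have h1 : IsLocalMin (fun y => aggreg μ F f x y) (ystar μ x) :=
    Eventually.of_forall (P.isMin μ ⟨hμ.1, hμ.2.trans (by norm_num)⟩ x)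
  rw [grady, gradient, h1.fderiv_eq_zero, map_zero]

lemma norm_ystar_sub_le (P : Problem F f ystar vstar σ M L) (hμ : μ ∈ Ioc (0 : ℝ) (1 / 2))
    (x : Eu n) (y : Eu m) : μ * σ * ‖ystar μ x - y‖ ≤ ‖grady (aggreg μ F f) x y‖ := by
  rcases (norm_nonneg (ystar μ x - y)).eq_or_lt with h0 | h0
  · rw [← h0]; simp
  · refine le_of_mul_le_mul_right ?_ h0
    have := (P.grady_mono hμ x y (ystar μ x)).trans (real_inner_le_norm _ _)
    rw [P.grady_ystar hμ, zero_sub, norm_neg] at this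
    linarith

lemma hessyy_vstar (P : Problem F f ystar vstar σ M L) (hμ : μ ∈ Ioc (0 : ℝ) (1 / 2)) (x : Eu n) :
    hessyy (aggreg μ F f) x (ystar μ x) (vstar μ x) = grady F x (ystar μ x) := by
  rw [P.vstar_eq]
  exact apply_inverse_of_coercive (mul_pos hμ.1 P.σ_pos) (P.hessyy_coercive hμ x _) _

lemma norm_grady_F_ystar_le (P : Problem F f ystar vstar σ M L) (hμ : μ ∈ Ioc (0 : ℝ) (1 / 2))
    {x : Eu n} (hD : ‖vstar μ x‖ ≤ D) : ‖grady F x (ystar μ x)‖ ≤ M * D := by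
  rw [← P.hessyy_vstar hμ]
  exact ((hessyy _ _ _).le_opNorm _).trans
    (mul_le_mul (P.norm_hessyy_aggreg hμ _ _) hD (norm_nonneg _) P.M_nonneg)

/-- At the solution of the aggregated problem, `∇_y F - ∇_y f` is controlled by `∇_y F`. -/
lemma norm_grady_sub_ystar_le (P : Problem F f ystar vstar σ M L) (hμ : μ ∈ Ioc (0 : ℝ) (1 / 2))
    (x : Eu n) :
    ‖grady F x (ystar μ x) - grady f x (ystar μ x)‖ ≤ 2 * ‖grady F x (ystar μ x)‖ := by
  have h0 := P.grady_ystar hμ x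
  rw [P.grady_aggreg] at h0
  have h1 : grady F x (ystar μ x) =
      (1 - μ) • (grady F x (ystar μ x) - grady f x (ystar μ x)) := by
    rw [← sub_eq_zero, ← h0]; module
  have h2 := congrArg norm h1
  have h3 : 1 / 2 ≤ 1 - μ := by linarith [hμ.2]
  rw [norm_smul, Real.norm_of_nonneg (by linarith)] at h2
  have := mul_le_mul_of_nonneg_right h3
    (norm_nonneg (grady F x (ystar μ x) - grady f x (ystar μ x)))
  linarith

lemma grady_aggreg_shift (P : Problem F f ystar vstar σ M L) (μ μ' : ℝ) (x : Eu n) (y : Eu m) :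
    grady (aggreg μ' F f) x y =
      grady (aggreg μ F f) x y + (μ' - μ) • (grady F x y - grady f x y) := by
  rw [P.grady_aggreg, P.grady_aggreg]; module

lemma norm_grady_aggreg_ystar_le (P : Problem F f ystar vstar σ M L)
    (hμ : μ ∈ Ioc (0 : ℝ) (1 / 2)) {x : Eu n} (hD : ‖vstar μ x‖ ≤ D) (μ' : ℝ) :
    ‖grady (aggreg μ' F f) x (ystar μ x)‖ ≤ 2 * M * D * |μ' - μ| := by
  rw [P.grady_aggreg_shift μ, P.grady_ystar hμ, zero_add, norm_smul, Real.norm_eq_abs]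
  have h1 := P.norm_grady_sub_ystar_le hμ x
  have h2 := P.norm_grady_F_ystar_le hμ hD
  calc |μ' - μ| * _ ≤ |μ' - μ| * (2 * (M * D)) := by gcongr; linarith
    _ = _ := by ring

lemma norm_ystar_sub_ystar_le (P : Problem F f ystar vstar σ M L) (hμ : μ ∈ Ioc (0 : ℝ) (1 / 2))
    (hμ' : μ' ∈ Ioc (0 : ℝ) (1 / 2)) {x : Eu n} (hD : ‖vstar μ x‖ ≤ D) (x' : Eu n) :
    μ' * σ * ‖ystar μ' x' - ystar μ x‖ ≤ M * ‖x' - x‖ + 2 * M * D * |μ' - μ| := by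
  refine (P.norm_ystar_sub_le hμ' x' _).trans ?_
  have h1 := P.lip_grady_aggreg hμ' x (ystar μ x) x' (ystar μ x)
  have h2 := P.norm_grady_aggreg_ystar_le hμ hD μ'
  have h3 := norm_le_norm_sub_add (grady (aggreg μ' F f) x' (ystar μ x))
    (grady (aggreg μ' F f) x (ystar μ x))
  simp only [sub_self, norm_zero, add_zero] at h1
  linarith

lemma norm_vstar_sub_vstar_le (P : Problem F f ystar vstar σ M L) (hμ : μ ∈ Ioc (0 : ℝ) (1 / 2))
    (hμ' : μ' ∈ Ioc (0 : ℝ) (1 / 2)) {x : Eu n} (hD : ‖vstar μ x‖ ≤ D) (x' : Eu n) :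
    μ' * σ * ‖vstar μ' x' - vstar μ x‖ ≤
      M * (1 + D) * (‖x' - x‖ + ‖ystar μ' x' - ystar μ x‖) + 2 * M * D * |μ' - μ| := by
  have hD0 : 0 ≤ D := (norm_nonneg _).trans hD
  have hM := P.M_nonneg
  set y := ystar μ x
  set y' := ystar μ' x'
  set v := vstar μ x
  refine (mul_norm_le_of_coercive (P.hessyy_coercive hμ' x' y') _).trans ?_
  have e : hessyy (aggreg μ' F f) x' y' (vstar μ' x' - v) =
      (grady F x' y' - grady F x y) -
        (hessyy (aggreg μ' F f) x' y' - hessyy (aggreg μ' F f) x y) v -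
        (μ' - μ) • (hessyy F x y - hessyy f x y) v := by
    rw [map_sub, P.hessyy_vstar hμ', ← P.hessyy_vstar hμ, P.hessyy_aggreg μ x,
      P.hessyy_aggreg μ' x y]
    simp only [_root_.add_apply, _root_.smul_apply, _root_.sub_apply]
    module
  rw [e]
  have h1 := P.lip_grady_F x y x' y'
  have h2 : ‖(hessyy (aggreg μ' F f) x' y' - hessyy (aggreg μ' F f) x y) v‖ ≤
      M * (‖x' - x‖ + ‖y' - y‖) * D :=
    (ContinuousLinearMap.le_opNorm _ _).trans
      (mul_le_mul (P.lip_hessyy_aggreg hμ' x y x' y') hD (norm_nonneg _) (by positivity))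
  have h3 : ‖(μ' - μ) • (hessyy F x y - hessyy f x y) v‖ ≤ |μ' - μ| * ((M + M) * D) := by
    rw [norm_smul, Real.norm_eq_abs]
    gcongr
    exact (ContinuousLinearMap.le_opNorm _ _).trans
      (mul_le_mul ((norm_sub_le _ _).trans
        (add_le_add (P.norm_hessyy_F x y) (P.norm_hessyy_f x y))) hD (norm_nonneg _)
        (by positivity))
  refine (norm_sub_le _ _).trans ?_
  have := norm_sub_le (grady F x' y' - grady F x y)
    ((hessyy (aggreg μ' F f) x' y' - hessyy (aggreg μ' F f) x y) v)
  linarith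

lemma exists_ystar_lip (P : Problem F f ystar vstar σ M L) (hD0 : 0 ≤ D) :
    ∃ C, 0 ≤ C ∧ ∀ μ ∈ Ioc (0 : ℝ) (1 / 2), ∀ μ' ∈ Ioc (0 : ℝ) (1 / 2), ∀ x x',
      ‖vstar μ x‖ ≤ D →
      ‖ystar μ' x' - ystar μ x‖ ≤ C * (‖x' - x‖ + |μ' - μ|) / μ' := by
  have hM := P.M_nonneg
  have hσ := P.σ_pos
  refine ⟨M * (1 + 2 * D) / σ, by positivity, fun μ hμ μ' hμ' x x' hD => ?_⟩
  have h := P.norm_ystar_sub_ystar_le hμ hμ' hD x'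
  rw [div_mul_eq_mul_div, div_div, le_div_iff₀ (mul_pos hσ hμ'.1)]
  have : 0 ≤ M * |μ' - μ| + 2 * M * D * ‖x' - x‖ := by positivity
  linarith

lemma exists_vstar_lip (P : Problem F f ystar vstar σ M L) (hD0 : 0 ≤ D) :
    ∃ C, 0 ≤ C ∧ ∀ μ ∈ Ioc (0 : ℝ) (1 / 2), ∀ μ' ∈ Ioc (0 : ℝ) (1 / 2), ∀ x x',
      ‖vstar μ x‖ ≤ D →
      ‖vstar μ' x' - vstar μ x‖ ≤ C * (‖x' - x‖ + |μ' - μ|) / μ' ^ 2 := by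
  have hM := P.M_nonneg
  have hσ := P.σ_pos
  obtain ⟨C, hC, h⟩ := P.exists_ystar_lip hD0
  refine ⟨(M * (1 + D) * (1 + C) + 2 * M * D) / σ, by positivity, fun μ hμ μ' hμ' x x' hD => ?_⟩
  have h1 := P.norm_vstar_sub_vstar_le hμ hμ' hD x'
  have h2 := h μ hμ μ' hμ' x x' hD
  have hpos := hμ'.1
  have hle : μ' ≤ 1 := hμ'.2.trans (by norm_num)
  set s := ‖x' - x‖ + |μ' - μ| with hs
  have hs0 : 0 ≤ s := by positivity
  rw [le_div_iff₀ hpos] at h2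
  rw [div_mul_eq_mul_div, div_div, le_div_iff₀ (by positivity)]
  calc ‖vstar μ' x' - vstar μ x‖ * (σ * μ' ^ 2)
      = μ' * (μ' * σ * ‖vstar μ' x' - vstar μ x‖) := by ring
    _ ≤ μ' * (M * (1 + D) * (‖x' - x‖ + ‖ystar μ' x' - ystar μ x‖) + 2 * M * D * |μ' - μ|) := by
        gcongr
    _ = M * (1 + D) * (μ' * ‖x' - x‖ + ‖ystar μ' x' - ystar μ x‖ * μ') +
          2 * M * D * (μ' * |μ' - μ|) := by ring
    _ ≤ M * (1 + D) * (1 * s + C * s) + 2 * M * D * (1 * s) := by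
        gcongr <;> simp [hs]
    _ = _ := by ring

end Problem

end Problem

section Estimates

variable {F f : Eu n → Eu m → ℝ} {ystar vstar : ℝ → Eu n → Eu m} {σ M L μ μ' D : ℝ}

/-- The gradient of `x ↦ F x (ystar μ x)`, in terms of the multiplier `vstar`. -/
def gradPhi (F f : Eu n → Eu m → ℝ) (ystar vstar : ℝ → Eu n → Eu m) (μ : ℝ) (x : Eu n) : Eu n :=
  gradx F x (ystar μ x) - hessxy (aggreg μ F f) x (ystar μ x) (vstar μ x)

/-- The direction of the upper-level update. -/
def upperDir (F f : Eu n → Eu m → ℝ) (μ : ℝ) (x : Eu n) (y v : Eu m) : Eu n :=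
  gradx F x y - hessxy (aggreg μ F f) x y v

namespace Problem

lemma hasGradientAt_gradPhi (P : Problem F f ystar vstar σ M L) (hμ : μ ∈ Ioc (0 : ℝ) (1 / 2))
    (x : Eu n) :
    HasGradientAt (fun x' => F x' (ystar μ x')) (gradPhi F f ystar vstar μ x) x := by
  set ψ := aggreg μ F f with hψ
  set z : Eu n → Eu n × Eu m := fun x' => (x', ystar μ x') with hz
  obtain ⟨C, hC, hlip⟩ := P.exists_ystar_lip (norm_nonneg (vstar μ x))
  have hO : (fun x' => z x' - z x) =O[𝓝 x] fun x' => x' - x := by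
    refine (isBigO_refl _ _).prod_left (IsBigO.of_bound (C / μ) (Eventually.of_forall fun x' => ?_))
    refine (hlip μ hμ μ hμ x x' le_rfl).trans_eq ?_
    simp only [sub_self, abs_zero, add_zero]
    ring
  have hz_tendsto : Tendsto z (𝓝 x) (𝓝 (z x)) := by
    have h0 : Tendsto (fun x' => x' - x) (𝓝 x) (𝓝 0) := by
      simpa using (tendsto_id (α := Eu n) (x := 𝓝 x)).sub_const x
    simpa using (hO.trans_tendsto h0).add_const (z x)
  have hU := (((P.contDiff_F.differentiable (by norm_num)) (z x)).hasFDerivAt.isLittleO.comp_tendsto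
    hz_tendsto).trans_isBigO hO
  have hG := ((((contDiff_grady (P.contDiff_aggreg μ)).differentiable (by norm_num))
    (z x)).hasFDerivAt.isLittleO.comp_tendsto hz_tendsto).trans_isBigO hO
  rw [hasGradientAt_iff_isLittleO]
  have hG' := ((innerSL ℝ (vstar μ x)).isBigO_comp
    (fun x' => (fderiv ℝ (Function.uncurry (grady ψ)) (z x)) (z x' - z x)) (𝓝 x)).trans_isLittleO
    (hG.neg_left.congr_left (f₂ :=
      fun x' => (fderiv ℝ (Function.uncurry (grady ψ)) (z x)) (z x' - z x)) (by
        intro x'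
        simp only [Function.comp_apply, hz, Function.uncurry_apply_pair, P.grady_ystar hμ, hψ]
        simp))
  refine (hU.add hG').congr_left fun x' => ?_
  simp only [Function.comp_apply, hz, Function.uncurry_apply_pair, Prod.mk_sub_mk,
    fderiv_uncurry_apply P.contDiff_F, fderiv_uncurry_grady_apply (P.contDiff_aggreg μ), gradPhi,
    innerSL_apply_apply, inner_add_right, inner_sub_left,
    ContinuousLinearMap.adjoint_inner_right, hψ]
  rw [← hessyy_symm (P.contDiff_aggreg μ), P.hessyy_vstar hμ]
  ring

lemma exists_gradPhi_lip (P : Problem F f ystar vstar σ M L) (hD0 : 0 ≤ D) :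
    ∃ C, 0 ≤ C ∧ ∀ μ ∈ Ioc (0 : ℝ) (1 / 2), ∀ x x', ‖vstar μ x‖ ≤ D →
      ‖gradPhi F f ystar vstar μ x' - gradPhi F f ystar vstar μ x‖ ≤ C / μ ^ 2 * ‖x' - x‖ := by
  obtain ⟨C₁, hC₁, h₁⟩ := P.exists_ystar_lip hD0
  obtain ⟨C₂, hC₂, h₂⟩ := P.exists_vstar_lip hD0
  have hM := P.M_nonneg
  refine ⟨M * (1 + D) * (1 + C₁) + M * C₂, by positivity, fun μ hμ x x' hD => ?_⟩
  have e1 := h₁ μ hμ μ hμ x x' hD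
  have e2 := h₂ μ hμ μ hμ x x' hD
  have hpos := hμ.1
  have hle : μ ≤ 1 := hμ.2.trans (by norm_num)
  simp only [sub_self, abs_zero, add_zero] at e1 e2
  set y := ystar μ x
  set y' := ystar μ x'
  set A := hessxy (aggreg μ F f)
  have e : gradPhi F f ystar vstar μ x' - gradPhi F f ystar vstar μ x =
      (gradx F x' y' - gradx F x y) - (A x' y' - A x y) (vstar μ x) -
        A x' y' (vstar μ x' - vstar μ x) := by
    simp only [gradPhi, map_sub, _root_.sub_apply]
    abel
  have b1 := P.lip_gradx_F x y x' y'
  have b2 : ‖(A x' y' - A x y) (vstar μ x)‖ ≤ M * (‖x' - x‖ + ‖y' - y‖) * D :=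
    (ContinuousLinearMap.le_opNorm _ _).trans
      (mul_le_mul (P.lip_hessxy_aggreg hμ x y x' y') hD (norm_nonneg _) (by positivity))
  have b3 : ‖A x' y' (vstar μ x' - vstar μ x)‖ ≤ M * (C₂ * ‖x' - x‖ / μ ^ 2) :=
    (ContinuousLinearMap.le_opNorm _ _).trans
      (mul_le_mul (P.norm_hessxy_aggreg hμ _ _) e2 (norm_nonneg _) hM)
  have b4 : ‖x' - x‖ + ‖y' - y‖ ≤ (1 + C₁) * (‖x' - x‖ / μ ^ 2) := by
    have h1 : μ ^ 2 ≤ μ := by nlinarith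
    have h2 : ‖x' - x‖ ≤ ‖x' - x‖ / μ ^ 2 :=
      le_div_self (norm_nonneg _) (by positivity) (h1.trans hle)
    have h3 : C₁ * ‖x' - x‖ / μ ≤ C₁ * (‖x' - x‖ / μ ^ 2) := by
      rw [← mul_div_assoc]; gcongr
    linarith
  rw [e]
  calc _ ≤ M * (‖x' - x‖ + ‖y' - y‖) + M * (‖x' - x‖ + ‖y' - y‖) * D +
        M * (C₂ * ‖x' - x‖ / μ ^ 2) :=
        (norm_sub_le _ _).trans (add_le_add ((norm_sub_le _ _).trans (add_le_add b1 b2)) b3)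
    _ = M * (1 + D) * (‖x' - x‖ + ‖y' - y‖) + M * (C₂ * ‖x' - x‖ / μ ^ 2) := by ring
    _ ≤ M * (1 + D) * ((1 + C₁) * (‖x' - x‖ / μ ^ 2)) + M * (C₂ * ‖x' - x‖ / μ ^ 2) := by gcongr
    _ = _ := by ring

/-- Descent inequality for `x ↦ F x (ystar μ x)`, with smoothness constant of order `μ⁻²`. -/
lemma exists_descent (P : Problem F f ystar vstar σ M L) (hD0 : 0 ≤ D) :
    ∃ C, 0 ≤ C ∧ ∀ μ ∈ Ioc (0 : ℝ) (1 / 2), ∀ x x', ‖vstar μ x‖ ≤ D →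
      F x' (ystar μ x') ≤ F x (ystar μ x) + ⟪gradPhi F f ystar vstar μ x, x' - x⟫ +
        C / μ ^ 2 * ‖x' - x‖ ^ 2 := by
  obtain ⟨C, hC, h⟩ := P.exists_gradPhi_lip hD0
  refine ⟨C, hC, fun μ hμ x x' hD => ?_⟩
  have hd : ∀ t : ℝ, HasDerivAt (fun t : ℝ => F (x + t • (x' - x)) (ystar μ (x + t • (x' - x))))
      ⟪gradPhi F f ystar vstar μ (x + t • (x' - x)), x' - x⟫ t := by
    intro t
    have h1 : HasDerivAt (fun t : ℝ => x + t • (x' - x)) (x' - x) t := by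
      simpa using ((hasDerivAt_id t).smul_const (x' - x)).const_add x
    simpa [Function.comp_def] using
      (P.hasGradientAt_gradPhi hμ (x + t • (x' - x))).hasFDerivAt.comp_hasDerivAt t h1
  obtain ⟨t, ht, hslope⟩ := exists_hasDerivAt_eq_slope _ _ one_pos
    (fun t _ => (hd t).continuousAt.continuousWithinAt) (fun t _ => hd t)
  simp only [one_smul, zero_smul, add_zero, sub_zero, div_one, add_sub_cancel] at hslope
  have h2 := h μ hμ x (x + t • (x' - x)) hD
  rw [add_sub_cancel_left, norm_smul, Real.norm_of_nonneg ht.1.le] at h2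
  have h3 : ⟪gradPhi F f ystar vstar μ (x + t • (x' - x)) - gradPhi F f ystar vstar μ x, x' - x⟫ ≤
      C / μ ^ 2 * ‖x' - x‖ ^ 2 := by
    have h4 : C / μ ^ 2 * (t * ‖x' - x‖) ≤ C / μ ^ 2 * (1 * ‖x' - x‖) := by
      gcongr
      exact ht.2.le
    calc _ ≤ _ := real_inner_le_norm _ _
      _ ≤ C / μ ^ 2 * (1 * ‖x' - x‖) * ‖x' - x‖ := by gcongr; exact h2.trans h4
      _ = _ := by ring
  rw [inner_sub_left] at h3
  linarith

/-- Effect of a change of the aggregation parameter on `F x (ystar μ x)`. -/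
lemma exists_drift (P : Problem F f ystar vstar σ M L) (hD0 : 0 ≤ D) :
    ∃ C, 0 ≤ C ∧ ∀ μ ∈ Ioc (0 : ℝ) (1 / 2), ∀ μ' ∈ Ioc (0 : ℝ) (1 / 2), ∀ x,
      ‖vstar μ' x‖ ≤ D →
      F x (ystar μ' x) - F x (ystar μ x) ≤ C * (|μ' - μ| + (|μ' - μ| / μ) ^ 2) := by
  obtain ⟨C₁, hC₁, h₁⟩ := P.exists_ystar_lip hD0
  have hM := P.M_nonneg
  refine ⟨D * (M * C₁ ^ 2 + 2 * M * D + 2 * M * C₁), by positivity, fun μ hμ μ' hμ' x hD => ?_⟩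
  have hq := h₁ μ' hμ' μ hμ x x hD
  rw [sub_self, norm_zero, zero_add, abs_sub_comm μ μ', mul_div_assoc] at hq
  have hpos := hμ.1
  have hle : μ ≤ 1 := hμ.2.trans (by norm_num)
  set δ := |μ' - μ| with hδ
  have hδ0 : 0 ≤ δ := abs_nonneg _
  set r := δ / μ with hr
  have hr0 : 0 ≤ r := by positivity
  have hδr : δ ≤ r := le_div_self hδ0 hpos hle
  set y := ystar μ x
  set y' := ystar μ' x with hy'
  set v' := vstar μ' x
  set H' := hessyy (aggreg μ' F f) x y' with hH'
  have hconv : F x y' - F x y ≤ ⟪grady F x y', y' - y⟫ := by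
    have h2 := (P.strongConvex x).add_inner_add_le (hasGradientAt_grady P.contDiff_F x y') y
    have h3 : 0 ≤ σ / 2 * ‖y - y'‖ ^ 2 := by have := P.σ_pos; positivity
    rw [← neg_sub y' y, inner_neg_right] at h2
    rw [neg_sub y' y] at h2
    linarith
  have htaylor : ‖grady (aggreg μ' F f) x y - grady (aggreg μ' F f) x y' - H' (y - y')‖ ≤
      M * ‖y - y'‖ * ‖y - y'‖ := by
    refine (convex_closedBall y' ‖y - y'‖).norm_image_sub_le_of_norm_hasFDerivWithin_le'
      (fun w _ => (hasFDerivAt_hessyy (P.contDiff_aggreg μ') x w).hasFDerivWithinAt) ?_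
      (by simp) (by simp [dist_eq_norm])
    intro w hw
    have h2 := P.lip_hessyy_aggreg hμ' x y' x w
    rw [sub_self, norm_zero, zero_add] at h2
    rw [mem_closedBall_iff_norm] at hw
    exact h2.trans (by gcongr)
  rw [P.grady_ystar hμ', sub_zero] at htaylor
  have hg : ‖grady (aggreg μ' F f) x y‖ ≤ δ * (2 * (M * D + M * ‖y - y'‖)) := by
    rw [P.grady_aggreg_shift μ, P.grady_ystar hμ, zero_add, norm_smul, Real.norm_eq_abs]
    refine mul_le_mul_of_nonneg_left ?_ hδ0
    refine (P.norm_grady_sub_ystar_le hμ x).trans ?_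
    gcongr
    have h2 := P.lip_grady_F x y' x y
    rw [sub_self, norm_zero, zero_add] at h2
    have h3 := P.norm_grady_F_ystar_le hμ' hD
    have h4 := norm_le_norm_sub_add (grady F x y) (grady F x y')
    linarith
  have hHv : ‖H' (y - y')‖ ≤ M * ‖y - y'‖ * ‖y - y'‖ + δ * (2 * (M * D + M * ‖y - y'‖)) := by
    have h2 := norm_sub_norm_le (H' (y - y')) (grady (aggreg μ' F f) x y)
    rw [norm_sub_rev] at h2
    linarith
  have hin : ⟪grady F x y', y' - y⟫ ≤ D * ‖H' (y - y')‖ := by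
    rw [← P.hessyy_vstar hμ', hessyy_symm (P.contDiff_aggreg μ')]
    refine (real_inner_le_norm _ _).trans ?_
    rw [← neg_sub y y', map_neg, norm_neg]
    gcongr
  calc _ ≤ D * (M * ‖y - y'‖ * ‖y - y'‖ + δ * (2 * (M * D + M * ‖y - y'‖))) :=
        (hconv.trans hin).trans (by gcongr)
    _ ≤ D * (M * (C₁ * r) * (C₁ * r) + δ * (2 * (M * D + M * (C₁ * r)))) := by gcongr
    _ = D * (M * C₁ ^ 2) * r ^ 2 + D * (2 * M * D) * δ + D * (2 * M * C₁) * (δ * r) := by ring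
    _ ≤ D * (M * C₁ ^ 2) * r ^ 2 + D * (2 * M * D) * δ + D * (2 * M * C₁) * (r * r) := by gcongr
    _ ≤ _ := by
        have : 0 ≤ D * (2 * M * D) * r ^ 2 + D * (M * C₁ ^ 2) * δ + D * (2 * M * C₁) * δ := by
          positivity
        linarith

lemma lower_step (P : Problem F f ystar vstar σ M L) (hμ : μ ∈ Ioc (0 : ℝ) (1 / 2)) {β : ℝ}
    (hβ : 0 ≤ β) (hβL : β * L ≤ 1) (x : Eu n) (y : Eu m) :
    ‖y - β • grady (aggreg μ F f) x y - ystar μ x‖ ^ 2 ≤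
      (1 - β * (μ * σ)) * ‖y - ystar μ x‖ ^ 2 := by
  have hσμ : 0 ≤ μ * σ := (mul_pos hμ.1 P.σ_pos).le
  have hstep : ∀ w u, ‖u - β • hessyy (aggreg μ F f) x w u‖ ^ 2 ≤
      (1 - β * (μ * σ)) * ‖u‖ ^ 2 := fun w u =>
    norm_sub_smul_sq_le (hessyy_symm (P.contDiff_aggreg μ) x w) (P.hessyy_coercive hμ x w)
      hσμ (P.norm_hessyy_aggreg' hμ x w) hβ hβL u
  rcases lt_or_ge (1 - β * (μ * σ)) 0 with hneg | hnn
  · have hz : ∀ u : Eu m, u = 0 := fun u => by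
      have h1 := (sq_nonneg _).trans (hstep y u)
      have h2 : ‖u‖ ^ 2 ≤ 0 := by
        by_contra! h
        exact absurd h1 (not_le.2 (mul_neg_of_neg_of_pos hneg h))
      simpa using le_antisymm h2 (sq_nonneg _)
    rw [hz (y - β • grady (aggreg μ F f) x y - ystar μ x), hz (y - ystar μ x)]
    simp
  · set c := Real.sqrt (1 - β * (μ * σ))
    have hd : ∀ w, HasFDerivAt (fun w => w - β • grady (aggreg μ F f) x w)
        (ContinuousLinearMap.id ℝ (Eu m) - β • hessyy (aggreg μ F f) x w) w := fun w =>
      (hasFDerivAt_id w).sub ((hasFDerivAt_hessyy (P.contDiff_aggreg μ) x w).const_smul β)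
    have h1 := convex_univ.norm_image_sub_le_of_norm_hasFDerivWithin_le (C := c)
      (fun w _ => (hd w).hasFDerivWithinAt) (fun w _ => by
        refine ContinuousLinearMap.opNorm_le_bound _ (Real.sqrt_nonneg _) fun u => ?_
        refine abs_le_of_sq_le_sq' ?_ (by positivity) |>.2
        rw [mul_pow, Real.sq_sqrt hnn]
        simpa using hstep w u) (mem_univ (ystar μ x)) (mem_univ y)
    rw [P.grady_ystar hμ, smul_zero, sub_zero] at h1
    calc _ ≤ (c * ‖y - ystar μ x‖) ^ 2 := by gcongr
      _ = _ := by rw [mul_pow, Real.sq_sqrt hnn]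

/-- Residual of the multiplier equation away from the lower-level solution. -/
lemma norm_residual_le (P : Problem F f ystar vstar σ M L) (hμ : μ ∈ Ioc (0 : ℝ) (1 / 2))
    {x : Eu n} (hD : ‖vstar μ x‖ ≤ D) (y : Eu m) :
    ‖grady F x y - hessyy (aggreg μ F f) x y (vstar μ x)‖ ≤ M * (1 + D) * ‖y - ystar μ x‖ := by
  have hM := P.M_nonneg
  have e : grady F x y - hessyy (aggreg μ F f) x y (vstar μ x) =
      (grady F x y - grady F x (ystar μ x)) -
        (hessyy (aggreg μ F f) x y - hessyy (aggreg μ F f) x (ystar μ x)) (vstar μ x) := by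
    rw [_root_.sub_apply, P.hessyy_vstar hμ]
    abel
  have h1 := P.lip_grady_F x (ystar μ x) x y
  have h2 := P.lip_hessyy_aggreg hμ x (ystar μ x) x y
  rw [sub_self, norm_zero, zero_add] at h1 h2
  rw [e]
  calc _ ≤ M * ‖y - ystar μ x‖ + M * ‖y - ystar μ x‖ * D :=
        (norm_sub_le _ _).trans (add_le_add h1 ((ContinuousLinearMap.le_opNorm _ _).trans
          (mul_le_mul h2 hD (norm_nonneg _) (by positivity))))
    _ = _ := by ring

lemma multiplier_step (P : Problem F f ystar vstar σ M L) (hμ : μ ∈ Ioc (0 : ℝ) (1 / 2)) {η : ℝ}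
    (hη : 0 ≤ η) (hηL : η * L ≤ 1) {x : Eu n} (hD : ‖vstar μ x‖ ≤ D) (y v : Eu m) :
    ∃ p, 0 ≤ p ∧ p ^ 2 ≤ (1 - η * (μ * σ)) * ‖v - vstar μ x‖ ^ 2 ∧
      ‖v + η • (grady F x y - hessyy (aggreg μ F f) x y v) - vstar μ x‖ ≤
        p + η * (M * (1 + D) * ‖y - ystar μ x‖) := by
  refine ⟨_, norm_nonneg _,
    norm_sub_smul_sq_le (hessyy_symm (P.contDiff_aggreg μ) x y) (P.hessyy_coercive hμ x y)
      (mul_pos hμ.1 P.σ_pos).le (P.norm_hessyy_aggreg' hμ x y) hη hηL (v - vstar μ x), ?_⟩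
  have e : v + η • (grady F x y - hessyy (aggreg μ F f) x y v) - vstar μ x =
      (v - vstar μ x - η • hessyy (aggreg μ F f) x y (v - vstar μ x)) +
        η • (grady F x y - hessyy (aggreg μ F f) x y (vstar μ x)) := by
    rw [map_sub]; module
  rw [e]
  refine (norm_add_le _ _).trans ?_
  rw [norm_smul, Real.norm_of_nonneg hη]
  gcongr
  exact P.norm_residual_le hμ hD y

lemma norm_upperDir_sub_le (P : Problem F f ystar vstar σ M L) (hμ : μ ∈ Ioc (0 : ℝ) (1 / 2))
    {x : Eu n} (hD : ‖vstar μ x‖ ≤ D) (y v : Eu m) :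
    ‖upperDir F f μ x y v - gradPhi F f ystar vstar μ x‖ ≤
      M * (1 + D) * ‖y - ystar μ x‖ + M * ‖v - vstar μ x‖ := by
  have hM := P.M_nonneg
  set A := hessxy (aggreg μ F f)
  have e : upperDir F f μ x y v - gradPhi F f ystar vstar μ x =
      (gradx F x y - gradx F x (ystar μ x)) - (A x y - A x (ystar μ x)) (vstar μ x) -
        A x y (v - vstar μ x) := by
    simp only [upperDir, gradPhi, map_sub, _root_.sub_apply]
    abel
  have h1 := P.lip_gradx_F x (ystar μ x) x y
  have h2 := P.lip_hessxy_aggreg hμ x (ystar μ x) x y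
  rw [sub_self, norm_zero, zero_add] at h1 h2
  rw [e]
  calc _ ≤ M * ‖y - ystar μ x‖ + M * ‖y - ystar μ x‖ * D + M * ‖v - vstar μ x‖ :=
        (norm_sub_le _ _).trans (add_le_add ((norm_sub_le _ _).trans (add_le_add h1
          ((ContinuousLinearMap.le_opNorm _ _).trans
            (mul_le_mul h2 hD (norm_nonneg _) (by positivity)))))
          ((ContinuousLinearMap.le_opNorm _ _).trans (by
            gcongr; exact P.norm_hessxy_aggreg hμ _ _)))
    _ = _ := by ring

lemma exists_KKTres_le (P : Problem F f ystar vstar σ M L) (hD0 : 0 ≤ D) :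
    ∃ C, 0 ≤ C ∧ ∀ μ ∈ Ioc (0 : ℝ) (1 / 2), ∀ x y v, ‖vstar μ x‖ ≤ D → ‖v‖ ≤ D →
      ‖gradx F x y - hessxy f x y v‖ ≤ ‖gradPhi F f ystar vstar μ x‖ +
        C * (‖y - ystar μ x‖ + ‖v - vstar μ x‖ + μ) ∧
      ‖grady F x y - hessyy f x y v‖ ≤
        C * (‖y - ystar μ x‖ + ‖v - vstar μ x‖ + μ) ∧
      ‖grady f x y‖ ≤ C * (‖y - ystar μ x‖ + ‖v - vstar μ x‖ + μ) := by
  have hM := P.M_nonneg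
  refine ⟨M * (1 + D) + M + 2 * M * D, by positivity, fun μ hμ x y v hD hv => ?_⟩
  have hpos := hμ.1
  set e := ‖y - ystar μ x‖
  set w := ‖v - vstar μ x‖
  have he : 0 ≤ e := norm_nonneg _
  have hw : 0 ≤ w := norm_nonneg _
  have key : M * (1 + D) * e + M * w + 2 * M * D * μ ≤
      (M * (1 + D) + M + 2 * M * D) * (e + w + μ) := by
    have h1 : 0 ≤ M * (1 + D) * (w + μ) + M * (e + μ) + 2 * M * D * (e + w) := by positivity
    linarith
  have hsum : ∀ {W : Type} [NormedAddCommGroup W] [NormedSpace ℝ W] (A B : Eu m →L[ℝ] W),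
      ‖A‖ ≤ M → ‖B‖ ≤ M → ‖μ • (A - B) v‖ ≤ 2 * M * D * μ := by
    intro W _ _ A B hA hB
    rw [norm_smul, Real.norm_of_nonneg hpos.le]
    calc μ * ‖(A - B) v‖ ≤ μ * ((M + M) * D) := by
          gcongr
          exact (ContinuousLinearMap.le_opNorm _ _).trans
            (mul_le_mul ((norm_sub_le _ _).trans (add_le_add hA hB)) hv (norm_nonneg _)
              (by positivity))
      _ = _ := by ring
  refine ⟨?_, ?_, ?_⟩
  · have h1 := P.norm_upperDir_sub_le hμ hD y v
    have h2 := hsum _ _ (P.norm_hessxy_F x y) (P.norm_hessxy_f x y)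
    have e1 : gradx F x y - hessxy f x y v = gradPhi F f ystar vstar μ x +
        (upperDir F f μ x y v - gradPhi F f ystar vstar μ x) +
        μ • (hessxy F x y - hessxy f x y) v := by
      simp only [upperDir, P.hessxy_aggreg, _root_.add_apply, _root_.sub_apply,
        _root_.smul_apply]
      module
    rw [e1]
    refine norm_add₃_le.trans ?_
    linarith
  · have h1 := P.norm_residual_le hμ hD y
    have h2 := hsum _ _ (P.norm_hessyy_F x y) (P.norm_hessyy_f x y)
    have h3 : ‖hessyy (aggreg μ F f) x y (v - vstar μ x)‖ ≤ M * w :=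
      (ContinuousLinearMap.le_opNorm _ _).trans (by
        gcongr; exact P.norm_hessyy_aggreg hμ _ _)
    have e1 : grady F x y - hessyy f x y v =
        (grady F x y - hessyy (aggreg μ F f) x y (vstar μ x)) +
        -hessyy (aggreg μ F f) x y (v - vstar μ x) + μ • (hessyy F x y - hessyy f x y) v := by
      rw [map_sub]
      simp only [P.hessyy_aggreg, _root_.add_apply, _root_.sub_apply, _root_.smul_apply]
      module
    rw [e1]
    refine norm_add₃_le.trans ?_
    rw [norm_neg]
    linarith
  · have h1 := P.lip_grady_f x (ystar μ x) x y
    rw [sub_self, norm_zero, zero_add] at h1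
    have h2 := P.norm_grady_F_ystar_le hμ hD
    have h0 := P.grady_ystar hμ x
    rw [P.grady_aggreg] at h0
    have h3 := congrArg norm (eq_neg_of_add_eq_zero_right h0)
    rw [norm_neg, norm_smul, norm_smul, Real.norm_of_nonneg hpos.le,
      Real.norm_of_nonneg (by linarith [hμ.2])] at h3
    have h4 := norm_le_norm_sub_add (grady f x y) (grady f x (ystar μ x))
    have h5 : ‖grady f x (ystar μ x)‖ ≤ 2 * M * D * μ := by
      have h6 : 1 / 2 * ‖grady f x (ystar μ x)‖ ≤ (1 - μ) * ‖grady f x (ystar μ x)‖ := by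
        gcongr; linarith [hμ.2]
      have h7 := mul_le_mul_of_nonneg_left h2 hpos.le
      linarith
    have h8 : 0 ≤ M * D * e + M * w := by positivity
    linarith

end Problem

end Estimates

section Recursion

variable {F f : Eu n → Eu m → ℝ} {ystar vstar : ℝ → Eu n → Eu m} {σ M L D B N : ℝ}

/-- One iteration of sl-BAMM, with step sizes `β`, `t * β`, `t ^ 3 * β * μ ^ 3` and with the
relative variation of the aggregation parameter controlled by `N * ν`. -/
structure Step (F f : Eu n → Eu m → ℝ) (ystar vstar : ℝ → Eu n → Eu m) (L D B N μ μ' t β ν : ℝ)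
    (x x' : Eu n) (y y' v v' : Eu m) : Prop where
  mem : μ ∈ Ioc (0 : ℝ) (1 / 2)
  mem' : μ' ∈ Ioc (0 : ℝ) (1 / 2)
  anti : μ' ≤ μ
  le_two_mul : μ ≤ 2 * μ'
  abs_sub_le : |μ' - μ| ≤ N * ν * μ'
  N_nonneg : 0 ≤ N
  ν_nonneg : 0 ≤ ν
  t_pos : 0 < t
  t_le : t ≤ 1
  β_pos : 0 < β
  β_le : β ≤ B
  β_mul_le : β * L ≤ 1
  vstar_le : ‖vstar μ x‖ ≤ D
  vstar_le' : ‖vstar μ' x'‖ ≤ D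
  y_eq : y' = y - β • grady (aggreg μ F f) x y
  v_eq : v' = v + (t * β) • (grady F x y - hessyy (aggreg μ F f) x y v)
  x_eq : x' = x - (t ^ 3 * β * μ ^ 3) • upperDir F f μ x y v

lemma sq_le_of_le_add {q e e' δ θ b : ℝ} (hθ : 0 < θ) (hθb : θ ≤ b)
    (hqe : q ^ 2 ≤ (1 - 2 * θ) * e ^ 2) (he' : 0 ≤ e') (h : e' ≤ q + δ) :
    e' ^ 2 ≤ e ^ 2 - θ * e ^ 2 + (1 + b) / θ * δ ^ 2 := by
  have h1 : e' ^ 2 ≤ (q + δ) ^ 2 := by gcongr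
  have h2 : (q + δ) ^ 2 ≤ (1 + θ) * q ^ 2 + (1 + θ) / θ * δ ^ 2 := by
    have : (1 + θ) * q ^ 2 + (1 + θ) / θ * δ ^ 2 - (q + δ) ^ 2 = (θ * q - δ) ^ 2 / θ := by
      field_simp; ring
    have h3 : 0 ≤ (θ * q - δ) ^ 2 / θ := by positivity
    linarith
  have h3 : (1 + θ) * q ^ 2 ≤ e ^ 2 - θ * e ^ 2 := by
    have h4 : (1 + θ) * q ^ 2 ≤ (1 + θ) * ((1 - 2 * θ) * e ^ 2) := by gcongr
    nlinarith [mul_nonneg (sq_nonneg θ) (sq_nonneg e)]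
  have h4 : (1 + θ) / θ * δ ^ 2 ≤ (1 + b) / θ * δ ^ 2 := by gcongr
  linarith

lemma add_mul_add_mul_le {a b c u v w : ℝ} (ha : 0 ≤ a) (hb : 0 ≤ b) (hc : 0 ≤ c) (hu : 0 ≤ u)
    (hv : 0 ≤ v) (hw : 0 ≤ w) : a * u + b * v + c * w ≤ (a + b + c) * (u + v + w) := by
  have h1 : a * u ≤ a * (u + v + w) := mul_le_mul_of_nonneg_left (by linarith) ha
  have h2 : b * v ≤ b * (u + v + w) := mul_le_mul_of_nonneg_left (by linarith) hb
  have h3 : c * w ≤ c * (u + v + w) := mul_le_mul_of_nonneg_left (by linarith) hc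
  linarith

namespace Step

lemma norm_x_sub {μ μ' t β ν : ℝ} {x x' : Eu n} {y y' v v' : Eu m}
    (S : Step F f ystar vstar L D B N μ μ' t β ν x x' y y' v v') :
    ‖x' - x‖ = t ^ 3 * β * μ ^ 3 * ‖upperDir F f μ x y v‖ := by
  have h1 := S.t_pos
  have h2 := S.β_pos
  have h3 := S.mem.1
  rw [S.x_eq, sub_sub_cancel_left, norm_neg, norm_smul, Real.norm_of_nonneg (by positivity)]

end Step

/-- Contraction of the lower-level error along one iteration. -/
lemma Problem.exists_lower_error_le (P : Problem F f ystar vstar σ M L) (hD : 0 ≤ D) :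
    ∃ C, 0 ≤ C ∧ ∀ {μ μ' t β ν : ℝ} {x x' : Eu n} {y y' v v' : Eu m},
      Step F f ystar vstar L D B N μ μ' t β ν x x' y y' v v' →
      ‖y' - ystar μ' x'‖ ^ 2 ≤ ‖y - ystar μ x‖ ^ 2 - σ / 2 * (β * μ * ‖y - ystar μ x‖ ^ 2) +
        C * (t ^ 3 * (t ^ 3 * β * μ ^ 3 * ‖upperDir F f μ x y v‖ ^ 2) + ν ^ 2 / (β * μ)) := by
  obtain ⟨C₁, hC₁, h₁⟩ := P.exists_ystar_lip hD
  have hσ := P.σ_pos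
  rcases lt_or_ge B 0 with hB | hB
  · exact ⟨0, le_rfl, fun S => absurd (S.β_pos.trans_le S.β_le) hB.not_gt⟩
  refine ⟨(1 + B * σ / 4) * (2 / σ) * (C₁ ^ 2 * 2 * (4 + N ^ 2)), by positivity,
    fun {μ μ' t β ν x x' y y' v v'} S => ?_⟩
  have hμ := S.mem.1
  have hμ' := S.mem'.1
  have hβ := S.β_pos
  have ht := S.t_pos
  have hN := S.N_nonneg
  have hν := S.ν_nonneg
  set d := ‖upperDir F f μ x y v‖ with hd
  have hd0 : 0 ≤ d := norm_nonneg _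
  have hδ : ‖ystar μ' x' - ystar μ x‖ ≤ C₁ * (2 * (t ^ 3 * β * μ ^ 2 * d) + N * ν) := by
    refine (h₁ μ S.mem μ' S.mem' x x' S.vstar_le).trans ?_
    rw [S.norm_x_sub, mul_div_assoc]
    gcongr
    rw [div_le_iff₀ hμ']
    have h2 : t ^ 3 * β * μ ^ 3 * d ≤ 2 * (t ^ 3 * β * μ ^ 2 * d) * μ' := by
      have : t ^ 3 * β * μ ^ 2 * d * μ ≤ t ^ 3 * β * μ ^ 2 * d * (2 * μ') := by
        have := S.le_two_mul
        gcongr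
      linarith
    linarith [S.abs_sub_le]
  have hstep := P.lower_step S.mem hβ.le S.β_mul_le x y
  have hle : ‖y' - ystar μ' x'‖ ≤ ‖y - β • grady (aggreg μ F f) x y - ystar μ x‖ +
      C₁ * (2 * (t ^ 3 * β * μ ^ 2 * d) + N * ν) := by
    rw [S.y_eq]
    calc _ = ‖(y - β • grady (aggreg μ F f) x y - ystar μ x) - (ystar μ' x' - ystar μ x)‖ := by
          congr 1; abel
      _ ≤ _ := (norm_sub_le _ _).trans (by gcongr)
  have hθb : β * (μ * σ) / 2 ≤ B * σ / 4 := by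
    have : β * μ ≤ B * (1 / 2) := mul_le_mul S.β_le S.mem.2 hμ.le hB
    nlinarith
  have key := sq_le_of_le_add (θ := β * (μ * σ) / 2) (by positivity) hθb
    (e := ‖y - ystar μ x‖) (by convert hstep using 2; ring) (norm_nonneg _) hle
  refine key.trans ?_
  have e1 : β * (μ * σ) / 2 * ‖y - ystar μ x‖ ^ 2 = σ / 2 * (β * μ * ‖y - ystar μ x‖ ^ 2) := by ring
  have e2 : (2 * (t ^ 3 * β * μ ^ 2 * d) + N * ν) ^ 2 / (β * μ) ≤
      2 * (4 + N ^ 2) * (t ^ 3 * (t ^ 3 * β * μ ^ 3 * d ^ 2) + ν ^ 2 / (β * μ)) := by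
    have h5 : (2 * (t ^ 3 * β * μ ^ 2 * d) + N * ν) ^ 2 ≤
        2 * ((2 * (t ^ 3 * β * μ ^ 2 * d)) ^ 2 + (N * ν) ^ 2) := add_sq_le
    have h6 : 2 * ((2 * (t ^ 3 * β * μ ^ 2 * d)) ^ 2 + (N * ν) ^ 2) / (β * μ) =
        2 * (4 * (t ^ 3 * (t ^ 3 * β * μ ^ 3 * d ^ 2)) + N ^ 2 * (ν ^ 2 / (β * μ))) := by
      field_simp; ring
    have h7 : 0 ≤ t ^ 3 * (t ^ 3 * β * μ ^ 3 * d ^ 2) := by positivity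
    have h8 : 0 ≤ ν ^ 2 / (β * μ) := by positivity
    calc _ ≤ 2 * ((2 * (t ^ 3 * β * μ ^ 2 * d)) ^ 2 + (N * ν) ^ 2) / (β * μ) := by gcongr
      _ = _ := h6
      _ ≤ _ := by nlinarith [mul_nonneg (sq_nonneg N) h7]
  have e3 : (1 + B * σ / 4) / (β * (μ * σ) / 2) * (C₁ * (2 * (t ^ 3 * β * μ ^ 2 * d) + N * ν)) ^ 2 =
      (1 + B * σ / 4) * (2 / σ) * C₁ ^ 2 *
        ((2 * (t ^ 3 * β * μ ^ 2 * d) + N * ν) ^ 2 / (β * μ)) := by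
    field_simp
  rw [e1, e3]
  calc _ ≤ ‖y - ystar μ x‖ ^ 2 - σ / 2 * (β * μ * ‖y - ystar μ x‖ ^ 2) +
      (1 + B * σ / 4) * (2 / σ) * C₁ ^ 2 *
        (2 * (4 + N ^ 2) * (t ^ 3 * (t ^ 3 * β * μ ^ 3 * d ^ 2) + ν ^ 2 / (β * μ))) := by gcongr
    _ = _ := by ring

/-- Contraction of the multiplier error along one iteration. -/
lemma Problem.exists_multiplier_error_le (P : Problem F f ystar vstar σ M L) (hD : 0 ≤ D) :
    ∃ C, 0 ≤ C ∧ ∀ {μ μ' t β ν : ℝ} {x x' : Eu n} {y y' v v' : Eu m},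
      Step F f ystar vstar L D B N μ μ' t β ν x x' y y' v v' →
      μ' ^ 2 * ‖v' - vstar μ' x'‖ ^ 2 ≤ μ ^ 2 * ‖v - vstar μ x‖ ^ 2 -
        σ / 2 * (t * β * μ ^ 3 * ‖v - vstar μ x‖ ^ 2) +
        C * (t * (β * μ * ‖y - ystar μ x‖ ^ 2) +
          t ^ 2 * (t ^ 3 * β * μ ^ 3 * ‖upperDir F f μ x y v‖ ^ 2) + ν ^ 2 / (t * β * μ)) := by
  obtain ⟨C₁, hC₁, h₁⟩ := P.exists_vstar_lip hD
  have hσ := P.σ_pos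
  have hM := P.M_nonneg
  rcases lt_or_ge B 0 with hB | hB
  · exact ⟨0, le_rfl, fun S => absurd (S.β_pos.trans_le S.β_le) hB.not_gt⟩
  obtain ⟨A, hA⟩ : ∃ A, M * (1 + D) = A := ⟨_, rfl⟩
  have hA0 : 0 ≤ A := hA ▸ (by positivity)
  refine ⟨(1 + B * σ / 4) * (2 / σ) * (3 * (A ^ 2 + 16 * C₁ ^ 2 + 4 * N ^ 2 * C₁ ^ 2)),
    by positivity,
    fun {μ μ' t β ν x x' y y' v v'} S => ?_⟩
  have hμ := S.mem.1
  have hμ' := S.mem'.1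
  have hβ := S.β_pos
  have ht := S.t_pos
  have hN := S.N_nonneg
  have hν := S.ν_nonneg
  set d := ‖upperDir F f μ x y v‖ with hd
  have hd0 : 0 ≤ d := norm_nonneg _
  have hδ : ‖vstar μ' x' - vstar μ x‖ ≤ C₁ * (4 * (t ^ 3 * β * μ * d) + 2 * N * ν / μ) := by
    refine (h₁ μ S.mem μ' S.mem' x x' S.vstar_le).trans ?_
    rw [S.norm_x_sub, mul_div_assoc]
    gcongr
    have hsq : μ ^ 2 ≤ 4 * μ' ^ 2 := by nlinarith [S.le_two_mul]
    rw [div_le_iff₀ (by positivity)]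
    have h2 : t ^ 3 * β * μ ^ 3 * d ≤ 4 * (t ^ 3 * β * μ * d) * μ' ^ 2 := by
      have : t ^ 3 * β * μ * d * μ ^ 2 ≤ t ^ 3 * β * μ * d * (4 * μ' ^ 2) := by
        gcongr
      linarith
    have h3 : N * ν * μ' ≤ 2 * N * ν / μ * μ' ^ 2 := by
      rw [div_mul_eq_mul_div, le_div_iff₀ hμ]
      have : N * ν * μ' * μ ≤ N * ν * μ' * (2 * μ') := by
        have := S.le_two_mul
        gcongr
      linarith
    linarith [S.abs_sub_le]
  have hβL : t * β * L ≤ 1 := by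
    have := mul_le_mul_of_nonneg_left S.β_mul_le ht.le
    linarith [S.t_le]
  obtain ⟨q, -, hq, hle⟩ := P.multiplier_step S.mem (mul_pos ht hβ).le hβL S.vstar_le y v
  rw [hA] at hle
  set e := ‖y - ystar μ x‖ with he
  have hle' : ‖v' - vstar μ' x'‖ ≤ q + (t * β * (A * e) +
      C₁ * (4 * (t ^ 3 * β * μ * d) + 2 * N * ν / μ)) := by
    rw [S.v_eq]
    calc _ = ‖(v + (t * β) • (grady F x y - hessyy (aggreg μ F f) x y v) - vstar μ x) -
          (vstar μ' x' - vstar μ x)‖ := by congr 1; abel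
      _ ≤ _ := (norm_sub_le _ _).trans (by linarith)
  have hθb : t * β * (μ * σ) / 2 ≤ B * σ / 4 := by
    have h1 : β * μ ≤ B * (1 / 2) := mul_le_mul S.β_le S.mem.2 hμ.le hB
    have h2 : t * (β * μ) ≤ 1 * (β * μ) := by gcongr; exact S.t_le
    nlinarith
  have key := sq_le_of_le_add (θ := t * β * (μ * σ) / 2) (by positivity) hθb
    (e := ‖v - vstar μ x‖) (by convert hq using 2; ring) (norm_nonneg _) hle'
  set w := ‖v - vstar μ x‖
  have e2 : μ ^ 2 * ((t * β * (A * e) + C₁ * (4 * (t ^ 3 * β * μ * d) + 2 * N * ν / μ)) ^ 2 /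
      (t * β * μ)) ≤ 3 * (A ^ 2 + 16 * C₁ ^ 2 + 4 * N ^ 2 * C₁ ^ 2) * (t * (β * μ * e ^ 2) +
          t ^ 2 * (t ^ 3 * β * μ ^ 3 * d ^ 2) + ν ^ 2 / (t * β * μ)) := by
    have h5 : (t * β * (A * e) + C₁ * (4 * (t ^ 3 * β * μ * d) + 2 * N * ν / μ)) ^ 2 ≤
        3 * ((t * β * (A * e)) ^ 2 + (C₁ * (4 * (t ^ 3 * β * μ * d))) ^ 2 +
          (C₁ * (2 * N * ν / μ)) ^ 2) := by
      rw [mul_add C₁]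
      generalize t * β * (A * e) = a
      generalize C₁ * (4 * (t ^ 3 * β * μ * d)) = b
      generalize C₁ * (2 * N * ν / μ) = c
      nlinarith [sq_nonneg (a - b), sq_nonneg (b - c), sq_nonneg (a - c)]
    have h6 : μ ^ 2 * (3 * ((t * β * (A * e)) ^ 2 + (C₁ * (4 * (t ^ 3 * β * μ * d))) ^ 2 +
          (C₁ * (2 * N * ν / μ)) ^ 2) / (t * β * μ)) =
        3 * (A ^ 2 * μ ^ 0 * (t * (β * μ * e ^ 2)) +
          16 * C₁ ^ 2 * (t ^ 2 * (t ^ 3 * β * μ ^ 3 * d ^ 2)) +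
            4 * N ^ 2 * C₁ ^ 2 * (ν ^ 2 / (t * β * μ))) := by
      field_simp; ring
    have h7 : 0 ≤ t ^ 2 * (t ^ 3 * β * μ ^ 3 * d ^ 2) := by positivity
    have h8 : 0 ≤ ν ^ 2 / (t * β * μ) := by positivity
    have h9 : 0 ≤ t * (β * μ * e ^ 2) := by positivity
    calc _ ≤ _ := by gcongr
      _ = _ := h6
      _ ≤ _ := by
        rw [pow_zero, mul_one, mul_assoc 3]
        exact mul_le_mul_of_nonneg_left (add_mul_add_mul_le (by positivity) (by positivity)
          (by positivity) h9 h7 h8) (by norm_num)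
  have e3 : (1 + B * σ / 4) / (t * β * (μ * σ) / 2) *
      (t * β * (A * e) + C₁ * (4 * (t ^ 3 * β * μ * d) + 2 * N * ν / μ)) ^ 2 =
      (1 + B * σ / 4) * (2 / σ) *
      ((t * β * (A * e) + C₁ * (4 * (t ^ 3 * β * μ * d) + 2 * N * ν / μ)) ^ 2 / (t * β * μ)) := by
    generalize (t * β * (A * e) + C₁ * (4 * (t ^ 3 * β * μ * d) + 2 * N * ν / μ)) ^ 2 = Q
    field_simp
  rw [e3] at key
  have hmul : μ' ^ 2 * ‖v' - vstar μ' x'‖ ^ 2 ≤ μ ^ 2 * ‖v' - vstar μ' x'‖ ^ 2 := by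
    have := S.anti
    gcongr
  have hkey := mul_le_mul_of_nonneg_left key (sq_nonneg μ)
  have hB' : 0 ≤ (1 + B * σ / 4) * (2 / σ) := by positivity
  have he2 := mul_le_mul_of_nonneg_left e2 hB'
  generalize (t * β * (A * e) + C₁ * (4 * (t ^ 3 * β * μ * d) + 2 * N * ν / μ)) ^ 2 /
    (t * β * μ) = Q at *
  refine hmul.trans (hkey.trans ?_)
  calc _ = μ ^ 2 * w ^ 2 - σ / 2 * (t * β * μ ^ 3 * w ^ 2) +
        (1 + B * σ / 4) * (2 / σ) * (μ ^ 2 * Q) := by ring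
    _ ≤ _ := by rw [mul_assoc ((1 + B * σ / 4) * (2 / σ))]; gcongr

/-- Decrease of the aggregated upper-level value along one iteration. -/
lemma Problem.exists_upper_value_le (P : Problem F f ystar vstar σ M L) (hD : 0 ≤ D) :
    ∃ C, 0 ≤ C ∧ ∀ {μ μ' t β ν : ℝ} {x x' : Eu n} {y y' v v' : Eu m},
      Step F f ystar vstar L D B N μ μ' t β ν x x' y y' v v' →
      F x' (ystar μ' x') ≤ F x (ystar μ x) -
        1 / 2 * (t ^ 3 * β * μ ^ 3 * ‖gradPhi F f ystar vstar μ x‖ ^ 2) -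
        1 / 2 * (t ^ 3 * β * μ ^ 3 * ‖upperDir F f μ x y v‖ ^ 2) +
        C * (t ^ 3 * (t ^ 3 * β * μ ^ 3 * ‖upperDir F f μ x y v‖ ^ 2) +
          t ^ 3 * β * μ ^ 3 * (‖y - ystar μ x‖ ^ 2 + ‖v - vstar μ x‖ ^ 2) +
          |μ' - μ| + ν ^ 2) := by
  obtain ⟨C₁, hC₁, h₁⟩ := P.exists_descent hD
  obtain ⟨C₂, hC₂, h₂⟩ := P.exists_drift hD
  have hM := P.M_nonneg
  rcases lt_or_ge B 0 with hB | hB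
  · exact ⟨0, le_rfl, fun S => absurd (S.β_pos.trans_le S.β_le) hB.not_gt⟩
  obtain ⟨A, hA⟩ : ∃ A, M * (1 + D) = A := ⟨_, rfl⟩
  have hA0 : 0 ≤ A := hA ▸ (by positivity)
  refine ⟨C₁ * B + A ^ 2 + M ^ 2 + C₂ * (1 + N ^ 2), by positivity,
    fun {μ μ' t β ν x x' y y' v v'} S => ?_⟩
  have hμ := S.mem.1
  have hμ' := S.mem'.1
  have hβ := S.β_pos
  have ht := S.t_pos
  have hN := S.N_nonneg
  have hν := S.ν_nonneg
  have k1 := h₁ μ S.mem x x' S.vstar_le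
  have k2 := h₂ μ S.mem μ' S.mem' x' S.vstar_le'
  have k3 := P.norm_upperDir_sub_le S.mem S.vstar_le y v
  rw [hA] at k3
  have k4 : (|μ' - μ| / μ) ^ 2 ≤ N ^ 2 * ν ^ 2 := by
    rw [← mul_pow]
    gcongr
    rw [div_le_iff₀ hμ]
    refine S.abs_sub_le.trans ?_
    have := S.anti
    gcongr
  rw [S.norm_x_sub] at k1
  have hx : x' - x = -((t ^ 3 * β * μ ^ 3) • upperDir F f μ x y v) := by
    rw [S.x_eq]; abel
  rw [hx, inner_neg_right, inner_smul_right] at k1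
  set a := gradPhi F f ystar vstar μ x
  set d := upperDir F f μ x y v
  set e := ‖y - ystar μ x‖
  set w := ‖v - vstar μ x‖
  obtain ⟨α, hα⟩ : ∃ α, t ^ 3 * β * μ ^ 3 = α := ⟨_, rfl⟩
  have hα0 : 0 ≤ α := hα ▸ (by positivity)
  have k5 : C₁ / μ ^ 2 * (α * ‖d‖) ^ 2 ≤ C₁ * B * (t ^ 3 * (α * ‖d‖ ^ 2)) := by
    have : C₁ / μ ^ 2 * (α * ‖d‖) ^ 2 = C₁ * (β * μ) * (t ^ 3 * (α * ‖d‖ ^ 2)) := by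
      rw [← hα]; field_simp
    rw [this]
    have h3 : β * μ ≤ B := by nlinarith [S.β_le, S.mem.2]
    gcongr
  have k6 : ‖d - a‖ ^ 2 ≤ 2 * (A ^ 2 + M ^ 2) * (e ^ 2 + w ^ 2) := by
    have h3 : ‖d - a‖ ^ 2 ≤ (A * e + M * w) ^ 2 := by gcongr
    nlinarith [add_sq_le (a := A * e) (b := M * w), mul_nonneg (sq_nonneg A) (sq_nonneg w),
      mul_nonneg (sq_nonneg M) (sq_nonneg e)]
  have k7 : ⟪a, d⟫ = (‖a‖ ^ 2 + ‖d‖ ^ 2 - ‖d - a‖ ^ 2) / 2 := by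
    rw [norm_sub_sq_real, real_inner_comm]; ring
  rw [hα] at k1 ⊢
  rw [k7] at k1
  have k8 : α * ‖d - a‖ ^ 2 ≤ α * (2 * (A ^ 2 + M ^ 2) * (e ^ 2 + w ^ 2)) := by gcongr
  have k9 : C₂ * (|μ' - μ| + (|μ' - μ| / μ) ^ 2) ≤ C₂ * (|μ' - μ| + N ^ 2 * ν ^ 2) := by gcongr
  have g1 : 0 ≤ t ^ 3 * (α * ‖d‖ ^ 2) := by positivity
  have g2 : 0 ≤ α * (e ^ 2 + w ^ 2) := by positivity
  have g3 : 0 ≤ |μ' - μ| := abs_nonneg _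
  have g4 : 0 ≤ ν ^ 2 := sq_nonneg _
  have f1 : C₁ * B * (t ^ 3 * (α * ‖d‖ ^ 2)) + (A ^ 2 + M ^ 2) * (α * (e ^ 2 + w ^ 2)) +
      C₂ * (|μ' - μ| + N ^ 2 * ν ^ 2) ≤ (C₁ * B + A ^ 2 + M ^ 2 + C₂ * (1 + N ^ 2)) *
      (t ^ 3 * (α * ‖d‖ ^ 2) + α * (e ^ 2 + w ^ 2) + |μ' - μ| + ν ^ 2) := by
    have g5 : C₂ * (|μ' - μ| + N ^ 2 * ν ^ 2) ≤ C₂ * (1 + N ^ 2) * (|μ' - μ| + ν ^ 2) := by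
      rw [mul_assoc]
      refine mul_le_mul_of_nonneg_left ?_ hC₂
      nlinarith [mul_nonneg (sq_nonneg N) g3]
    have g6 := add_mul_add_mul_le (a := C₁ * B) (b := A ^ 2 + M ^ 2) (c := C₂ * (1 + N ^ 2))
      (by positivity) (by positivity) (by positivity) g1 g2 (add_nonneg g3 g4)
    refine le_trans ?_ (g6.trans_eq (by ring))
    linarith
  linarith

/-- The potential function driving the convergence analysis. -/
def potential (F : Eu n → Eu m → ℝ) (ystar vstar : ℝ → Eu n → Eu m) (μ : ℝ) (x : Eu n)
    (y v : Eu m) : ℝ :=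
  F x (ystar μ x) + ‖y - ystar μ x‖ ^ 2 + μ ^ 2 * ‖v - vstar μ x‖ ^ 2

/-- One-step decrease of the potential. -/
lemma Problem.exists_potential_le (P : Problem F f ystar vstar σ M L) (hD : 0 ≤ D) :
    ∃ C, 0 ≤ C ∧ ∀ {μ μ' t β ν : ℝ} {x x' : Eu n} {y y' v v' : Eu m},
      Step F f ystar vstar L D B N μ μ' t β ν x x' y y' v v' →
      potential F ystar vstar μ' x' y' v' +
        (1 / 2 * (t ^ 3 * β * μ ^ 3 * ‖gradPhi F f ystar vstar μ x‖ ^ 2) +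
          (1 / 2 - C * t) * (t ^ 3 * β * μ ^ 3 * ‖upperDir F f μ x y v‖ ^ 2) +
          (σ / 2 - C * t) * (β * μ * ‖y - ystar μ x‖ ^ 2) +
          (σ / 2 - C * t) * (t * β * μ ^ 3 * ‖v - vstar μ x‖ ^ 2)) ≤
        potential F ystar vstar μ x y v +
          C * (|μ' - μ| + ν ^ 2 + ν ^ 2 / (t * β * μ)) := by
  obtain ⟨C₁, hC₁, h₁⟩ := P.exists_lower_error_le (B := B) (N := N) hD
  obtain ⟨C₂, hC₂, h₂⟩ := P.exists_multiplier_error_le (B := B) (N := N) hD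
  obtain ⟨C₃, hC₃, h₃⟩ := P.exists_upper_value_le (B := B) (N := N) hD
  refine ⟨C₁ + C₂ + C₃, by positivity,
    fun {μ μ' t β ν x x' y y' v v'} S => ?_⟩
  have k1 := h₁ S
  have k2 := h₂ S
  have k3 := h₃ S
  have hμ := S.mem.1
  have hβ := S.β_pos
  have ht := S.t_pos
  have ht1 := S.t_le
  simp only [potential]
  set a := ‖gradPhi F f ystar vstar μ x‖
  set d := ‖upperDir F f μ x y v‖
  set e := ‖y - ystar μ x‖
  set w := ‖v - vstar μ x‖
  have g1 : t ^ 3 * (t ^ 3 * β * μ ^ 3 * d ^ 2) ≤ t * (t ^ 3 * β * μ ^ 3 * d ^ 2) := by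
    gcongr; nlinarith [pow_le_one₀ ht.le ht1 (n := 2)]
  have g2 : t ^ 2 * (t ^ 3 * β * μ ^ 3 * d ^ 2) ≤ t * (t ^ 3 * β * μ ^ 3 * d ^ 2) := by
    gcongr; nlinarith
  have g3 : ν ^ 2 / (β * μ) ≤ ν ^ 2 / (t * β * μ) := by
    have : t * β * μ ≤ β * μ := by
      rw [mul_assoc]; exact mul_le_of_le_one_left (by positivity) ht1
    gcongr
  have g4 : t ^ 3 * β * μ ^ 3 * (e ^ 2 + w ^ 2) ≤
      t * (β * μ * e ^ 2) + t * (t * β * μ ^ 3 * w ^ 2) := by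
    have h2 : μ ^ 2 ≤ 1 := by nlinarith [S.mem.2]
    have h3 : t ^ 2 ≤ 1 := pow_le_one₀ ht.le ht1
    have h4 : t ^ 2 * μ ^ 2 * (t * (β * μ * e ^ 2)) ≤ 1 * 1 * (t * (β * μ * e ^ 2)) := by gcongr
    have h5 : t * (t * (t * β * μ ^ 3 * w ^ 2)) ≤ 1 * (t * (t * β * μ ^ 3 * w ^ 2)) := by gcongr
    linarith
  have n1 : 0 ≤ t ^ 3 * β * μ ^ 3 * d ^ 2 := by positivity
  have n2 : 0 ≤ β * μ * e ^ 2 := by positivity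
  have n3 : 0 ≤ t * β * μ ^ 3 * w ^ 2 := by positivity
  have n4 : 0 ≤ ν ^ 2 / (t * β * μ) := by positivity
  have n5 : 0 ≤ |μ' - μ| := abs_nonneg _
  generalize t ^ 3 * β * μ ^ 3 * d ^ 2 = d' at *
  generalize β * μ * e ^ 2 = e' at *
  generalize t * β * μ ^ 3 * w ^ 2 = w' at *
  generalize ν ^ 2 / (t * β * μ) = s at *
  generalize ν ^ 2 / (β * μ) = s' at *
  have m1 : C₁ * (t ^ 3 * d' + s') ≤ C₁ * (t * d' + s) := by gcongr
  have m2 : C₂ * (t * e' + t ^ 2 * d' + s) ≤ C₂ * (t * e' + t * d' + s) := by gcongr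
  have m3 : C₃ * (t ^ 3 * d' + t ^ 3 * β * μ ^ 3 * (e ^ 2 + w ^ 2) + |μ' - μ| + ν ^ 2) ≤
      C₃ * (t * d' + (t * e' + t * w') + |μ' - μ| + ν ^ 2) := by gcongr
  have n1' := mul_nonneg ht.le n1
  have n2' := mul_nonneg ht.le n2
  have n3' := mul_nonneg ht.le n3
  have n6 : 0 ≤ ν ^ 2 := sq_nonneg _
  generalize ν ^ 2 = r at *
  generalize |μ' - μ| = z at *
  have r1 : C₁ * (t * d' + s) ≤ C₁ * (t * d' + t * e' + t * w' + z + r + s) :=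
    mul_le_mul_of_nonneg_left (by linarith) hC₁
  have r2 : C₂ * (t * e' + t * d' + s) ≤ C₂ * (t * d' + t * e' + t * w' + z + r + s) :=
    mul_le_mul_of_nonneg_left (by linarith) hC₂
  have r3 : C₃ * (t * d' + (t * e' + t * w') + z + r) ≤
      C₃ * (t * d' + t * e' + t * w' + z + r + s) :=
    mul_le_mul_of_nonneg_left (by linarith) hC₃
  linarith

end Recursion

section Sequences

lemma summable_of_add_le {V g s : ℕ → ℝ} {V₀ : ℝ} (hV : ∀ k, V₀ ≤ V k) (hg : ∀ k, 0 ≤ g k)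
    (hs : Summable s) (hs0 : ∀ k, 0 ≤ s k) (h : ∀ᶠ k in atTop, V (k + 1) + g k ≤ V k + s k) :
    Summable g := by
  obtain ⟨k₀, hk₀⟩ := eventually_atTop.1 h
  rw [← summable_nat_add_iff k₀]
  refine summable_of_sum_range_le (c := V k₀ - V₀ + ∑' k, s (k + k₀)) (fun k => hg _) fun n => ?_
  have h1 : ∀ n, V (n + k₀) + ∑ i ∈ Finset.range n, g (i + k₀) ≤
      V k₀ + ∑ i ∈ Finset.range n, s (i + k₀) := by
    intro n
    induction n with
    | zero => simp
    | succ n ih =>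
      rw [Finset.sum_range_succ, Finset.sum_range_succ]
      have := hk₀ (n + k₀) (by omega)
      rw [show n + 1 + k₀ = n + k₀ + 1 by ring]
      linarith
  have h2 := ((summable_nat_add_iff k₀).2 hs).sum_le_tsum (Finset.range n) fun i _ => hs0 _
  linarith [h1 n, hV (n + k₀)]

lemma tendsto_zero_of_summable_mul {u s b : ℕ → ℝ} (hu : ∀ k, 0 ≤ u k) (hb : ∀ k, 0 ≤ b k)
    (hs : Summable s) (h : ∀ k, u (k + 1) ≤ u k + s k)
    (hbu : Summable fun k => b k * u k) (hb' : ¬ Summable b) : Tendsto u atTop (𝓝 0) := by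
  obtain ⟨l, hl⟩ : ∃ l, Tendsto u atTop (𝓝 l) := by
    have hanti : Antitone fun k => u k - ∑ i ∈ Finset.range k, s i := by
      refine antitone_nat_of_succ_le fun k => ?_
      rw [Finset.sum_range_succ]
      linarith [h k]
    have hS := hs.hasSum.tendsto_sum_nat
    obtain ⟨b, hb⟩ := hS.bddAbove_range
    have hbdd : BddBelow (range fun k => u k - ∑ i ∈ Finset.range k, s i) := by
      refine ⟨-b, ?_⟩
      rintro _ ⟨k, rfl⟩
      have := hb (mem_range_self k)
      dsimp only at this ⊢
      linarith [hu k]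
    refine ⟨_, ((tendsto_atTop_ciInf hanti hbdd).add hS).congr fun k => ?_⟩
    ring
  rcases (ge_of_tendsto' hl hu).eq_or_lt with h0 | h0
  · rwa [← h0] at hl
  refine absurd ?_ hb'
  have hev : ∀ᶠ k in atTop, l / 2 ≤ u k := (hl.eventually (lt_mem_nhds (half_lt_self h0))).mono
    fun k hk => hk.le
  refine Summable.of_norm_bounded_eventually_nat (hbu.mul_left (2 / l)) (hev.mono fun k hk => ?_)
  rw [Real.norm_of_nonneg (hb k)]
  calc b k = 2 / l * (b k * (l / 2)) := by field_simp
    _ ≤ _ := by have := hb k; gcongr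

lemma summable_add_one_rpow {r : ℝ} (hr : 1 < r) : Summable fun k : ℕ => ((k : ℝ) + 1) ^ (-r) := by
  have := (summable_nat_add_iff 1).2 (Real.summable_nat_rpow.2 (neg_lt_neg hr))
  simpa using this

lemma not_summable_add_one_rpow {r : ℝ} (hr : r ≤ 1) :
    ¬ Summable fun k : ℕ => ((k : ℝ) + 1) ^ (-r) := by
  intro h
  have h1 : Summable fun k : ℕ => ((k + 1 : ℕ) : ℝ) ^ (-r) := by simpa using h
  have := Real.summable_nat_rpow.1
    ((summable_nat_add_iff (f := fun k : ℕ => (k : ℝ) ^ (-r)) 1).1 h1)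
  linarith

lemma exists_le_rpow_of_summable {Q : ℕ → ℝ} {r : ℝ} (hr : 0 ≤ r) (hQ : ∀ k, 0 ≤ Q k)
    (h : Summable fun k : ℕ => ((k : ℝ) + 1) ^ (-r) * Q k) :
    ∃ C, 0 < C ∧ ∀ K : ℕ, 1 ≤ K → ∃ k ≤ K, (K : ℝ) ≤ 2 * ((k : ℝ) + 1) ∧
      Q k ≤ C * (K : ℝ) ^ (-(1 - r)) := by
  set S := ∑' k : ℕ, ((k : ℝ) + 1) ^ (-r) * Q k with hS
  have hS0 : 0 ≤ S := tsum_nonneg fun k => by have := hQ k; positivity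
  refine ⟨(S + 1) * 2 * 2 ^ r, by positivity, fun K hK => ?_⟩
  by_contra! hcon
  have hKpos : (0 : ℝ) < K := by exact_mod_cast hK
  have hterm : ∀ k ∈ Finset.Icc (K / 2) K, (S + 1) * 2 / K ≤ ((k : ℝ) + 1) ^ (-r) * Q k := by
    intro k hk
    rw [Finset.mem_Icc] at hk
    have hk2 : (K : ℝ) ≤ 2 * ((k : ℝ) + 1) := by
      have : K ≤ 2 * (k + 1) := by omega
      exact_mod_cast this
    have h1 := hcon k hk.2 hk2
    have h2 : (k : ℝ) + 1 ≤ 2 * K := by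
      have : k + 1 ≤ 2 * K := by omega
      exact_mod_cast this
    have h3 : (2 * (K : ℝ)) ^ (-r) ≤ ((k : ℝ) + 1) ^ (-r) :=
      Real.rpow_le_rpow_of_nonpos (by positivity) h2 (by linarith)
    calc (S + 1) * 2 / K = (2 * (K : ℝ)) ^ (-r) * ((S + 1) * 2 * 2 ^ r * (K : ℝ) ^ (-(1 - r))) := by
          rw [Real.mul_rpow (by norm_num) hKpos.le]
          have e1 : (2 : ℝ) ^ (-r) * 2 ^ r = 1 := by
            rw [← Real.rpow_add (by norm_num)]; simp
          have e2 : (K : ℝ) ^ (-r) * (K : ℝ) ^ (-(1 - r)) = (K : ℝ)⁻¹ := by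
            rw [← Real.rpow_add hKpos, ← Real.rpow_neg_one]; congr 1; ring
          rw [div_eq_mul_inv, ← e2]
          linear_combination (S + 1) * 2 * ((K : ℝ) ^ (-r) * (K : ℝ) ^ (-(1 - r))) * (-e1)
      _ ≤ _ := by gcongr
  have hsum := Finset.card_nsmul_le_sum _ _ _ hterm
  have hle := h.sum_le_tsum (Finset.Icc (K / 2) K) fun k _ => by have := hQ k; positivity
  rw [nsmul_eq_mul, Nat.card_Icc] at hsum
  have hcard : (K : ℝ) / 2 ≤ ((K + 1 - K / 2 : ℕ) : ℝ) := by
    rw [div_le_iff₀ (by norm_num)]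
    have : K ≤ (K + 1 - K / 2) * 2 := by omega
    exact_mod_cast this
  have h4 : (K : ℝ) / 2 * ((S + 1) * 2 / K) ≤ ((K + 1 - K / 2 : ℕ) : ℝ) * ((S + 1) * 2 / K) := by
    gcongr
  have h5 : (K : ℝ) / 2 * ((S + 1) * 2 / K) = S + 1 := by field_simp
  linarith

end Sequences

section Run

variable {F f : Eu n → Eu m → ℝ} {ystar vstar : ℝ → Eu n → Eu m}
  {σ M L D B N p τ μbar βbar : ℝ} {μ β : ℕ → ℝ} {x : ℕ → Eu n} {y v : ℕ → Eu m}

/-- A run of sl-BAMM with the polynomial schedules of the parameters. -/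
structure Run (F f : Eu n → Eu m → ℝ) (ystar vstar : ℝ → Eu n → Eu m)
    (L D B N p τ μbar βbar : ℝ) (μ β : ℕ → ℝ) (x : ℕ → Eu n) (y v : ℕ → Eu m) : Prop where
  step : ∀ k : ℕ, Step F f ystar vstar L D B N (μ k) (μ (k + 1)) (((k : ℝ) + 1) ^ (-(τ / 2))) (β k)
    (((k : ℝ) + 1)⁻¹) (x k) (x (k + 1)) (y k) (y (k + 1)) (v k) (v (k + 1))
  μ_eq : ∀ k : ℕ, μ k = μbar * ((k : ℝ) + 1) ^ (-p)
  le_β : ∀ k : ℕ, βbar * ((k : ℝ) + 1) ^ (-(τ / 2)) ≤ β k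
  p_pos : 0 < p
  p_lt : p < 1 / 4
  τ_pos : 0 < τ
  τ_lt : τ < 1 / 12
  μbar_pos : 0 < μbar
  βbar_pos : 0 < βbar

/-- The step size of the upper-level variable. -/
def upperStep (τ : ℝ) (μ β : ℕ → ℝ) (k : ℕ) : ℝ :=
  (((k : ℝ) + 1) ^ (-(τ / 2))) ^ 3 * β k * μ k ^ 3

lemma rpow_pow_three {a r : ℝ} (ha : 0 < a) : (a ^ r) ^ 3 = a ^ (3 * r) := by
  rw [← Real.rpow_natCast, ← Real.rpow_mul ha.le]; congr 1; push_cast; ring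

namespace Run

lemma upperStep_pos (R : Run F f ystar vstar L D B N p τ μbar βbar μ β x y v) (k : ℕ) :
    0 < upperStep τ μ β k := by
  have h1 := (R.step k).mem.1
  have h2 := (R.step k).β_pos
  unfold upperStep
  positivity

lemma le_mul_μ (R : Run F f ystar vstar L D B N p τ μbar βbar μ β x y v) (k : ℕ) :
    βbar * μbar * ((k : ℝ) + 1) ^ (-(τ / 2 + p)) ≤ β k * μ k := by
  have hpos : (0 : ℝ) < (k : ℝ) + 1 := by positivity
  have h1 := R.μbar_pos
  rw [R.μ_eq, neg_add, Real.rpow_add hpos]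
  have := R.le_β k
  calc _ = βbar * ((k : ℝ) + 1) ^ (-(τ / 2)) * (μbar * ((k : ℝ) + 1) ^ (-p)) := by ring
    _ ≤ _ := by gcongr

lemma le_mul_μ_cube (R : Run F f ystar vstar L D B N p τ μbar βbar μ β x y v) (k : ℕ) :
    βbar * μbar ^ 3 * ((k : ℝ) + 1) ^ (-(τ + 3 * p)) ≤
      ((k : ℝ) + 1) ^ (-(τ / 2)) * β k * μ k ^ 3 := by
  have hpos : (0 : ℝ) < (k : ℝ) + 1 := by positivity
  have h1 := R.μbar_pos
  have := R.le_β k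
  rw [R.μ_eq, mul_pow, rpow_pow_three hpos,
    show -(τ + 3 * p) = -(τ / 2) + (-(τ / 2) + 3 * (-p)) by ring, Real.rpow_add hpos,
    Real.rpow_add hpos]
  calc _ = ((k : ℝ) + 1) ^ (-(τ / 2)) * (βbar * ((k : ℝ) + 1) ^ (-(τ / 2))) *
        (μbar ^ 3 * ((k : ℝ) + 1) ^ (3 * (-p))) := by ring
    _ ≤ _ := by gcongr

lemma le_upperStep (R : Run F f ystar vstar L D B N p τ μbar βbar μ β x y v) (k : ℕ) :
    βbar * μbar ^ 3 * ((k : ℝ) + 1) ^ (-(2 * τ + 3 * p)) ≤ upperStep τ μ β k := by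
  have hpos : (0 : ℝ) < (k : ℝ) + 1 := by positivity
  have h1 := R.le_mul_μ_cube k
  have h2 : upperStep τ μ β k = ((k : ℝ) + 1) ^ (-τ) *
      (((k : ℝ) + 1) ^ (-(τ / 2)) * β k * μ k ^ 3) := by
    have : ((k : ℝ) + 1) ^ (-τ) = ((k : ℝ) + 1) ^ (-(τ / 2)) * ((k : ℝ) + 1) ^ (-(τ / 2)) := by
      rw [← Real.rpow_add hpos]; congr 1; ring
    rw [this, upperStep]; ring
  rw [h2, show -(2 * τ + 3 * p) = -τ + -(τ + 3 * p) by ring, Real.rpow_add hpos]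
  calc _ = ((k : ℝ) + 1) ^ (-τ) * (βbar * μbar ^ 3 * ((k : ℝ) + 1) ^ (-(τ + 3 * p))) := by ring
    _ ≤ _ := by gcongr

lemma upperStep_le (R : Run F f ystar vstar L D B N p τ μbar βbar μ β x y v) (k : ℕ) :
    upperStep τ μ β k ≤ B * μbar ^ 3 * ((k : ℝ) + 1) ^ (-(3 * τ / 2 + 3 * p)) := by
  have hpos : (0 : ℝ) < (k : ℝ) + 1 := by positivity
  have h1 := R.μbar_pos
  have := (R.step k).β_le
  rw [upperStep, R.μ_eq, mul_pow, rpow_pow_three hpos, rpow_pow_three hpos,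
    show -(3 * τ / 2 + 3 * p) = 3 * (-(τ / 2)) + 3 * (-p) by ring, Real.rpow_add hpos]
  calc _ ≤ ((k : ℝ) + 1) ^ (3 * (-(τ / 2))) * B * (μbar ^ 3 * ((k : ℝ) + 1) ^ (3 * (-p))) := by
        gcongr
    _ = _ := by ring

lemma summable_perturbation (R : Run F f ystar vstar L D B N p τ μbar βbar μ β x y v) :
    Summable fun k : ℕ => |μ (k + 1) - μ k| + (((k : ℝ) + 1)⁻¹) ^ 2 +
      (((k : ℝ) + 1)⁻¹) ^ 2 / (((k : ℝ) + 1) ^ (-(τ / 2)) * β k * μ k) := by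
  have hp := R.p_pos
  have hp' := R.p_lt
  have hτ' := R.τ_lt
  have h1 := R.μbar_pos
  have h2 := R.βbar_pos
  have e2 : ∀ k : ℕ, (((k : ℝ) + 1)⁻¹) ^ 2 = ((k : ℝ) + 1) ^ (-2 : ℝ) := fun k => by
    rw [Real.rpow_neg (by positivity), inv_pow]; norm_cast
  refine (Summable.add ?_ ?_).add ?_
  · refine Summable.of_nonneg_of_le (fun k => abs_nonneg _) (fun k => ?_)
      ((summable_add_one_rpow (r := 1 + p) (by linarith)).mul_left (N * μbar))
    have hpos : (0 : ℝ) < (k : ℝ) + 1 := by positivity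
    have hN := (R.step k).N_nonneg
    refine (R.step k).abs_sub_le.trans ?_
    calc N * ((k : ℝ) + 1)⁻¹ * μ (k + 1) ≤ N * ((k : ℝ) + 1)⁻¹ * μ k := by
          have := (R.step k).anti; gcongr
      _ = _ := by
          rw [R.μ_eq, neg_add, Real.rpow_add hpos, Real.rpow_neg_one]; ring
  · simp only [e2]
    exact summable_add_one_rpow (by norm_num)
  · refine Summable.of_nonneg_of_le (fun k => ?_) (fun k => ?_)
      ((summable_add_one_rpow (r := 2 - τ - p) (by linarith)).mul_left (βbar * μbar)⁻¹)
    · have := (R.step k).mem.1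
      have := (R.step k).β_pos
      positivity
    · have hpos : (0 : ℝ) < (k : ℝ) + 1 := by positivity
      have hmul : βbar * μbar * ((k : ℝ) + 1) ^ (-(τ + p)) ≤
          ((k : ℝ) + 1) ^ (-(τ / 2)) * β k * μ k := by
        rw [show -(τ + p) = -(τ / 2) + -(τ / 2 + p) by ring, Real.rpow_add hpos]
        calc _ = ((k : ℝ) + 1) ^ (-(τ / 2)) * (βbar * μbar * ((k : ℝ) + 1) ^ (-(τ / 2 + p))) := by
              ring
          _ ≤ ((k : ℝ) + 1) ^ (-(τ / 2)) * (β k * μ k) := by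
              have := R.le_mul_μ k; gcongr
          _ = _ := by ring
      calc _ ≤ (((k : ℝ) + 1)⁻¹) ^ 2 / (βbar * μbar * ((k : ℝ) + 1) ^ (-(τ + p))) := by gcongr
        _ = _ := by
          rw [e2, show -(2 - τ - p) = -2 - -(τ + p) by ring, Real.rpow_sub hpos]
          field_simp

lemma perturbation_nonneg (R : Run F f ystar vstar L D B N p τ μbar βbar μ β x y v) (k : ℕ) :
    0 ≤ |μ (k + 1) - μ k| + (((k : ℝ) + 1)⁻¹) ^ 2 +
      (((k : ℝ) + 1)⁻¹) ^ 2 / (((k : ℝ) + 1) ^ (-(τ / 2)) * β k * μ k) := by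
  have := (R.step k).mem.1
  have := (R.step k).β_pos
  positivity

lemma summable_weighted (P : Problem F f ystar vstar σ M L) {F₀ : ℝ} (hF₀ : ∀ x y, F₀ ≤ F x y)
    (R : Run F f ystar vstar L D B N p τ μbar βbar μ β x y v) :
    (Summable fun k => upperStep τ μ β k * ‖gradPhi F f ystar vstar (μ k) (x k)‖ ^ 2) ∧
    (Summable fun k => upperStep τ μ β k * ‖upperDir F f (μ k) (x k) (y k) (v k)‖ ^ 2) ∧
    (Summable fun k => β k * μ k * ‖y k - ystar (μ k) (x k)‖ ^ 2) ∧
    (Summable fun k : ℕ => ((k : ℝ) + 1) ^ (-(τ / 2)) * β k * μ k ^ 3 *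
      ‖v k - vstar (μ k) (x k)‖ ^ 2) := by
  have hD : 0 ≤ D := (norm_nonneg _).trans (R.step 0).vstar_le
  have hσ := P.σ_pos
  obtain ⟨C, hC, hstep⟩ := P.exists_potential_le (B := B) (N := N) hD
  set c := min (1 / 4) (σ / 4) with hc
  have hcpos : 0 < c := by positivity
  have hpos : ∀ k, 0 < μ k := fun k => (R.step k).mem.1
  have hβ : ∀ k, 0 < β k := fun k => (R.step k).β_pos
  have hα := R.upperStep_pos
  have ht : ∀ᶠ k : ℕ in atTop, C * ((k : ℝ) + 1) ^ (-(τ / 2)) ≤ c := by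
    have h1 : Tendsto (fun k : ℕ => C * ((k : ℝ) + 1) ^ (-(τ / 2))) atTop (𝓝 (C * 0)) :=
      ((tendsto_rpow_neg_atTop (half_pos R.τ_pos)).comp
        (tendsto_atTop_add_const_right _ 1 tendsto_natCast_atTop_atTop)).const_mul C
    rw [mul_zero] at h1
    exact (h1.eventually (gt_mem_nhds hcpos)).mono fun k hk => hk.le
  have n1 : ∀ k, 0 ≤ upperStep τ μ β k * ‖gradPhi F f ystar vstar (μ k) (x k)‖ ^ 2 := fun k => by
    have := (hα k).le; positivity
  have n2 : ∀ k, 0 ≤ upperStep τ μ β k * ‖upperDir F f (μ k) (x k) (y k) (v k)‖ ^ 2 := fun k => by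
    have := (hα k).le; positivity
  have n3 : ∀ k, 0 ≤ β k * μ k * ‖y k - ystar (μ k) (x k)‖ ^ 2 := fun k => by
    have := (hβ k).le; have := (hpos k).le; positivity
  have n4 : ∀ k : ℕ, 0 ≤ ((k : ℝ) + 1) ^ (-(τ / 2)) * β k * μ k ^ 3 *
      ‖v k - vstar (μ k) (x k)‖ ^ 2 := fun k => by
    have := (hβ k).le; have := (hpos k).le; positivity
  have key : Summable fun k : ℕ => c * (
      upperStep τ μ β k * ‖gradPhi F f ystar vstar (μ k) (x k)‖ ^ 2 +
      upperStep τ μ β k * ‖upperDir F f (μ k) (x k) (y k) (v k)‖ ^ 2 +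
      β k * μ k * ‖y k - ystar (μ k) (x k)‖ ^ 2 +
      ((k : ℝ) + 1) ^ (-(τ / 2)) * β k * μ k ^ 3 * ‖v k - vstar (μ k) (x k)‖ ^ 2) := by
    refine summable_of_add_le (V := fun k => potential F ystar vstar (μ k) (x k) (y k) (v k))
      (V₀ := F₀) (fun k => ?_) (fun k => ?_) (R.summable_perturbation.mul_left C)
      (fun k => mul_nonneg hC (R.perturbation_nonneg k)) (ht.mono fun k hk => ?_)
    · have h1 := hF₀ (x k) (ystar (μ k) (x k))
      have h2 : 0 ≤ ‖y k - ystar (μ k) (x k)‖ ^ 2 + μ k ^ 2 * ‖v k - vstar (μ k) (x k)‖ ^ 2 := by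
        positivity
      simp only [potential]
      linarith
    · have := n1 k; have := n2 k; have := n3 k; have := n4 k
      positivity
    · refine le_trans ?_ (hstep (R.step k))
      have c1 : c ≤ 1 / 4 := min_le_left _ _
      have c2 : c ≤ σ / 4 := min_le_right _ _
      have m1 := n1 k
      have m2 := n2 k
      have m3 := n3 k
      have m4 := n4 k
      simp only [upperStep] at m1 m2 ⊢
      have k1 := mul_le_mul_of_nonneg_right (show c ≤ 1 / 2 by linarith) m1
      have k2 := mul_le_mul_of_nonneg_right
        (show c ≤ 1 / 2 - C * ((k : ℝ) + 1) ^ (-(τ / 2)) by linarith) m2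
      have k3 := mul_le_mul_of_nonneg_right
        (show c ≤ σ / 2 - C * ((k : ℝ) + 1) ^ (-(τ / 2)) by linarith) m3
      have k4 := mul_le_mul_of_nonneg_right
        (show c ≤ σ / 2 - C * ((k : ℝ) + 1) ^ (-(τ / 2)) by linarith) m4
      linarith
  have key' := (summable_mul_left_iff hcpos.ne').1 key
  refine ⟨key'.of_nonneg_of_le n1 fun k => ?_, key'.of_nonneg_of_le n2 fun k => ?_,
    key'.of_nonneg_of_le n3 fun k => ?_, key'.of_nonneg_of_le n4 fun k => ?_⟩ <;>
  linarith [n1 k, n2 k, n3 k, n4 k]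

lemma tendsto_lower_error (P : Problem F f ystar vstar σ M L) {F₀ : ℝ} (hF₀ : ∀ x y, F₀ ≤ F x y)
    (R : Run F f ystar vstar L D B N p τ μbar βbar μ β x y v) :
    Tendsto (fun k => ‖y k - ystar (μ k) (x k)‖) atTop (𝓝 0) := by
  have hD : 0 ≤ D := (norm_nonneg _).trans (R.step 0).vstar_le
  obtain ⟨C, hC, hstep⟩ := P.exists_lower_error_le (B := B) (N := N) hD
  obtain ⟨-, hd, he, -⟩ := summable_weighted P hF₀ R
  have hnn : ∀ k, 0 ≤ β k * μ k := fun k =>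
    mul_nonneg (R.step k).β_pos.le (R.step k).mem.1.le
  have hsq : Tendsto (fun k => ‖y k - ystar (μ k) (x k)‖ ^ 2) atTop (𝓝 0) := by
    refine tendsto_zero_of_summable_mul (fun k => sq_nonneg _) hnn
      ((hd.add R.summable_perturbation).mul_left C) (fun k => (hstep (R.step k)).trans ?_) he
      fun hs => ?_
    · have hμ := (R.step k).mem.1
      have hβ := (R.step k).β_pos
      have ht := (R.step k).t_pos
      have ht1 := (R.step k).t_le
      have h1 : 0 ≤ σ / 2 * (β k * μ k * ‖y k - ystar (μ k) (x k)‖ ^ 2) := by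
        have := P.σ_pos.le; positivity
      rw [← upperStep]
      have h2 : (((k : ℝ) + 1) ^ (-(τ / 2))) ^ 3 *
          (upperStep τ μ β k * ‖upperDir F f (μ k) (x k) (y k) (v k)‖ ^ 2) ≤
          upperStep τ μ β k * ‖upperDir F f (μ k) (x k) (y k) (v k)‖ ^ 2 :=
        mul_le_of_le_one_left (by have := (R.upperStep_pos k).le; positivity)
          (pow_le_one₀ ht.le ht1)
      have h3 : (((k : ℝ) + 1)⁻¹) ^ 2 / (β k * μ k) ≤
          (((k : ℝ) + 1)⁻¹) ^ 2 / (((k : ℝ) + 1) ^ (-(τ / 2)) * β k * μ k) := by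
        have : ((k : ℝ) + 1) ^ (-(τ / 2)) * β k * μ k ≤ β k * μ k := by
          rw [mul_assoc]; exact mul_le_of_le_one_left (hnn k) ht1
        gcongr
      have h4 : 0 ≤ |μ (k + 1) - μ k| := abs_nonneg _
      have h5 : 0 ≤ (((k : ℝ) + 1)⁻¹) ^ 2 := sq_nonneg _
      have h6 := mul_le_mul_of_nonneg_left (add_le_add h2
        (h3.trans (le_add_of_nonneg_left (add_nonneg h4 h5)))) hC
      linarith
    · refine not_summable_add_one_rpow (r := τ / 2 + p) (by linarith [R.τ_lt, R.p_lt]) ?_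
      have hpos := mul_pos R.βbar_pos R.μbar_pos
      exact (summable_mul_left_iff hpos.ne').1
        (hs.of_nonneg_of_le (fun k => by positivity) R.le_mul_μ)
  simpa using hsq.sqrt

/-- The stationarity measure, with the gradient of the upper-level value written explicitly. -/
lemma summable_stationarity (P : Problem F f ystar vstar σ M L) {F₀ : ℝ}
    (hF₀ : ∀ x y, F₀ ≤ F x y) (R : Run F f ystar vstar L D B N p τ μbar βbar μ β x y v) :
    Summable fun k : ℕ => ((k : ℝ) + 1) ^ (-(3 * p + 3 * τ)) *
      (‖gradPhi F f ystar vstar (μ k) (x k)‖ ^ 2 + ‖x (k + 1) - x k‖ ^ 2 +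
        ‖y k - ystar (μ k) (x k)‖ ^ 2 + ‖v k - vstar (μ k) (x k)‖ ^ 2) := by
  obtain ⟨ha, hd, he, hw⟩ := summable_weighted P hF₀ R
  have hτ := R.τ_pos
  have hp := R.p_pos
  have h1 := R.μbar_pos
  have h2 := R.βbar_pos
  have hB : 0 ≤ B := (R.step 0).β_pos.le.trans (R.step 0).β_le
  have hmono : ∀ (k : ℕ) {r : ℝ}, r ≤ 3 * p + 3 * τ →
      ((k : ℝ) + 1) ^ (-(3 * p + 3 * τ)) ≤ ((k : ℝ) + 1) ^ (-r) := fun k r hr =>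
    Real.rpow_le_rpow_of_exponent_le (by linarith [Nat.cast_nonneg (α := ℝ) k]) (by linarith)
  have hlow : ∀ {c r : ℝ} {g q : ℕ → ℝ}, 0 < c → r ≤ 3 * p + 3 * τ → (∀ k, 0 ≤ q k) →
      (∀ k : ℕ, c * ((k : ℝ) + 1) ^ (-r) ≤ g k) → (Summable fun k => g k * q k) →
      Summable fun k : ℕ => ((k : ℝ) + 1) ^ (-(3 * p + 3 * τ)) * q k := by
    intro c r g q hc hr hq hg hs
    refine (hs.mul_left c⁻¹).of_nonneg_of_le (fun k => by have := hq k; positivity) fun k => ?_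
    rw [← mul_assoc]
    refine mul_le_mul_of_nonneg_right ((hmono k hr).trans ?_) (hq k)
    rw [inv_mul_eq_div, le_div_iff₀ hc, mul_comm]
    exact hg k
  have s1 := hlow (by positivity) (by linarith) (fun k => sq_nonneg _) R.le_upperStep ha
  have s3 := hlow (by positivity) (by linarith) (fun k => sq_nonneg _) R.le_mul_μ he
  have s4 := hlow (by positivity) (by linarith) (fun k => sq_nonneg _) R.le_mul_μ_cube hw
  have s2 : Summable fun k : ℕ => ((k : ℝ) + 1) ^ (-(3 * p + 3 * τ)) * ‖x (k + 1) - x k‖ ^ 2 := by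
    refine (hd.mul_left (B * μbar ^ 3)).of_nonneg_of_le (fun k => by positivity) fun k => ?_
    have hone : (1 : ℝ) ≤ (k : ℝ) + 1 := by linarith [Nat.cast_nonneg (α := ℝ) k]
    have hα := R.upperStep_pos k
    have hα' : upperStep τ μ β k ≤ B * μbar ^ 3 := (R.upperStep_le k).trans
      (mul_le_of_le_one_right (by positivity)
        (Real.rpow_le_one_of_one_le_of_nonpos hone (by linarith)))
    rw [(R.step k).norm_x_sub, ← upperStep]
    calc _ ≤ 1 * (upperStep τ μ β k * ‖upperDir F f (μ k) (x k) (y k) (v k)‖) ^ 2 := by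
          gcongr
          exact Real.rpow_le_one_of_one_le_of_nonpos hone (by linarith)
      _ = upperStep τ μ β k *
          (upperStep τ μ β k * ‖upperDir F f (μ k) (x k) (y k) (v k)‖ ^ 2) := by ring
      _ ≤ _ := by gcongr
  refine (((s1.add s2).add s3).add s4).congr fun k => ?_
  ring

lemma isBigO_norm_sub (P : Problem F f ystar vstar σ M L) {F₀ : ℝ} (hF₀ : ∀ x y, F₀ ≤ F x y)
    (R : Run F f ystar vstar L D B N p τ μbar βbar μ β x y v) :
    (fun k : ℕ => ‖x (k + 1) - x k‖) =O[atTop] fun k : ℕ => (k : ℝ) ^ (-(3 * p / 2 + τ / 4)) := by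
  obtain ⟨-, hd, -, -⟩ := summable_weighted P hF₀ R
  obtain ⟨T, hT⟩ := hd.tendsto_atTop_zero.bddAbove_range
  have hτ := R.τ_pos
  have hp := R.p_pos
  have h1 := R.μbar_pos
  have hB : 0 ≤ B := (R.step 0).β_pos.le.trans (R.step 0).β_le
  have hT0 : 0 ≤ T := le_trans
    (by have := (R.upperStep_pos 0).le; positivity) (hT (mem_range_self 0))
  refine IsBigO.of_bound (√(B * μbar ^ 3 * T)) (eventually_atTop.2 ⟨1, fun k hk => ?_⟩)
  have hk1 : (1 : ℝ) ≤ k := by exact_mod_cast hk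
  have hk0 : (0 : ℝ) < k := by linarith
  rw [norm_norm, Real.norm_of_nonneg (by positivity)]
  refine le_of_sq_le_sq ?_ (by positivity)
  have hpow : ((k : ℝ) ^ (-(3 * p / 2 + τ / 4))) ^ 2 = (k : ℝ) ^ (-(3 * p / 2 + τ / 4) * 2) := by
    rw [← Real.rpow_natCast, ← Real.rpow_mul hk0.le, Nat.cast_ofNat]
  rw [mul_pow, Real.sq_sqrt (by positivity), hpow, (R.step k).norm_x_sub, ← upperStep]
  have hα := R.upperStep_pos k
  calc _ = upperStep τ μ β k *
          (upperStep τ μ β k * ‖upperDir F f (μ k) (x k) (y k) (v k)‖ ^ 2) := by ring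
    _ ≤ (B * μbar ^ 3 * (k : ℝ) ^ (-(3 * p / 2 + τ / 4) * 2)) * T := by
        refine mul_le_mul ((R.upperStep_le k).trans ?_) (hT (mem_range_self k))
          (by positivity) (by positivity)
        have h3 : ((k : ℝ) + 1) ^ (-(3 * τ / 2 + 3 * p)) ≤ (k : ℝ) ^ (-(3 * τ / 2 + 3 * p)) :=
          Real.rpow_le_rpow_of_nonpos hk0 (by linarith) (by linarith)
        have h4 : (k : ℝ) ^ (-(3 * τ / 2 + 3 * p)) ≤ (k : ℝ) ^ (-(3 * p / 2 + τ / 4) * 2) :=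
          Real.rpow_le_rpow_of_exponent_le hk1 (by linarith)
        have := h3.trans h4
        gcongr
    _ = _ := by ring

end Run

end Run

section LimitPoints

variable {F f : Eu n → Eu m → ℝ} {ystar vstar : ℝ → Eu n → Eu m}
  {σ M L D B N p τ μbar βbar : ℝ} {μ β : ℕ → ℝ} {x : ℕ → Eu n} {y v : ℕ → Eu m}

lemma Problem.grady_f_eq_zero_of_mem_segment (P : Problem F f ystar vstar σ M L) {x : Eu n}
    {y y' : Eu m} (h : grady f x y = 0) (h' : grady f x y' = 0) {s : ℝ} (hs : s ∈ Icc (0 : ℝ) 1) :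
    grady f x (y + s • (y' - y)) = 0 := by
  have hmin : ∀ {w}, grady f x w = 0 → ∀ z, f x w ≤ f x z := fun {w} hw z => by
    have := (P.strongConvex_zero_f x).add_inner_add_le (hasGradientAt_grady P.contDiff_f x w) z
    simpa [hw] using this
  have hle : f x (y + s • (y' - y)) ≤ (1 - s) * f x y + s * f x y' := by
    have := (P.convex x).2 (mem_univ y) (mem_univ y') (sub_nonneg.2 hs.2) hs.1 (by ring)
    rwa [smul_eq_mul, smul_eq_mul,
      show (1 - s) • y + s • y' = y + s • (y' - y) by module] at this
  have heq := (hmin h' y).antisymm (hmin h y')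
  have hloc : IsLocalMin (fun z => f x z) (y + s • (y' - y)) :=
    Eventually.of_forall fun z => hle.trans (by rw [heq]; linarith [hmin h z])
  rw [grady, gradient, hloc.fderiv_eq_zero, map_zero]

lemma Problem.hessyy_f_sub_eq_zero (P : Problem F f ystar vstar σ M L) {x : Eu n} {y y' : Eu m}
    (h : grady f x y = 0) (h' : grady f x y' = 0) : hessyy f x y (y' - y) = 0 := by
  have h1 : HasDerivAt (fun s : ℝ => y + s • (y' - y)) (y' - y) 0 := by
    simpa using ((hasDerivAt_id (0 : ℝ)).smul_const (y' - y)).const_add y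
  have h2 : HasFDerivAt (fun z => grady f x z) (hessyy f x y) (y + (0 : ℝ) • (y' - y)) := by
    simpa using hasFDerivAt_hessyy P.contDiff_f x y
  have h3 := (h2.comp_hasDerivAt (0 : ℝ) h1).hasDerivWithinAt (s := Icc (0 : ℝ) 1)
  have h4 : HasDerivWithinAt ((fun z => grady f x z) ∘ fun s : ℝ => y + s • (y' - y)) 0
      (Icc (0 : ℝ) 1) 0 :=
    (hasDerivWithinAt_const (0 : ℝ) (Icc (0 : ℝ) 1) (0 : Eu m)).congr
      (fun s hs => P.grady_f_eq_zero_of_mem_segment h h' hs)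
      (P.grady_f_eq_zero_of_mem_segment h h' ⟨le_rfl, zero_le_one⟩)
  exact (uniqueDiffOn_Icc zero_lt_one 0 ⟨le_rfl, zero_le_one⟩).eq_deriv _ h3 h4

/-- The lower-level component of a point satisfying the second and third KKT equations is
determined by the upper-level component. -/
lemma Problem.lower_unique (P : Problem F f ystar vstar σ M L) {x : Eu n} {y y' w w' : Eu m}
    (h : grady f x y = 0) (h' : grady f x y' = 0) (hw : grady F x y = hessyy f x y w)
    (hw' : grady F x y' = hessyy f x y' w') : y = y' := by
  have e1 : ⟪grady F x y, y' - y⟫ = 0 := by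
    rw [hw, hessyy_symm P.contDiff_f, P.hessyy_f_sub_eq_zero h h', inner_zero_right]
  have e2 : ⟪grady F x y', y' - y⟫ = 0 := by
    rw [hw', hessyy_symm P.contDiff_f, ← neg_sub y y', map_neg, P.hessyy_f_sub_eq_zero h' h,
      neg_zero, inner_zero_right]
  have key := (P.strongConvex x).le_inner_sub (hasGradientAt_grady P.contDiff_F x) y y'
  rw [inner_sub_left, e1, e2, sub_zero] at key
  have h0 : ‖y' - y‖ ^ 2 ≤ 0 := by
    by_contra! hcon
    exact absurd key (not_le.2 (mul_pos P.σ_pos hcon))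
  have h1 : ‖y' - y‖ = 0 := by nlinarith [norm_nonneg (y' - y)]
  exact (sub_eq_zero.1 (norm_eq_zero.1 h1)).symm

namespace Run

lemma tendsto_μ (R : Run F f ystar vstar L D B N p τ μbar βbar μ β x y v) :
    Tendsto μ atTop (𝓝 0) := by
  have h1 : Tendsto (fun k : ℕ => μbar * ((k : ℝ) + 1) ^ (-p)) atTop (𝓝 (μbar * 0)) :=
    ((tendsto_rpow_neg_atTop R.p_pos).comp
      (tendsto_atTop_add_const_right _ 1 tendsto_natCast_atTop_atTop)).const_mul μbar
  rw [mul_zero] at h1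
  exact h1.congr fun k => (R.μ_eq k).symm

lemma exists_multiplier_of_tendsto (P : Problem F f ystar vstar σ M L) {F₀ : ℝ}
    (hF₀ : ∀ x y, F₀ ≤ F x y) (R : Run F f ystar vstar L D B N p τ μbar βbar μ β x y v)
    {U : Ultrafilter ℕ} (hU : (U : Filter ℕ) ≤ atTop) {a : Eu n} {b : Eu m}
    (ha : Tendsto x U (𝓝 a)) (hb : Tendsto y U (𝓝 b)) :
    ∃ w, grady F a b = hessyy f a b w ∧ grady f a b = 0 ∧
      (Tendsto (fun k => ‖gradPhi F f ystar vstar (μ k) (x k)‖) U (𝓝 0) → 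
        gradx F a b = hessxy f a b w) := by
  have hD : 0 ≤ D := (norm_nonneg _).trans (R.step 0).vstar_le
  obtain ⟨C, hC, h⟩ := P.exists_KKTres_le hD
  obtain ⟨w, -, hw⟩ := (isCompact_closedBall (0 : Eu m) D).ultrafilter_le_nhds
    (U.map fun k => vstar (μ k) (x k)) (le_principal_iff.2 (mem_map.2
      (Eventually.of_forall fun k => by simpa using (R.step k).vstar_le)))
  have hw' : Tendsto (fun k => vstar (μ k) (x k)) U (𝓝 w) := hw
  have hk := fun k : ℕ => h (μ k) (R.step k).mem (x k) (y k) _ (R.step k).vstar_le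
    (R.step k).vstar_le
  simp only [sub_self, norm_zero, add_zero] at hk
  have hz : Tendsto (fun k => C * (‖y k - ystar (μ k) (x k)‖ + μ k)) U (𝓝 0) := by
    have := ((tendsto_lower_error P hF₀ R).add R.tendsto_μ).const_mul C
    rw [add_zero, mul_zero] at this
    exact this.mono_left hU
  refine ⟨w, ?_, ?_, fun hg => ?_⟩
  · refine sub_eq_zero.1 (tendsto_nhds_unique
      (Tendsto.sub (P.lip_grady_F.tendsto ha hb)
        ((isBoundedBilinearMap_apply.continuous.tendsto _).comp
          ((P.lip_hessyy_f.tendsto ha hb).prodMk_nhds hw'))) ?_)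
    exact squeeze_zero_norm (fun k => (hk k).2.1) hz
  · exact tendsto_nhds_unique (P.lip_grady_f.tendsto ha hb)
      (squeeze_zero_norm (fun k => (hk k).2.2) hz)
  · refine sub_eq_zero.1 (tendsto_nhds_unique
      (Tendsto.sub (P.lip_gradx_F.tendsto ha hb)
        ((isBoundedBilinearMap_apply.continuous.tendsto _).comp
          ((P.lip_hessxy_f.tendsto ha hb).prodMk_nhds hw'))) ?_)
    exact squeeze_zero_norm (fun k => (hk k).1) (by simpa using hg.add hz)

lemma tendsto_norm_y_sub (P : Problem F f ystar vstar σ M L) {F₀ : ℝ}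
    (hF₀ : ∀ x y, F₀ ≤ F x y) (R : Run F f ystar vstar L D B N p τ μbar βbar μ β x y v) :
    Tendsto (fun k => ‖y (k + 1) - y k‖) atTop (𝓝 0) := by
  refine squeeze_zero (fun k => norm_nonneg _) (fun k => ?_)
    (by simpa using (tendsto_lower_error P hF₀ R).const_mul (B * M))
  have hμ := (R.step k).mem
  have hlip := P.lip_grady_aggreg hμ (x k) (ystar (μ k) (x k)) (x k) (y k)
  rw [P.grady_ystar hμ, sub_zero, sub_self, norm_zero, zero_add] at hlip
  have hB : 0 ≤ B := (R.step k).β_pos.le.trans (R.step k).β_le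
  rw [(R.step k).y_eq, sub_sub_cancel_left, norm_neg, norm_smul,
    Real.norm_of_nonneg (R.step k).β_pos.le, mul_assoc]
  exact mul_le_mul (R.step k).β_le hlip (norm_nonneg _) hB

lemma exists_le_norm_gradPhi (P : Problem F f ystar vstar σ M L) {F₀ : ℝ}
    (hF₀ : ∀ x y, F₀ ≤ F x y) (R : Run F f ystar vstar L D B N p τ μbar βbar μ β x y v)
    {a : Eu n} {b : Eu m} (hab : ∀ w, grady F a b = hessyy f a b w → grady f a b = 0 →
      gradx F a b ≠ hessxy f a b w) :
    ∃ ε > 0, ∃ r > 0, ∀ᶠ k in atTop, dist (x k) a ≤ r → dist (y k) b ≤ r →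
      ε ≤ ‖gradPhi F f ystar vstar (μ k) (x k)‖ := by
  set l : Filter ℕ := atTop ⊓ comap (fun k => (x k, y k)) (𝓝 (a, b)) with hl
  have hev : ∃ ε > 0, ∀ᶠ k in l, ε ≤ ‖gradPhi F f ystar vstar (μ k) (x k)‖ := by
    by_contra! hcon
    have hclus : MapClusterPt (0 : ℝ) l fun k => ‖gradPhi F f ystar vstar (μ k) (x k)‖ := by
      rw [(Metric.nhds_basis_ball (x := (0 : ℝ))).mapClusterPt_iff_frequently]
      intro ε hε
      refine (hcon ε hε).mono fun k hk => ?_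
      simpa using hk
    obtain ⟨U, hU, hg⟩ := mapClusterPt_iff_ultrafilter.1 hclus
    have hxy : Tendsto (fun k => (x k, y k)) U (𝓝 (a, b)) :=
      tendsto_iff_comap.2 (hU.trans inf_le_right)
    obtain ⟨w, h1, h2, h3⟩ := exists_multiplier_of_tendsto P hF₀ R (hU.trans inf_le_left)
      ((continuous_fst.tendsto _).comp hxy) ((continuous_snd.tendsto _).comp hxy)
    exact hab w h1 h2 (h3 hg)
  obtain ⟨ε, hε, h⟩ := hev
  obtain ⟨t₁, ht₁, t₂, ht₂, hsub⟩ := mem_inf_iff_superset.1 h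
  obtain ⟨s, hs, hst⟩ := mem_comap.1 ht₂
  obtain ⟨r, hr, hrs⟩ := Metric.nhds_basis_closedBall.mem_iff.1 hs
  refine ⟨ε, hε, r, hr, ?_⟩
  filter_upwards [ht₁] with k hk hxk hyk
  exact hsub ⟨hk, hst (hrs (max_le hxk hyk))⟩

lemma exists_shell (P : Problem F f ystar vstar σ M L) {F₀ : ℝ}
    (hF₀ : ∀ x y, F₀ ≤ F x y) (R : Run F f ystar vstar L D B N p τ μbar βbar μ β x y v)
    {a : Eu n} {b w : Eu m} (h1 : grady F a b = hessyy f a b w) (h2 : grady f a b = 0)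
    {r : ℝ} (hr : 0 < r) :
    ∃ δ > 0, ∀ᶠ k in atTop, dist (x k) a ≤ δ → dist (y k) b ≤ r → dist (y k) b < r / 2 := by
  set l : Filter ℕ := atTop ⊓ comap x (𝓝 a) with hl
  have hev : ∀ᶠ k in l, dist (y k) b ≤ r → dist (y k) b < r / 2 := by
    by_contra hcon
    have hne : (l ⊓ 𝓟 {k | ¬ (dist (y k) b ≤ r → dist (y k) b < r / 2)}).NeBot :=
      frequently_iff_neBot.1 (not_eventually.1 hcon)
    obtain ⟨U, hU⟩ := exists_ultrafilter_iff.2 hne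
    have hmem : ∀ᶠ k in (U : Filter ℕ), dist (y k) b ≤ r ∧ r / 2 ≤ dist (y k) b := by
      have : ∀ᶠ k in (U : Filter ℕ), ¬ (dist (y k) b ≤ r → dist (y k) b < r / 2) :=
        le_principal_iff.1 (hU.trans inf_le_right)
      filter_upwards [this] with k hk
      push Not at hk
      exact hk
    obtain ⟨b', -, hb'⟩ := (isCompact_closedBall b r).ultrafilter_le_nhds (U.map y)
      (le_principal_iff.2 (hmem.mono fun k hk => hk.1))
    have hyU : Tendsto y U (𝓝 b') := hb'
    have hUl := hU.trans inf_le_left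
    obtain ⟨w', h3, h4, -⟩ := exists_multiplier_of_tendsto P hF₀ R (hUl.trans inf_le_left)
      (tendsto_iff_comap.2 (hUl.trans inf_le_right)) hyU
    have hbb := P.lower_unique h2 h4 h1 h3
    have := ge_of_tendsto (hyU.dist (tendsto_const_nhds (x := b))) (hmem.mono fun k hk => hk.2)
    rw [hbb, dist_self] at this
    linarith
  obtain ⟨t₁, ht₁, t₂, ht₂, hsub⟩ := mem_inf_iff_superset.1 hev
  obtain ⟨s, hs, hst⟩ := mem_comap.1 ht₂
  obtain ⟨δ, hδ, hδs⟩ := Metric.nhds_basis_closedBall.mem_iff.1 hs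
  refine ⟨δ, hδ, ?_⟩
  filter_upwards [ht₁] with k hk hxk
  exact hsub ⟨hk, hst (hδs hxk)⟩

/-- Limit points of the iterates are KKT points: near a limit point that is not a KKT point, the
upper-level steps would be summable, so the iterates would stay there and the step sizes would be
summable. -/
lemma exists_KKTres_eq_zero (P : Problem F f ystar vstar σ M L) {F₀ : ℝ}
    (hF₀ : ∀ x y, F₀ ≤ F x y) (R : Run F f ystar vstar L D B N p τ μbar βbar μ β x y v)
    {a : Eu n} {b : Eu m} (hab : MapClusterPt (a, b) atTop fun k => (x k, y k)) :
    ∃ w, KKTres F f a b w = 0 := by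
  by_contra! hcon
  have hab' : ∀ w, grady F a b = hessyy f a b w → grady f a b = 0 →
      gradx F a b ≠ hessxy f a b w := by
    intro w h1 h2 h3
    exact hcon w (by simp [KKTres, h1, h2, h3])
  obtain ⟨U, hU, hxy⟩ := mapClusterPt_iff_ultrafilter.1 hab
  obtain ⟨w, hw1, hw2, -⟩ := exists_multiplier_of_tendsto P hF₀ R hU
      ((continuous_fst.tendsto _).comp hxy) ((continuous_snd.tendsto _).comp hxy)
  obtain ⟨ε, hε, r, hr, hgrad⟩ := exists_le_norm_gradPhi P hF₀ R hab'
  obtain ⟨δ', hδ', hshell⟩ := exists_shell P hF₀ R hw1 hw2 hr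
  set δ := min δ' r with hδ
  have hδpos : 0 < δ := lt_min hδ' hr
  obtain ⟨sa, sd, -, -⟩ := summable_weighted P hF₀ R
  set g : ℕ → ℝ := fun k =>
    upperStep τ μ β k * ‖upperDir F f (μ k) (x k) (y k) (v k)‖ ^ 2 +
      (ε ^ 2)⁻¹ * (upperStep τ μ β k * ‖gradPhi F f ystar vstar (μ k) (x k)‖ ^ 2) with hg
  have sg : Summable g := sd.add (sa.mul_left _)
  have hg0 : ∀ k, 0 ≤ g k := fun k => by
    have := (R.upperStep_pos k).le
    positivity
  have hstep : ∀ᶠ k in atTop, dist (x k) a ≤ r → dist (y k) b ≤ r →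
      ‖x (k + 1) - x k‖ ≤ g k ∧ upperStep τ μ β k ≤ g k := by
    filter_upwards [hgrad] with k hk h1 h2
    have hα := R.upperStep_pos k
    have h3 : upperStep τ μ β k ≤
        (ε ^ 2)⁻¹ * (upperStep τ μ β k * ‖gradPhi F f ystar vstar (μ k) (x k)‖ ^ 2) := by
      rw [inv_mul_eq_div, le_div_iff₀ (by positivity)]
      have := hk h1 h2
      gcongr
    have h4 : 0 ≤ upperStep τ μ β k * ‖upperDir F f (μ k) (x k) (y k) (v k)‖ ^ 2 := by positivity
    refine ⟨?_, h3.trans (le_add_of_nonneg_left h4)⟩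
    rw [(R.step k).norm_x_sub, ← upperStep]
    set d := ‖upperDir F f (μ k) (x k) (y k) (v k)‖
    calc upperStep τ μ β k * d ≤ upperStep τ μ β k * (d ^ 2 + 1) := by
          gcongr; nlinarith [sq_nonneg (d - 1)]
      _ = upperStep τ μ β k * d ^ 2 + upperStep τ μ β k := by ring
      _ ≤ _ := by simp only [hg]; gcongr
  have hy0 : ∀ᶠ k in atTop, ‖y (k + 1) - y k‖ < r / 2 :=
    (tendsto_norm_y_sub P hF₀ R).eventually (gt_mem_nhds (half_pos hr))
  have htail : ∀ᶠ k in atTop, ∑' i, g (i + k) < δ / 2 :=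
    (tendsto_sum_nat_add g).eventually (gt_mem_nhds (half_pos hδpos))
  obtain ⟨k₀, hk₀⟩ := eventually_atTop.1 (hstep.and (hshell.and hy0))
  have hnear : ∀ᶠ k in (U : Filter ℕ), dist (x k) a < δ / 2 ∧ dist (y k) b < r / 2 := by
    have h1 : ∀ᶠ z : Eu n × Eu m in 𝓝 (a, b), dist z.1 a < δ / 2 ∧ dist z.2 b < r / 2 :=
      ((continuous_fst.tendsto (a, b)).eventually (Metric.ball_mem_nhds a (half_pos hδpos))).and
        ((continuous_snd.tendsto (a, b)).eventually (Metric.ball_mem_nhds b (half_pos hr)))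
    exact hxy.eventually h1
  obtain ⟨k, ⟨hxk, hyk⟩, hkt, hk⟩ :=
    (hnear.and ((htail.and (eventually_ge_atTop k₀)).filter_mono hU)).exists
  have hpartial : ∀ j, ∑ i ∈ Finset.range j, g (i + k) < δ / 2 := fun j =>
    (((summable_nat_add_iff k).2 sg).sum_le_tsum (Finset.range j) fun i _ => hg0 _).trans_lt hkt
  have hstay : ∀ j, dist (x (j + k)) a ≤ dist (x k) a + ∑ i ∈ Finset.range j, g (i + k) ∧
      dist (y (j + k)) b < r / 2 := by
    intro j
    induction j with
    | zero => simpa using hyk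
    | succ j ih =>
      obtain ⟨ih1, ih2⟩ := ih
      obtain ⟨hs, -, hyj⟩ := hk₀ (j + k) (by omega)
      have hxr : dist (x (j + k)) a ≤ r := by
        linarith [hpartial j, min_le_right δ' r]
      have h1 := (hs hxr (by linarith)).1
      rw [← dist_eq_norm] at h1 hyj
      have h2 := dist_triangle (x (j + k + 1)) (x (j + k)) a
      have h3 := dist_triangle (y (j + k + 1)) (y (j + k)) b
      have h4 : dist (x (j + k + 1)) a ≤ dist (x k) a + ∑ i ∈ Finset.range (j + 1), g (i + k) := by
        rw [Finset.sum_range_succ]; linarith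
      have h5 : dist (x (j + k + 1)) a ≤ δ' := by
        linarith [hpartial (j + 1), min_le_left δ' r]
      rw [show j + 1 + k = j + k + 1 by ring]
      exact ⟨h4, (hk₀ (j + k + 1) (by omega)).2.1 h5 (by linarith)⟩
  have hsum : Summable (upperStep τ μ β) := by
    rw [← summable_nat_add_iff k]
    refine ((summable_nat_add_iff k).2 sg).of_nonneg_of_le
      (fun j => (R.upperStep_pos _).le) fun j => ?_
    exact ((hk₀ (j + k) (by omega)).1 (by linarith [(hstay j).1, hpartial j, min_le_right δ' r])
      (by linarith [(hstay j).2])).2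
  have hpos : 0 < βbar * μbar ^ 3 := mul_pos R.βbar_pos (pow_pos R.μbar_pos 3)
  exact not_summable_add_one_rpow (r := 2 * τ + 3 * p) (by linarith [R.p_lt, R.τ_lt])
    ((summable_mul_left_iff hpos.ne').1
      (hsum.of_nonneg_of_le (fun k => by positivity) R.le_upperStep))

end Run

end LimitPoints

section Rates

variable {F f : Eu n → Eu m → ℝ} {ystar vstar : ℝ → Eu n → Eu m}
  {σ M L D B N p τ μbar βbar : ℝ} {μ β : ℕ → ℝ} {x : ℕ → Eu n} {y v : ℕ → Eu m}

lemma rpow_neg_le_one_add_inv_mul {a p : ℝ} (ha : 1 ≤ a) (hp : p ≤ 1) :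
    a ^ (-p) ≤ (1 + a⁻¹) * (a + 1) ^ (-p) := by
  have ha0 : 0 < a := by linarith
  have hinv : 0 < a⁻¹ := by positivity
  have h1 : (1 + a⁻¹) ^ p ≤ 1 + a⁻¹ := by
    simpa using Real.rpow_le_rpow_of_exponent_le (by linarith) hp
  have h2 : a ^ (-p) = (1 + a⁻¹) ^ p * (a + 1) ^ (-p) := by
    have : a + 1 = a * (1 + a⁻¹) := by field_simp
    rw [this, Real.mul_rpow ha0.le (by positivity), Real.rpow_neg (x := 1 + a⁻¹) (by positivity)]
    field_simp
  rw [h2]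
  gcongr

namespace Run

lemma of_stepSizes (hp : 0 < p) (hp' : p < 1 / 4) (hτ : 0 < τ) (hτ' : τ < 1 / 12)
    (hμbar : 0 < μbar) (hμbar' : μbar ≤ 1 / 2) (hβbar : 0 < βbar) {α η : ℕ → ℝ}
    (hμ : ∀ k : ℕ, μ k = μbar * ((k : ℝ) + 1) ^ (-p))
    (hβ : ∀ k : ℕ, β k ∈ Icc (βbar * ((k : ℝ) + 1) ^ (-(τ / 2))) (1 / L))
    (hη : ∀ k : ℕ, η k = ((k : ℝ) + 1) ^ (-(τ / 2)) * β k)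
    (hα : ∀ k : ℕ, α k = ((k : ℝ) + 1) ^ (-(3 * τ / 2)) * β k * μ k ^ 3)
    (hy : ∀ k, y (k + 1) = y k - β k • grady (aggreg (μ k) F f) (x k) (y k))
    (hv : ∀ k, v (k + 1) = v k + η k •
      (grady F (x k) (y k) - hessyy (aggreg (μ k) F f) (x k) (y k) (v k)))
    (hx : ∀ k, x (k + 1) = x k - α k •
      (gradx F (x k) (y k) - hessxy (aggreg (μ k) F f) (x k) (y k) (v k)))
    (hD : ∀ k, ‖vstar (μ k) (x k)‖ ≤ D) :
    Run F f ystar vstar L D (1 / L) 1 p τ μbar βbar μ β x y v := by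
  have one_le : ∀ k : ℕ, (1 : ℝ) ≤ (k : ℝ) + 1 := fun k => by simp
  have hβpos : ∀ k, 0 < β k := fun k => lt_of_lt_of_le (by positivity) (hβ k).1
  have hL : 0 < L := one_div_pos.1 ((hβpos 0).trans_le (hβ 0).2)
  have mem : ∀ k, μ k ∈ Ioc (0 : ℝ) (1 / 2) := fun k => by
    have h1 : ((k : ℝ) + 1) ^ (-p) ≤ 1 :=
      Real.rpow_le_one_of_one_le_of_nonpos (one_le k) (by linarith)
    have h2 : 0 < ((k : ℝ) + 1) ^ (-p) := by positivity
    rw [hμ]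
    exact ⟨by positivity, by nlinarith⟩
  have anti : ∀ k, μ (k + 1) ≤ μ k := fun k => by
    rw [hμ, hμ]
    refine mul_le_mul_of_nonneg_left ?_ hμbar.le
    exact Real.rpow_le_rpow_of_nonpos (by positivity) (by push_cast; linarith) (by linarith)
  have hle : ∀ k, μ k ≤ (1 + ((k : ℝ) + 1)⁻¹) * μ (k + 1) := fun k => by
    have := mul_le_mul_of_nonneg_left
      (rpow_neg_le_one_add_inv_mul (p := p) (one_le k) (by linarith)) hμbar.le
    rw [hμ, hμ]
    push_cast
    linarith
  have hinv : ∀ k : ℕ, ((k : ℝ) + 1)⁻¹ ≤ 1 := fun k => inv_le_one_of_one_le₀ (one_le k)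
  refine ⟨fun k => ⟨mem k, mem _, anti k, ?_, ?_, zero_le_one, by positivity, by positivity,
    Real.rpow_le_one_of_one_le_of_nonpos (one_le k) (by linarith), hβpos k, (hβ k).2,
    (le_div_iff₀ hL).1 (hβ k).2, hD k, hD _, hy k, ?_, ?_⟩, hμ, fun k => (hβ k).1, hp, hp', hτ, hτ',
    hμbar, hβbar⟩
  · exact (hle k).trans (mul_le_mul_of_nonneg_right (by linarith [hinv k]) (mem (k + 1)).1.le)
  · rw [abs_sub_comm, abs_of_nonneg (sub_nonneg.2 (anti k))]
    linarith [hle k]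
  · rw [hv, hη]
  · rw [hx, hα, rpow_pow_three (by positivity)]
    simp only [upperDir]
    ring_nf

lemma exists_stationarity_le (P : Problem F f ystar vstar σ M L) {F₀ : ℝ}
    (hF₀ : ∀ x y, F₀ ≤ F x y) (R : Run F f ystar vstar L D B N p τ μbar βbar μ β x y v) :
    ∃ C > 0, ∀ K : ℕ, 1 ≤ K → ∃ k ≤ K, (K : ℝ) ≤ 2 * ((k : ℝ) + 1) ∧
      ‖gradPhi F f ystar vstar (μ k) (x k)‖ ^ 2 + ‖x (k + 1) - x k‖ ^ 2 +
        ‖y k - ystar (μ k) (x k)‖ ^ 2 + ‖v k - vstar (μ k) (x k)‖ ^ 2 ≤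
          C * (K : ℝ) ^ (-(1 - 3 * p - 3 * τ)) := by
  have := exists_le_rpow_of_summable (by linarith [R.p_pos, R.τ_pos]) (fun k => by positivity)
    (R.summable_stationarity P hF₀)
  rwa [show 1 - (3 * p + 3 * τ) = 1 - 3 * p - 3 * τ by ring] at this

lemma μ_sq_le (R : Run F f ystar vstar L D B N p τ μbar βbar μ β x y v) {k K : ℕ} (hK : 1 ≤ K)
    (hk : (K : ℝ) ≤ 2 * ((k : ℝ) + 1)) :
    μ k ^ 2 ≤ μbar ^ 2 * 2 ^ (2 * p) * (K : ℝ) ^ (-(2 * p)) := by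
  have hK0 : (0 : ℝ) < K := by exact_mod_cast hK
  have h1 : (((k : ℝ) + 1) ^ (-p)) ^ 2 = ((k : ℝ) + 1) ^ (-(2 * p)) := by
    rw [← Real.rpow_natCast, ← Real.rpow_mul (by positivity)]
    congr 1
    push_cast
    ring
  have h2 : ((k : ℝ) + 1) ^ (-(2 * p)) ≤ ((K : ℝ) / 2) ^ (-(2 * p)) :=
    Real.rpow_le_rpow_of_nonpos (by positivity) (by linarith) (by linarith [R.p_pos])
  have h3 : ((K : ℝ) / 2) ^ (-(2 * p)) = 2 ^ (2 * p) * (K : ℝ) ^ (-(2 * p)) := by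
    rw [Real.div_rpow hK0.le (by norm_num), Real.rpow_neg (x := 2) (by norm_num), div_inv_eq_mul,
      mul_comm]
  rw [R.μ_eq, mul_pow, h1, mul_assoc, ← h3]
  gcongr

lemma exists_KKTres_rate (P : Problem F f ystar vstar σ M L) {F₀ : ℝ}
    (hF₀ : ∀ x y, F₀ ≤ F x y) (R : Run F f ystar vstar L D B N p τ μbar βbar μ β x y v)
    {Dv : ℝ} (hDv : ∀ k, ‖v k‖ ≤ Dv) :
    ∃ C > 0, ∀ K : ℕ, 1 ≤ K → ∃ k ≤ K, KKTres F f (x k) (y k) (v k) ≤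
      C * ((K : ℝ) ^ (-(1 - 3 * p - 3 * τ)) + (K : ℝ) ^ (-(2 * p))) := by
  obtain ⟨C₁, hC₁, hstat⟩ := exists_stationarity_le P hF₀ R
  obtain ⟨C₂, hC₂, hres⟩ := P.exists_KKTres_le (D := max D Dv)
    (le_max_of_le_right ((norm_nonneg _).trans (hDv 0)))
  have hμbar := R.μbar_pos
  refine ⟨(2 + 12 * C₂ ^ 2) * (C₁ + μbar ^ 2 * 2 ^ (2 * p)), by positivity, fun K hK => ?_⟩
  obtain ⟨k, hkK, hk2, hk⟩ := hstat K hK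
  refine ⟨k, hkK, ?_⟩
  obtain ⟨ha, hb, hc⟩ := hres (μ k) (R.step k).mem (x k) (y k) (v k)
    ((R.step k).vstar_le.trans (le_max_left _ _)) ((hDv k).trans (le_max_right _ _))
  have hμk := R.μ_sq_le hK hk2
  set g := ‖gradPhi F f ystar vstar (μ k) (x k)‖
  set e := ‖y k - ystar (μ k) (x k)‖
  set w := ‖v k - vstar (μ k) (x k)‖
  set s := C₂ * (e + w + μ k)
  set P₁ := (K : ℝ) ^ (-(1 - 3 * p - 3 * τ))
  set P₂ := (K : ℝ) ^ (-(2 * p))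
  have hP₁ : 0 ≤ P₁ := by positivity
  have hP₂ : 0 ≤ P₂ := by positivity
  have h1 : KKTres F f (x k) (y k) (v k) ≤ (g + s) ^ 2 + s ^ 2 + s ^ 2 := by
    unfold KKTres
    gcongr
  have h2 : (e + w + μ k) ^ 2 ≤ 3 * (e ^ 2 + w ^ 2 + μ k ^ 2) := by
    nlinarith [sq_nonneg (e - w), sq_nonneg (e - μ k), sq_nonneg (w - μ k)]
  have h3 : s ^ 2 ≤ C₂ ^ 2 * (3 * (e ^ 2 + w ^ 2 + μ k ^ 2)) := by
    rw [mul_pow]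
    gcongr
  have h4 : (g + s) ^ 2 ≤ 2 * g ^ 2 + 2 * s ^ 2 := by nlinarith [sq_nonneg (g - s)]
  have h5 : 0 ≤ C₂ ^ 2 * g ^ 2 := by positivity
  have h6 : g ^ 2 + e ^ 2 + w ^ 2 + μ k ^ 2 ≤ C₁ * P₁ + μbar ^ 2 * 2 ^ (2 * p) * P₂ := by
    nlinarith [sq_nonneg ‖x (k + 1) - x k‖]
  have h7 : C₁ * P₁ + μbar ^ 2 * 2 ^ (2 * p) * P₂ ≤
      (C₁ + μbar ^ 2 * 2 ^ (2 * p)) * (P₁ + P₂) := by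
    have : 0 ≤ C₁ * P₂ + μbar ^ 2 * 2 ^ (2 * p) * P₁ := by positivity
    linarith
  calc KKTres F f (x k) (y k) (v k)
      ≤ (2 + 12 * C₂ ^ 2) * (g ^ 2 + e ^ 2 + w ^ 2 + μ k ^ 2) := by
        nlinarith [sq_nonneg e, sq_nonneg w, sq_nonneg (μ k)]
    _ ≤ (2 + 12 * C₂ ^ 2) * ((C₁ + μbar ^ 2 * 2 ^ (2 * p)) * (P₁ + P₂)) := by
        gcongr
        exact h6.trans h7
    _ = _ := by ring

end Run

end Rates

end BAMM

/-- non-asymptotic convergence of sl-BAMM. -/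
theorem slBAMM_convergence_17 {n m : ℕ}
    (F f : Eu n → Eu m → ℝ)
    (hF : ContDiff ℝ 2 (Function.uncurry F))
    (hf : ContDiff ℝ 2 (Function.uncurry f))
    (LFx1 LFx2 LFy1 LFy2 Lfy1 Lfy2 LFxy1 LFxy2 Lfxy1 Lfxy2 LFyy1 LFyy2 Lfyy1 Lfyy2 : ℝ≥0)
    (hLFx1 : ∀ y, LipschitzWith LFx1 fun x => gradx F x y)
    (hLFx2 : ∀ x, LipschitzWith LFx2 fun y => gradx F x y)
    (hLFy1 : ∀ y, LipschitzWith LFy1 fun x => grady F x y)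
    (hLFy2 : ∀ x, LipschitzWith LFy2 fun y => grady F x y)
    (hLfy1 : ∀ y, LipschitzWith Lfy1 fun x => grady f x y)
    (hLfy2 : ∀ x, LipschitzWith Lfy2 fun y => grady f x y)
    (hLFxy1 : ∀ y, LipschitzWith LFxy1 fun x => hessxy F x y)
    (hLFxy2 : ∀ x, LipschitzWith LFxy2 fun y => hessxy F x y)
    (hLfxy1 : ∀ y, LipschitzWith Lfxy1 fun x => hessxy f x y)
    (hLfxy2 : ∀ x, LipschitzWith Lfxy2 fun y => hessxy f x y)
    (hLFyy1 : ∀ y, LipschitzWith LFyy1 fun x => hessyy F x y)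
    (hLFyy2 : ∀ x, LipschitzWith LFyy2 fun y => hessyy F x y)
    (hLfyy1 : ∀ y, LipschitzWith Lfyy1 fun x => hessyy f x y)
    (hLfyy2 : ∀ x, LipschitzWith Lfyy2 fun y => hessyy f x y)
    (σF : ℝ) (hσF : 0 < σF)
    (hFsc : ∀ x, StrongConvexOn univ σF (F x))
    (hfconv : ∀ x, ConvexOn ℝ univ (f x))
    (F0 : ℝ) (hF0 : ∀ x y, F0 ≤ F x y)
    (ystar : ℝ → Eu n → Eu m)
    (hmin : ∀ μ' ∈ Ioc (0 : ℝ) 1, ∀ x y,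
      aggreg μ' F f x (ystar μ' x) ≤ aggreg μ' F f x y)
    (vstar : ℝ → Eu n → Eu m)
    (hvstar : ∀ μ' x, vstar μ' x =
      (hessyy (aggreg μ' F f) x (ystar μ' x)).inverse (grady F x (ystar μ' x)))
    -- parameters and step sizes
    (p τ μbar βbar : ℝ)
    (hp : 0 < p) (hp' : p < 1 / 4) (hτ : 0 < τ) (hτ' : τ < 1 / 12)
    (hμbar : 0 < μbar) (hμbar' : μbar ≤ 1 / 2) (hβbar : 0 < βbar)
    (μ α β η : ℕ → ℝ) (x : ℕ → Eu n) (y v : ℕ → Eu m)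
    (hμ : ∀ k : ℕ, μ k = μbar * ((k : ℝ) + 1) ^ (-p))
    (hβ : ∀ k : ℕ, β k ∈
      Icc (βbar * ((k : ℝ) + 1) ^ (-(τ / 2))) (1 / ((LFy2 : ℝ) + (Lfy2 : ℝ))))
    (hη : ∀ k : ℕ, η k = ((k : ℝ) + 1) ^ (-(τ / 2)) * β k)
    (hα : ∀ k : ℕ, α k = ((k : ℝ) + 1) ^ (-(3 * τ / 2)) * β k * μ k ^ 3)
    -- the sl-BAMM iterates
    (hy : ∀ k, y (k + 1) = y k - β k • grady (aggreg (μ k) F f) (x k) (y k))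
    (hv : ∀ k, v (k + 1) = v k + η k •
      (grady F (x k) (y k) - hessyy (aggreg (μ k) F f) (x k) (y k) (v k)))
    (hx : ∀ k, x (k + 1) = x k - α k •
      (gradx F (x k) (y k) - hessxy (aggreg (μ k) F f) (x k) (y k) (v k)))
    -- the stationarity measure Π
    (Pi : ℕ → ℝ)
    (hPi : ∀ k, Pi k =
      ‖gradient (fun x' => F x' (ystar (μ k) x')) (x k)‖ ^ 2 +
      ‖x (k + 1) - x k‖ ^ 2 +
      ‖y k - ystar (μ k) (x k)‖ ^ 2 +
      ‖v k - vstar (μ k) (x k)‖ ^ 2) :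
    ((∃ D : ℝ, ∀ k, ‖vstar (μ k) (x k)‖ ≤ D) →
      ∃ C > (0 : ℝ), ∀ K : ℕ, 1 ≤ K → ∃ k ≤ K,
        Pi k ≤ C * (K : ℝ) ^ (-(1 - 3 * p - 3 * τ))) ∧
    ((∃ D : ℝ, ∀ k, ‖vstar (μ k) (x k)‖ ≤ D) → (∃ Dv : ℝ, ∀ k, ‖v k‖ ≤ Dv) →
      (∃ C' > (0 : ℝ), ∀ K : ℕ, 1 ≤ K → ∃ k ≤ K,
        KKTres F f (x k) (y k) (v k) ≤
          C' * ((K : ℝ) ^ (-(1 - 3 * p - 3 * τ)) + (K : ℝ) ^ (-(2 * p)))) ∧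
      (∀ pt : Eu n × Eu m, MapClusterPt pt atTop (fun k => (x k, y k)) →
        ∃ w : Eu m, KKTres F f pt.1 pt.2 w = 0) ∧
      ((fun k : ℕ => ‖x (k + 1) - x k‖) =O[atTop]
        fun k : ℕ => (k : ℝ) ^ (-(3 * p / 2 + τ / 4)))) := by
  set M : ℝ := (LFx1 : ℝ) + LFx2 + LFy1 + LFy2 + Lfy1 + Lfy2 + LFxy1 + LFxy2 + Lfxy1 + Lfxy2 +
    LFyy1 + LFyy2 + Lfyy1 + Lfyy2 with hM
  have P : BAMM.Problem F f ystar vstar σF M ((LFy2 : ℝ) + Lfy2) := by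
    have n1 := LFx1.coe_nonneg
    have n2 := LFx2.coe_nonneg
    have n3 := LFy1.coe_nonneg
    have n4 := LFy2.coe_nonneg
    have n5 := Lfy1.coe_nonneg
    have n6 := Lfy2.coe_nonneg
    have n7 := LFxy1.coe_nonneg
    have n8 := LFxy2.coe_nonneg
    have n9 := Lfxy1.coe_nonneg
    have n10 := Lfxy2.coe_nonneg
    have n11 := LFyy1.coe_nonneg
    have n12 := LFyy2.coe_nonneg
    have n13 := Lfyy1.coe_nonneg
    have n14 := Lfyy2.coe_nonneg
    exact {
      contDiff_F := hF
      contDiff_f := hf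
      lip_gradx_F := .of_lipschitzWith hLFx1 hLFx2 (by linarith) (by linarith)
      lip_grady_F := .of_lipschitzWith hLFy1 hLFy2 (by linarith) (by linarith)
      lip_grady_f := .of_lipschitzWith hLfy1 hLfy2 (by linarith) (by linarith)
      lip_hessxy_F := .of_lipschitzWith hLFxy1 hLFxy2 (by linarith) (by linarith)
      lip_hessxy_f := .of_lipschitzWith hLfxy1 hLfxy2 (by linarith) (by linarith)
      lip_hessyy_F := .of_lipschitzWith hLFyy1 hLFyy2 (by linarith) (by linarith)
      lip_hessyy_f := .of_lipschitzWith hLfyy1 hLfyy2 (by linarith) (by linarith)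
      norm_hessxy_F := fun a b => (BAMM.norm_hessxy_le LFy1 hLFy1 a b).trans (by linarith)
      norm_hessxy_f := fun a b => (BAMM.norm_hessxy_le Lfy1 hLfy1 a b).trans (by linarith)
      norm_hessyy_F := fun a b => (BAMM.norm_hessyy_le LFy2 hLFy2 a b).trans (by linarith)
      norm_hessyy_f := fun a b => (BAMM.norm_hessyy_le Lfy2 hLfy2 a b).trans (by linarith)
      norm_hessyy_add := fun a b => add_le_add (BAMM.norm_hessyy_le LFy2 hLFy2 a b)
        (BAMM.norm_hessyy_le Lfy2 hLfy2 a b)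
      M_nonneg := by linarith
      σ_pos := hσF
      strongConvex := hFsc
      convex := hfconv
      isMin := hmin
      vstar_eq := hvstar }
  have hrun : ∀ D, (∀ k, ‖vstar (μ k) (x k)‖ ≤ D) →
      BAMM.Run F f ystar vstar ((LFy2 : ℝ) + Lfy2) D (1 / ((LFy2 : ℝ) + Lfy2)) 1 p τ μbar βbar
        μ β x y v := fun D hD =>
    .of_stepSizes hp hp' hτ hτ' hμbar hμbar' hβbar hμ hβ hη hα hy hv hx hD
  refine ⟨fun ⟨D, hD⟩ => ?_, fun ⟨D, hD⟩ ⟨Dv, hDv⟩ => ⟨?_, fun pt hpt => ?_, ?_⟩⟩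
  · obtain ⟨C, hC, h⟩ := (hrun D hD).exists_stationarity_le P hF0
    refine ⟨C, hC, fun K hK => ?_⟩
    obtain ⟨k, hkK, -, hk⟩ := h K hK
    refine ⟨k, hkK, ?_⟩
    rwa [hPi, (P.hasGradientAt_gradPhi ((hrun D hD).step k).mem (x k)).gradient]
  · exact (hrun D hD).exists_KKTres_rate P hF0 hDv
  · exact (hrun D hD).exists_KKTres_eq_zero P hF0 hpt
  · exact (hrun D hD).isBigO_norm_sub P hF0
end
end

section
/- Under the smoothness and convexity assumptions, suppose the sequences (x_k), (y_k), (v_k) and (v*_{μ_k}(x_k)) are all bounded and μ_k ∈ (0, 1/2]. Then there exists a positive constant C, independent of k, such that for all k: KKT(x_k, y_k, v_k) ≤ C(‖∇Φ_{μ_k}(x_k)‖² + ‖y_k − y*_{μ_k}(x_k)‖² + ‖v_k − v*_{μ_k}(x_k)‖² + μ_k²). -/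
open Set Filter Asymptotics
open scoped NNReal

noncomputable section

variable {n m : ℕ}

section StrongConvexity

variable {E : Type*} [NormedAddCommGroup E] [InnerProductSpace ℝ E]

/-- First-order lower bound for a strongly convex function. -/
lemma StrongConvexOn.add_fderiv_add_sq_le {s : ℝ} {g : E → ℝ} (hg : StrongConvexOn univ s g)
    {a : E} (hd : DifferentiableAt ℝ g a) (b : E) :
    g a + fderiv ℝ g a (b - a) + s / 2 * ‖b - a‖ ^ 2 ≤ g b := by
  have hline : HasDerivAt (fun t : ℝ => g (a + t • (b - a))) (fderiv ℝ g a (b - a)) 0 := by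
    have h1 : HasDerivAt (fun t : ℝ => a + t • (b - a)) (b - a) 0 := by
      simpa using ((hasDerivAt_id (0 : ℝ)).smul_const (b - a)).const_add a
    have h2 : HasFDerivAt g (fderiv ℝ g a) (a + (0 : ℝ) • (b - a)) := by
      simpa using hd.hasFDerivAt
    exact h2.comp_hasDerivAt (0 : ℝ) h1
  have hslope := hline.tendsto_slope_zero_right
  have hbound : Tendsto (fun t : ℝ => g b - g a - (1 - t) * (s / 2 * ‖b - a‖ ^ 2))
      (nhdsWithin 0 (Ioi 0)) (nhds (g b - g a - (1 - 0) * (s / 2 * ‖b - a‖ ^ 2))) :=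
    Tendsto.mono_left (Continuous.tendsto (by fun_prop) 0) nhdsWithin_le_nhds
  have hle := le_of_tendsto_of_tendsto hslope hbound (by
    filter_upwards [Ioo_mem_nhdsGT (zero_lt_one' ℝ)] with t ht
    have h := hg.2 (mem_univ a) (mem_univ b) (sub_nonneg.2 ht.2.le) ht.1.le (by ring)
    have hpt : (1 - t) • a + t • b = a + t • (b - a) := by module
    rw [hpt, norm_sub_rev] at h
    simp only [zero_add, zero_smul, add_zero, smul_eq_mul] at h ⊢
    rw [inv_mul_le_iff₀ ht.1]
    nlinarith [h])
  linarith

/-- The gradient of a differentiable strongly convex function is strongly monotone. -/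
lemma StrongConvexOn.mul_sq_le_inner_gradient_sub [CompleteSpace E] {s : ℝ} {g : E → ℝ}
    (hg : StrongConvexOn univ s g) (hd : Differentiable ℝ g) (a b : E) :
    s * ‖b - a‖ ^ 2 ≤ inner ℝ (gradient g b - gradient g a) (b - a) := by
  have h1 := hg.add_fderiv_add_sq_le (hd a) b
  have h2 := hg.add_fderiv_add_sq_le (hd b) a
  have h3 : fderiv ℝ g b (a - b) = -fderiv ℝ g b (b - a) := by rw [← map_neg, neg_sub]
  rw [norm_sub_rev a b, h3] at h2
  simp only [inner_sub_left, inner_gradient_left]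
  linarith

end StrongConvexity

/-- A function implicitly defined by `G (x, y x) = 0` that is Lipschitz at a point is
differentiable there. -/
lemma hasFDerivAt_of_implicit {E H K : Type*} [NormedAddCommGroup E] [NormedSpace ℝ E]
    [NormedAddCommGroup H] [NormedSpace ℝ H] [NormedAddCommGroup K] [NormedSpace ℝ K]
    {G : E × H → K} {y : E → H} {x : E} {A : E →L[ℝ] K} (e : H ≃L[ℝ] K)
    (hG : HasFDerivAt G (A.coprod (e : H →L[ℝ] K)) (x, y x)) (hzero : ∀ x', G (x', y x') = 0)
    (hy : (fun x' => y x' - y x) =O[nhds x] fun x' => x' - x) :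
    HasFDerivAt y (-((e.symm : K →L[ℝ] H).comp A)) x := by
  have hcont : Tendsto y (nhds x) (nhds (y x)) := by
    have h := hy.trans_tendsto (tendsto_sub_nhds_zero_iff.2 tendsto_id)
    exact tendsto_sub_nhds_zero_iff.1 h
  have hpair : Tendsto (fun x' => (x', y x')) (nhds x) (nhds (x, y x)) :=
    tendsto_id.prodMk_nhds hcont
  have hlin : (fun x' => A (x' - x) + e (y x' - y x)) =o[nhds x] fun x' => x' - x := by
    have h := (hasFDerivAt_iff_isLittleO.1 hG).comp_tendsto hpair
    have hO : (fun x' => (x', y x') - (x, y x)) =O[nhds x] fun x' => x' - x :=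
      (isBigO_refl _ _).prod_left hy
    refine (h.trans_isBigO hO).neg_left.congr_left fun x' => ?_
    simp [hzero]
  rw [hasFDerivAt_iff_isLittleO]
  refine ((e.symm : K →L[ℝ] H).isBigO_comp _ _).trans_isLittleO hlin |>.congr_left fun x' => ?_
  simp
  abel

section PartialDerivatives

variable {ψ : Eu n → Eu m → ℝ}

lemma grady_eq (hψ : ContDiff ℝ 2 (Function.uncurry ψ)) (x : Eu n) (y : Eu m) :
    grady ψ x y = (InnerProductSpace.toDual ℝ (Eu m)).symm
      ((fderiv ℝ (Function.uncurry ψ) (x, y)).comp (ContinuousLinearMap.inr ℝ (Eu n) (Eu m))) := by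
  have h := (hψ.differentiable (by norm_num) (x, y)).hasFDerivAt.comp y
    (hasFDerivAt_prodMk_right x y)
  exact congrArg (InnerProductSpace.toDual ℝ (Eu m)).symm h.fderiv

lemma gradx_eq (hψ : ContDiff ℝ 2 (Function.uncurry ψ)) (x : Eu n) (y : Eu m) :
    gradx ψ x y = (InnerProductSpace.toDual ℝ (Eu n)).symm
      ((fderiv ℝ (Function.uncurry ψ) (x, y)).comp (ContinuousLinearMap.inl ℝ (Eu n) (Eu m))) := by
  have h := (hψ.differentiable (by norm_num) (x, y)).hasFDerivAt.comp (f := fun x' => (x', y)) x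
    (hasFDerivAt_prodMk_left x y)
  exact congrArg (InnerProductSpace.toDual ℝ (Eu n)).symm h.fderiv

lemma fderiv_uncurry_apply (hψ : ContDiff ℝ 2 (Function.uncurry ψ)) (x : Eu n) (y : Eu m)
    (u : Eu n) (w : Eu m) :
    fderiv ℝ (Function.uncurry ψ) (x, y) (u, w) =
      inner ℝ (gradx ψ x y) u + inner ℝ (grady ψ x y) w := by
  rw [gradx_eq hψ, grady_eq hψ, InnerProductSpace.toDual_symm_apply,
    InnerProductSpace.toDual_symm_apply]
  simp [← map_add]

lemma contDiff_grady (hψ : ContDiff ℝ 2 (Function.uncurry ψ)) :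
    ContDiff ℝ 1 (Function.uncurry (grady ψ)) := by
  have h : Function.uncurry (grady ψ) = fun p => (InnerProductSpace.toDual ℝ (Eu m)).symm
      ((fderiv ℝ (Function.uncurry ψ) p).comp (ContinuousLinearMap.inr ℝ (Eu n) (Eu m))) :=
    funext fun p => grady_eq hψ p.1 p.2
  rw [h]
  exact (InnerProductSpace.toDual ℝ (Eu m)).symm.contDiff.comp
    ((hψ.fderiv_right (by norm_num)).clm_comp contDiff_const)

lemma hasFDerivAt_grady_left (hψ : ContDiff ℝ 2 (Function.uncurry ψ)) (x : Eu n) (y : Eu m) :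
    HasFDerivAt (fun x' => grady ψ x' y) (ContinuousLinearMap.adjoint (hessxy ψ x y)) x := by
  rw [hessxy, ContinuousLinearMap.adjoint_adjoint]
  exact (((contDiff_grady hψ).differentiable (by norm_num) (x, y)).comp (f := fun x' => (x', y)) x
    (hasFDerivAt_prodMk_left x y).differentiableAt).hasFDerivAt

lemma hasFDerivAt_grady_right (hψ : ContDiff ℝ 2 (Function.uncurry ψ)) (x : Eu n) (y : Eu m) :
    HasFDerivAt (fun y' => grady ψ x y') (hessyy ψ x y) y :=
  (((contDiff_grady hψ).differentiable (by norm_num) (x, y)).comp y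
    (hasFDerivAt_prodMk_right x y).differentiableAt).hasFDerivAt

lemma hasFDerivAt_grady (hψ : ContDiff ℝ 2 (Function.uncurry ψ)) (x : Eu n) (y : Eu m) :
    HasFDerivAt (Function.uncurry (grady ψ))
      ((ContinuousLinearMap.adjoint (hessxy ψ x y)).coprod (hessyy ψ x y)) (x, y) := by
  have hd := ((contDiff_grady hψ).differentiable (by norm_num) (x, y)).hasFDerivAt
  have hl := (hd.comp (f := fun x' => (x', y)) x (hasFDerivAt_prodMk_left x y)).unique
    (hasFDerivAt_grady_left hψ x y)
  have hr := (hd.comp y (hasFDerivAt_prodMk_right x y)).unique (hasFDerivAt_grady_right hψ x y)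
  rw [← hl, ← hr]
  exact hd.congr_fderiv (ContinuousLinearMap.coprod_comp_inl_inr _).symm

lemma differentiable_right (hψ : ContDiff ℝ 2 (Function.uncurry ψ)) (x : Eu n) :
    Differentiable ℝ (ψ x) := fun y =>
  (hψ.differentiable (by norm_num) (x, y)).comp y (hasFDerivAt_prodMk_right x y).differentiableAt

lemma inner_hessyy_comm (hψ : ContDiff ℝ 2 (Function.uncurry ψ)) (x : Eu n) (y u w : Eu m) :
    inner ℝ (hessyy ψ x y u) w = inner ℝ u (hessyy ψ x y w) := by
  have hc : ContDiff ℝ 2 (ψ x) := hψ.comp (contDiff_prodMk_right x)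
  have hsnd : ∀ a b, fderiv ℝ (fderiv ℝ (ψ x)) y a b = inner ℝ (hessyy ψ x y a) b := by
    intro a b
    have h1 : HasFDerivAt (fun y' => fderiv ℝ (ψ x) y' b)
        ((fderiv ℝ (fderiv ℝ (ψ x)) y).flip b) y := by
      have hd := ((hc.fderiv_right (m := 1) (by norm_num)).differentiable (by norm_num)
        y).hasFDerivAt
      simpa using hd.clm_apply (hasFDerivAt_const b y)
    have h2 := (hasFDerivAt_grady_right hψ x y).inner ℝ (hasFDerivAt_const b y)
    have h3 : (fun y' => inner ℝ (grady ψ x y') b) = fun y' => fderiv ℝ (ψ x) y' b :=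
      funext fun y' => inner_gradient_left
    rw [h3] at h2
    simpa using congrArg (fun T => T a) (h1.unique h2)
  have hs := hc.contDiffAt.isSymmSndFDerivAt (x := y) (by simp) u w
  rw [hsnd, hsnd] at hs
  rw [hs, real_inner_comm]

lemma hessyy_injective (hψ : ContDiff ℝ 2 (Function.uncurry ψ)) {s : ℝ} (hs : 0 < s) (x : Eu n)
    (hsc : StrongConvexOn univ s (ψ x)) (y : Eu m) :
    Function.Injective (hessyy ψ x y) := by
  rw [injective_iff_map_eq_zero]
  intro w hw
  have hline : HasDerivAt (fun t : ℝ => grady ψ x (y + t • w)) 0 0 := by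
    have h1 : HasDerivAt (fun t : ℝ => y + t • w) w 0 := by
      simpa using ((hasDerivAt_id (0 : ℝ)).smul_const w).const_add y
    have h2 : HasFDerivAt (grady ψ x) (hessyy ψ x y) (y + (0 : ℝ) • w) := by
      simpa using hasFDerivAt_grady_right hψ x y
    exact (h2.comp_hasDerivAt (0 : ℝ) h1).congr_deriv hw
  have hlim : Tendsto (fun t : ℝ => inner ℝ
      (t⁻¹ • (grady ψ x (y + (0 + t) • w) - grady ψ x (y + (0 : ℝ) • w))) w)
      (nhdsWithin 0 (Ioi 0)) (nhds (inner ℝ (0 : Eu m) w)) :=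
    hline.tendsto_slope_zero_right.inner tendsto_const_nhds
  have hle : s * ‖w‖ ^ 2 ≤ inner ℝ (0 : Eu m) w := by
    refine ge_of_tendsto hlim ?_
    filter_upwards [self_mem_nhdsWithin] with t (ht : 0 < t)
    have h := hsc.mul_sq_le_inner_gradient_sub (differentiable_right hψ x) y (y + t • w)
    rw [add_sub_cancel_left, norm_smul, inner_smul_right, Real.norm_of_nonneg ht.le] at h
    simp only [zero_add, zero_smul, add_zero, real_inner_smul_left]
    rw [← div_eq_inv_mul, le_div_iff₀ ht]
    refine le_of_mul_le_mul_left ?_ ht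
    calc t * (s * ‖w‖ ^ 2 * t) = s * (t * ‖w‖) ^ 2 := by ring
      _ ≤ _ := h
  rw [inner_zero_left] at hle
  have h0 : ‖w‖ ^ 2 ≤ 0 := by
    by_contra! h
    nlinarith [mul_pos hs h]
  simpa using le_antisymm h0 (sq_nonneg _)

lemma hessyy_isInvertible (hψ : ContDiff ℝ 2 (Function.uncurry ψ)) {s : ℝ} (hs : 0 < s)
    (x : Eu n) (hsc : StrongConvexOn univ s (ψ x)) (y : Eu m) :
    (hessyy ψ x y).IsInvertible := by
  have hinj := hessyy_injective hψ hs x hsc y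
  refine ⟨(LinearEquiv.ofInjectiveEndo (hessyy ψ x y : Eu m →ₗ[ℝ] Eu m)
    hinj).toContinuousLinearEquiv, ?_⟩
  ext w
  simp

lemma grady_eq_zero_of_forall_le {x : Eu n} {y : Eu m} (hy : ∀ y', ψ x y ≤ ψ x y') :
    grady ψ x y = 0 := by
  have h : fderiv ℝ (ψ x) y = 0 :=
    IsLocalMin.fderiv_eq_zero (Eventually.of_forall hy)
  simp [grady, gradient, h]

/-- Minimizers of a uniformly strongly convex family are Lipschitz at every parameter. -/
lemma isBigO_minimizer_sub (hψ : ContDiff ℝ 2 (Function.uncurry ψ)) {s : ℝ} (hs : 0 < s)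
    (hsc : ∀ x, StrongConvexOn univ s (ψ x)) {y : Eu n → Eu m}
    (hy : ∀ x, grady ψ x (y x) = 0) (x : Eu n) :
    (fun x' => y x' - y x) =O[nhds x] fun x' => x' - x := by
  have hG := (hasFDerivAt_grady_left hψ x (y x)).isBigO_sub
  refine IsBigO.trans (IsBigO.of_bound s⁻¹ (Eventually.of_forall fun x' => ?_)) hG
  have h := (hsc x').mul_sq_le_inner_gradient_sub (differentiable_right hψ x') (y x) (y x')
  have hy' : gradient (ψ x') (y x') = 0 := hy x'
  have h2 : s * ‖y x' - y x‖ ^ 2 ≤ ‖grady ψ x' (y x)‖ * ‖y x' - y x‖ := by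
    refine h.trans ((real_inner_le_norm _ _).trans_eq ?_)
    rw [hy', zero_sub, norm_neg]
    rfl
  rw [hy x, sub_zero, ← div_eq_inv_mul, le_div_iff₀ hs]
  rcases (norm_nonneg (y x' - y x)).eq_or_lt with h0 | h0
  · rw [← h0, zero_mul]
    exact norm_nonneg _
  · refine le_of_mul_le_mul_right ?_ h0
    linarith

/-- Hypergradient formula for a smooth function evaluated at the minimizer of a smooth strongly
convex family. -/
lemma gradient_comp_minimizer {F : Eu n → Eu m → ℝ} (hF : ContDiff ℝ 2 (Function.uncurry F))
    (hψ : ContDiff ℝ 2 (Function.uncurry ψ)) {s : ℝ} (hs : 0 < s)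
    (hsc : ∀ x, StrongConvexOn univ s (ψ x)) {y : Eu n → Eu m}
    (hy : ∀ x, grady ψ x (y x) = 0) {x : Eu n} {v : Eu m}
    (hv : hessyy ψ x (y x) v = grady F x (y x)) :
    gradient (fun x' => F x' (y x')) x = gradx F x (y x) - hessxy ψ x (y x) v := by
  obtain ⟨e, he⟩ := hessyy_isInvertible hψ hs x (hsc x) (y x)
  have hG := hasFDerivAt_grady hψ x (y x)
  rw [← he] at hG
  have hdy := hasFDerivAt_of_implicit e hG hy (isBigO_minimizer_sub hψ hs hsc hy x)
  have hΦ := (hF.differentiable (by norm_num) (x, y x)).hasFDerivAt.comp x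
    ((hasFDerivAt_id x).prodMk hdy)
  refine HasGradientAt.gradient (hasGradientAt_iff_hasFDerivAt.2 (hΦ.congr_fderiv ?_))
  ext u
  have hsymm := inner_hessyy_comm hψ x (y x) v
    (e.symm (ContinuousLinearMap.adjoint (hessxy ψ x (y x)) u))
  rw [hv, ← he] at hsymm
  simp only [ContinuousLinearMap.comp_apply, ContinuousLinearMap.prod_apply,
    fderiv_uncurry_apply hF, neg_apply, ContinuousLinearMap.id_apply,
    InnerProductSpace.toDual_apply_apply, inner_sub_left, inner_neg_right,
    ContinuousLinearEquiv.coe_coe]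
  rw [hsymm]
  simp [ContinuousLinearMap.adjoint_inner_right, sub_eq_add_neg]

end PartialDerivatives

section Aggregation

variable {F f : Eu n → Eu m → ℝ}

lemma contDiff_aggreg (hF : ContDiff ℝ 2 (Function.uncurry F))
    (hf : ContDiff ℝ 2 (Function.uncurry f)) (μ : ℝ) :
    ContDiff ℝ 2 (Function.uncurry (aggreg μ F f)) :=
  (contDiff_const.mul hF).add (contDiff_const.mul hf)

lemma grady_aggreg (hF : ContDiff ℝ 2 (Function.uncurry F))
    (hf : ContDiff ℝ 2 (Function.uncurry f)) (μ : ℝ) (x : Eu n) (y : Eu m) :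
    grady (aggreg μ F f) x y = μ • grady F x y + (1 - μ) • grady f x y := by
  have h := ((differentiable_right hF x y).hasFDerivAt.const_mul μ).add
    ((differentiable_right hf x y).hasFDerivAt.const_mul (1 - μ))
  refine (congrArg (InnerProductSpace.toDual ℝ (Eu m)).symm h.fderiv).trans ?_
  simp [grady, gradient]

lemma hessyy_aggreg (hF : ContDiff ℝ 2 (Function.uncurry F))
    (hf : ContDiff ℝ 2 (Function.uncurry f)) (μ : ℝ) (x : Eu n) (y : Eu m) :
    hessyy (aggreg μ F f) x y = μ • hessyy F x y + (1 - μ) • hessyy f x y := by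
  have h := ((hasFDerivAt_grady_right hF x y).const_smul μ).add
    ((hasFDerivAt_grady_right hf x y).const_smul (1 - μ))
  refine HasFDerivAt.fderiv (h.congr_of_eventuallyEq (Eventually.of_forall fun y' => ?_))
  exact grady_aggreg hF hf μ x y'

lemma hessxy_aggreg (hF : ContDiff ℝ 2 (Function.uncurry F))
    (hf : ContDiff ℝ 2 (Function.uncurry f)) (μ : ℝ) (x : Eu n) (y : Eu m) :
    hessxy (aggreg μ F f) x y = μ • hessxy F x y + (1 - μ) • hessxy f x y := by
  have h := ((hasFDerivAt_grady_left hF x y).const_smul μ).add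
    ((hasFDerivAt_grady_left hf x y).const_smul (1 - μ))
  have h' : fderiv ℝ (fun x' => grady (aggreg μ F f) x' y) x = _ :=
    HasFDerivAt.fderiv (h.congr_of_eventuallyEq (Eventually.of_forall fun x' =>
      grady_aggreg hF hf μ x' y))
  rw [hessxy, h']
  simp

lemma strongConvexOn_aggreg {σ μ : ℝ} (h0 : 0 < μ) (h1 : μ ≤ 1) (x : Eu n)
    (hF : StrongConvexOn univ σ (F x)) (hf : ConvexOn ℝ univ (f x)) :
    StrongConvexOn univ (μ * σ) (aggreg μ F f x) := by
  refine ⟨convex_univ, fun a _ b _ s t hs ht hst => ?_⟩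
  have h2 := mul_le_mul_of_nonneg_left (hF.2 (mem_univ a) (mem_univ b) hs ht hst) h0.le
  have h3 := mul_le_mul_of_nonneg_left (hf.2 (mem_univ a) (mem_univ b) hs ht hst)
    (sub_nonneg.2 h1)
  simp only [aggreg, smul_eq_mul] at *
  linarith

lemma norm_hessxy_le {L : ℝ≥0} {x : Eu n} {y : Eu m}
    (h : LipschitzWith L fun x' => grady f x' y) : ‖hessxy f x y‖ ≤ L := by
  rw [hessxy, LinearIsometryEquiv.norm_map]
  exact norm_fderiv_le_of_lipschitz ℝ h

/-- Perturbation bound for the residual `u - Q v` around the regularized system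
`z = u' - (μ P + (1 - μ) Q') w`. -/
lemma norm_sub_apply_le {X Y : Type*} [NormedAddCommGroup X] [NormedSpace ℝ X]
    [NormedAddCommGroup Y] [NormedSpace ℝ Y] {P Q Q' : X →L[ℝ] Y} {u u' z : Y} {v w : X}
    {μ b K L L' D : ℝ} (hμ : 0 ≤ μ) (hz : z = u' - (μ • P + (1 - μ) • Q') w)
    (hu : ‖u - u'‖ ≤ L * b) (hQ : ‖Q - Q'‖ ≤ L' * b) (hP : ‖P - Q'‖ ≤ K) (hQK : ‖Q‖ ≤ K)
    (hw : ‖w‖ ≤ D) :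
    ‖u - Q v‖ ≤ ‖z‖ + (L + L' * D) * b + K * ‖v - w‖ + K * D * μ := by
  have hD : 0 ≤ D := (norm_nonneg w).trans hw
  have hsplit : u - Q v = z + (u - u') - (Q - Q') w - Q (v - w) + μ • (P - Q') w := by
    subst hz
    simp only [add_apply, smul_apply,
      sub_apply, map_sub]
    module
  have h1 : ‖(Q - Q') w‖ ≤ L' * b * D := ContinuousLinearMap.le_of_opNorm_le_of_le _ hQ hw
  have h2 : ‖Q (v - w)‖ ≤ K * ‖v - w‖ := Q.le_of_opNorm_le hQK _
  have h3 : ‖μ • (P - Q') w‖ ≤ μ * (K * D) := by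
    rw [norm_smul, Real.norm_of_nonneg hμ]
    exact mul_le_mul_of_nonneg_left (ContinuousLinearMap.le_of_opNorm_le_of_le _ hP hw) hμ
  calc ‖u - Q v‖ ≤ ‖z‖ + ‖u - u'‖ + ‖(Q - Q') w‖ + ‖Q (v - w)‖ + ‖μ • (P - Q') w‖ := by
        rw [hsplit]
        refine (norm_add_le _ _).trans (add_le_add_left ?_ _)
        refine (norm_sub_le _ _).trans (add_le_add_left ?_ _)
        refine (norm_sub_le _ _).trans (add_le_add_left ?_ _)
        exact norm_add_le _ _
    _ ≤ _ := by linarith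

/-- Along a regularized lower-level stationary point, the lower-level gradient is of order `μ`. -/
lemma norm_grady_le_of_aggreg {μ L L' B : ℝ} (hμ : μ ∈ Ioc (0 : ℝ) (1 / 2)) {x : Eu n}
    {y y' : Eu m} (hy' : μ • grady F x y' + (1 - μ) • grady f x y' = 0)
    (hF : ‖grady F x y - grady F x y'‖ ≤ L' * ‖y - y'‖)
    (hf : ‖grady f x y - grady f x y'‖ ≤ L * ‖y - y'‖) (hB : ‖grady F x y‖ ≤ B) :
    ‖grady f x y‖ ≤ (L + L') * ‖y - y'‖ + 2 * B * μ := by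
  have h1 : ‖grady F x y'‖ ≤ B + L' * ‖y - y'‖ := by
    have := norm_le_norm_add_norm_sub (grady F x y) (grady F x y')
    linarith
  have h2 : (1 - μ) * ‖grady f x y'‖ = μ * ‖grady F x y'‖ := by
    have h := congrArg norm (eq_neg_of_add_eq_zero_right hy')
    rwa [norm_neg, norm_smul, norm_smul, Real.norm_of_nonneg hμ.1.le,
      Real.norm_of_nonneg (by linarith [hμ.2])] at h
  have h3 : ‖grady f x y'‖ ≤ 2 * μ * ‖grady F x y'‖ := by
    nlinarith [norm_nonneg (grady f x y'), hμ.2]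
  have h4 : 2 * μ * ‖grady F x y'‖ ≤ 2 * B * μ + L' * ‖y - y'‖ := by
    have h5 : 0 ≤ L' * ‖y - y'‖ := (norm_nonneg _).trans hF
    nlinarith [mul_le_mul_of_nonneg_left h1 hμ.1.le, hμ.2]
  have h6 := norm_le_norm_add_norm_sub' (grady f x y) (grady f x y')
  linarith

end Aggregation

/-- the KKT residual along bounded iterates is controlled by the
stationarity measures of sl-BAMM, up to `μ_k²`. -/
theorem kkt_residual_bound {n m : ℕ}
    (F f : Eu n → Eu m → ℝ)
    (hF : ContDiff ℝ 2 (Function.uncurry F))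
    (hf : ContDiff ℝ 2 (Function.uncurry f))
    (LFx1 LFx2 LFy1 LFy2 Lfy1 Lfy2 LFxy1 LFxy2 Lfxy1 Lfxy2 LFyy1 LFyy2 Lfyy1 Lfyy2 : ℝ≥0)
    (hLFx1 : ∀ y, LipschitzWith LFx1 fun x => gradx F x y)
    (hLFx2 : ∀ x, LipschitzWith LFx2 fun y => gradx F x y)
    (hLFy1 : ∀ y, LipschitzWith LFy1 fun x => grady F x y)
    (hLFy2 : ∀ x, LipschitzWith LFy2 fun y => grady F x y)
    (hLfy1 : ∀ y, LipschitzWith Lfy1 fun x => grady f x y)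
    (hLfy2 : ∀ x, LipschitzWith Lfy2 fun y => grady f x y)
    (hLFxy1 : ∀ y, LipschitzWith LFxy1 fun x => hessxy F x y)
    (hLFxy2 : ∀ x, LipschitzWith LFxy2 fun y => hessxy F x y)
    (hLfxy1 : ∀ y, LipschitzWith Lfxy1 fun x => hessxy f x y)
    (hLfxy2 : ∀ x, LipschitzWith Lfxy2 fun y => hessxy f x y)
    (hLFyy1 : ∀ y, LipschitzWith LFyy1 fun x => hessyy F x y)
    (hLFyy2 : ∀ x, LipschitzWith LFyy2 fun y => hessyy F x y)
    (hLfyy1 : ∀ y, LipschitzWith Lfyy1 fun x => hessyy f x y)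
    (hLfyy2 : ∀ x, LipschitzWith Lfyy2 fun y => hessyy f x y)
    (σF : ℝ) (hσF : 0 < σF)
    (hFsc : ∀ x, StrongConvexOn univ σF (F x))
    (hfconv : ∀ x, ConvexOn ℝ univ (f x))
    (ystar : ℝ → Eu n → Eu m)
    (hmin : ∀ μ' ∈ Ioc (0 : ℝ) 1, ∀ x y,
      aggreg μ' F f x (ystar μ' x) ≤ aggreg μ' F f x y)
    (vstar : ℝ → Eu n → Eu m)
    (hvstar : ∀ μ' x, vstar μ' x =
      (hessyy (aggreg μ' F f) x (ystar μ' x)).inverse (grady F x (ystar μ' x)))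
    (μ : ℕ → ℝ) (hμ : ∀ k, μ k ∈ Ioc (0 : ℝ) (1 / 2))
    (x : ℕ → Eu n) (y v : ℕ → Eu m)
    (hxb : ∃ Dx : ℝ, ∀ k, ‖x k‖ ≤ Dx)
    (hyb : ∃ Dy : ℝ, ∀ k, ‖y k‖ ≤ Dy)
    (hvb : ∃ Dv : ℝ, ∀ k, ‖v k‖ ≤ Dv)
    (hvstarb : ∃ Dvs : ℝ, ∀ k, ‖vstar (μ k) (x k)‖ ≤ Dvs) :
    ∃ C > (0 : ℝ), ∀ k,
      KKTres F f (x k) (y k) (v k) ≤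
        C * (‖gradient (fun x' => F x' (ystar (μ k) x')) (x k)‖ ^ 2 +
          ‖y k - ystar (μ k) (x k)‖ ^ 2 +
          ‖v k - vstar (μ k) (x k)‖ ^ 2 + μ k ^ 2) := by
  obtain ⟨Dx, hDx⟩ := hxb
  obtain ⟨Dy, hDy⟩ := hyb
  obtain ⟨D, hD⟩ := hvstarb
  have hDx0 : 0 ≤ Dx := (norm_nonneg _).trans (hDx 0)
  have hDy0 : 0 ≤ Dy := (norm_nonneg _).trans (hDy 0)
  have hD0 : 0 ≤ D := (norm_nonneg _).trans (hD 0)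
  set B : ℝ := ‖grady F 0 0‖ + LFy1 * Dx + LFy2 * Dy
  have hB0 : 0 ≤ B := by positivity
  have hgradB : ∀ k, ‖grady F (x k) (y k)‖ ≤ B := fun k => by
    have h1 := (hLFy1 0).norm_sub_le (x k) 0
    have h2 := (hLFy2 (x k)).norm_sub_le (y k) 0
    have h3 := norm_le_norm_add_norm_sub' (grady F (x k) (y k)) (grady F (x k) 0)
    have h4 := norm_le_norm_add_norm_sub' (grady F (x k) 0) (grady F 0 0)
    rw [sub_zero] at h1 h2
    have h5 := mul_le_mul_of_nonneg_left (hDx k) LFy1.coe_nonneg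
    have h6 := mul_le_mul_of_nonneg_left (hDy k) LFy2.coe_nonneg
    linarith
  set M₁ : ℝ := 1 + (LFx2 + Lfxy2 * D) + (LFy1 + Lfy1) + (LFy1 + Lfy1) * D
  set M₂ : ℝ := (LFy2 + Lfyy2 * D) + (LFy2 + Lfy2) + (LFy2 + Lfy2) * D
  set M₃ : ℝ := (Lfy2 + LFy2) + 2 * B
  have hM₁0 : 0 < M₁ := by positivity
  refine ⟨4 * (M₁ ^ 2 + M₂ ^ 2 + M₃ ^ 2), by positivity, fun k => ?_⟩
  have hμ0 := (hμ k).1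
  have hμ1 : μ k ≤ 1 := (hμ k).2.trans (by norm_num)
  have hψ := contDiff_aggreg hF hf (μ k)
  have hsc := fun x => strongConvexOn_aggreg hμ0 hμ1 x (hFsc x) (hfconv x)
  have hs : 0 < μ k * σF := mul_pos hμ0 hσF
  have hstat : ∀ x, grady (aggreg (μ k) F f) x (ystar (μ k) x) = 0 := fun x =>
    grady_eq_zero_of_forall_le (hmin (μ k) ⟨hμ0, hμ1⟩ x)
  have hv : hessyy (aggreg (μ k) F f) (x k) (ystar (μ k) (x k)) (vstar (μ k) (x k)) =
      grady F (x k) (ystar (μ k) (x k)) :=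
    ((hessyy_isInvertible hψ hs (x k) (hsc (x k)) _).inverse_apply_eq.1
      (hvstar (μ k) (x k)).symm).symm
  have hgrad := gradient_comp_minimizer hF hψ hs hsc hstat hv
  rw [hessxy_aggreg hF hf] at hgrad
  rw [hessyy_aggreg hF hf] at hv
  have hstatk := hstat (x k)
  rw [grady_aggreg hF hf] at hstatk
  have hDk := hD k
  have hBk := hgradB k
  set z := gradient (fun x' => F x' (ystar (μ k) x')) (x k)
  set ys := ystar (μ k) (x k)
  set w := vstar (μ k) (x k)
  have hKxy : ‖hessxy F (x k) ys - hessxy f (x k) ys‖ ≤ LFy1 + Lfy1 :=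
    norm_sub_le_of_le (norm_hessxy_le (hLFy1 ys)) (norm_hessxy_le (hLfy1 ys))
  have hKyy : ‖hessyy F (x k) ys - hessyy f (x k) ys‖ ≤ LFy2 + Lfy2 :=
    norm_sub_le_of_le (norm_fderiv_le_of_lipschitz ℝ (hLFy2 (x k)))
      (norm_fderiv_le_of_lipschitz ℝ (hLfy2 (x k)))
  have hT₁ := norm_sub_apply_le (v := v k) hμ0.le hgrad
    ((hLFx2 (x k)).norm_sub_le (y k) ys) ((hLfxy2 (x k)).norm_sub_le (y k) ys)
    hKxy
    ((norm_hessxy_le (hLfy1 (y k))).trans (le_add_of_nonneg_left LFy1.coe_nonneg)) hDk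
  have hT₂ := norm_sub_apply_le (v := v k) hμ0.le (sub_eq_zero.2 hv.symm).symm
    ((hLFy2 (x k)).norm_sub_le (y k) ys) ((hLfyy2 (x k)).norm_sub_le (y k) ys)
    hKyy
    ((norm_fderiv_le_of_lipschitz ℝ (hLfy2 (x k))).trans
      (le_add_of_nonneg_left LFy2.coe_nonneg)) hDk
  have hT₃ := norm_grady_le_of_aggreg (hμ k) hstatk
    ((hLFy2 (x k)).norm_sub_le (y k) ys) ((hLfy2 (x k)).norm_sub_le (y k) ys) hBk
  rw [norm_zero, zero_add] at hT₂
  have hsum_le : ∀ {p q r t : ℝ}, 0 ≤ p → 0 ≤ q → 0 ≤ r → 0 ≤ t →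
      p * ‖z‖ + q * ‖y k - ys‖ + r * ‖v k - w‖ + t * μ k ≤
        (p + q + r + t) * (‖z‖ + ‖y k - ys‖ + ‖v k - w‖ + μ k) := by
    intro p q r t hp hq hr ht
    have ha := norm_nonneg z
    have hb := norm_nonneg (y k - ys)
    have hc := norm_nonneg (v k - w)
    rw [add_mul, add_mul, add_mul]
    refine add_le_add (add_le_add (add_le_add ?_ ?_) ?_) ?_ <;>
      exact mul_le_mul_of_nonneg_left (by linarith) (by assumption)
  have hsq : ∀ {T M : ℝ}, 0 ≤ T →
      T ≤ M * (‖z‖ + ‖y k - ys‖ + ‖v k - w‖ + μ k) →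
      T ^ 2 ≤ 4 * M ^ 2 * (‖z‖ ^ 2 + ‖y k - ys‖ ^ 2 + ‖v k - w‖ ^ 2 + μ k ^ 2) := by
    intro T M hT hTM
    have hsum : (‖z‖ + ‖y k - ys‖ + ‖v k - w‖ + μ k) ^ 2 ≤
        4 * (‖z‖ ^ 2 + ‖y k - ys‖ ^ 2 + ‖v k - w‖ ^ 2 + μ k ^ 2) := by
      nlinarith [sq_nonneg (‖z‖ - ‖y k - ys‖), sq_nonneg (‖z‖ - ‖v k - w‖),
        sq_nonneg (‖z‖ - μ k), sq_nonneg (‖y k - ys‖ - ‖v k - w‖),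
        sq_nonneg (‖y k - ys‖ - μ k), sq_nonneg (‖v k - w‖ - μ k)]
    calc T ^ 2 ≤ (M * (‖z‖ + ‖y k - ys‖ + ‖v k - w‖ + μ k)) ^ 2 := pow_le_pow_left₀ hT hTM 2
      _ = M ^ 2 * (‖z‖ + ‖y k - ys‖ + ‖v k - w‖ + μ k) ^ 2 := mul_pow _ _ 2
      _ ≤ M ^ 2 * (4 * (‖z‖ ^ 2 + ‖y k - ys‖ ^ 2 + ‖v k - w‖ ^ 2 + μ k ^ 2)) :=
        mul_le_mul_of_nonneg_left hsum (sq_nonneg M)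
      _ = _ := by ring
  have h₁ := hsq (M := M₁) (norm_nonneg _) (hT₁.trans ?_)
  have h₂ := hsq (M := M₂) (norm_nonneg _) (hT₂.trans ?_)
  have h₃ := hsq (M := M₃) (norm_nonneg _) (hT₃.trans ?_)
  · rw [KKTres]
    linarith
  · refine le_trans (le_of_eq ?_) ((hsum_le (p := 0) (q := Lfy2 + LFy2) (r := 0) (t := 2 * B)
      le_rfl (by positivity) le_rfl (by positivity)).trans_eq ?_) <;> ring
  · refine le_trans (le_of_eq ?_) ((hsum_le (p := 0) (q := LFy2 + Lfyy2 * D) (r := LFy2 + Lfy2)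
      (t := (LFy2 + Lfy2) * D) le_rfl (by positivity) (by positivity) (by positivity)).trans_eq
      ?_) <;> ring
  · refine le_trans (le_of_eq ?_) (hsum_le (p := 1) (q := LFx2 + Lfxy2 * D) (r := LFy1 + Lfy1)
      (t := (LFy1 + Lfy1) * D) zero_le_one (by positivity) (by positivity) (by positivity))
    ring
end
end
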